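/- Let f be a horizontal extension of an irrational rotation of 𝕋², f̂ : 𝔸 → 𝔸 a lift of f, and F : ℝ² → ℝ² a lift of f̂. Suppose ρ(F) = [ρ⁻, ρ⁺] × {α}. Then for all δ > 0 and ε > 0 there exist a closed essential topological annulus A ⊂ 𝔸, an essential simple loop γ ⊂ 𝔸∖A, points x, y ∈ 𝔸∖A, a set G ⊂ ℕ, and a constant B > 0 depending only on f, such that: (1) pr₁(Fⁿ(x̃) − x̃)/n → ρ⁻ and pr₁(Fⁿ(ỹ) − ỹ)/n → ρ⁺ as n → ∞ for lifts x̃, ỹ ∈ ℝ² of x, y; (2) for every n ∈ G, d(f̂ⁿ(x), f̂ⁿ(γ)) < ε and d(f̂ⁿ(y), f̂ⁿ(γ)) < ε; (3) the lower density of G is at least 1 − δ; (4) diam(pr₂(f̂ⁿ(A))) ≤ B for all n ∈ ℕ; (5) A separates {x, y} from γ in 𝔸, and inf_{n∈ℕ} lw(f̂ⁿ(A)) > 0. -/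

import Mathlib

/- STATEMENT 9: The key lemma (Lemma 3.2 of the paper): for a horizontal
extension `f` of an irrational rotation with lifts `f̂ : 𝔸 → 𝔸` and
`F : ℝ² → ℝ²`, if `ρ(F) = [ρ⁻,ρ⁺] × {α}`, then for all `δ, ε > 0` there are a
closed essential annulus `A`, an essential simple loop `γ ⊆ 𝔸∖A`, points
`x, y ∈ 𝔸∖A`, a set `G ⊆ ℕ` of lower density at least `1 − δ`, and a constant
`B > 0` depending only on `f`, satisfying properties (1)–(5). -/

noncomputable section
open Set Metric Filter Topology Function

abbrev 𝕊 : Type := AddCircle (1:ℝ)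
abbrev 𝔸 : Type := 𝕊 × ℝ
abbrev 𝕋2 : Type := 𝕊 × 𝕊

def τ : ℝ × ℝ → 𝔸 := fun p => ((p.1 : 𝕊), p.2)
def θ : 𝔸 → 𝕋2 := fun p => (p.1, (p.2 : 𝕊))

/-- The connected components of a set `S ⊆ 𝔸`. -/
def comps (S : Set 𝔸) : Set (Set 𝔸) := {C | ∃ z ∈ S, C = connectedComponentIn S z}

/-- A subset of the annulus is unbounded above. -/
def UnbAbove (C : Set 𝔸) : Prop := ¬ BddAbove (Prod.snd '' C)
/-- A subset of the annulus is unbounded below. -/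
def UnbBelow (C : Set 𝔸) : Prop := ¬ BddBelow (Prod.snd '' C)

/-- An essential continuum: a compact connected set whose complement has exactly two
unbounded connected components, one unbounded above, the other unbounded below. -/
def IsEssentialContinuum (E : Set 𝔸) : Prop :=
  IsCompact E ∧ IsConnected E ∧
  ∃ U V : Set 𝔸, U ∈ comps Eᶜ ∧ V ∈ comps Eᶜ ∧ U ≠ V ∧
    UnbAbove U ∧ ¬ UnbBelow U ∧ UnbBelow V ∧ ¬ UnbAbove V ∧
    ∀ C ∈ comps Eᶜ, ¬ Bornology.IsBounded C → C = U ∨ C = V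

/-- The lower unbounded complementary region `U⁻(E)` of an essential continuum. -/
def Uminus (E : Set 𝔸) : Set 𝔸 :=
  {z | z ∉ E ∧ UnbBelow (connectedComponentIn Eᶜ z)}

/-- The partial order `C₁ ≺ C₂` on essential continua. -/
def Prec (C₁ C₂ : Set 𝔸) : Prop := C₁ ⊆ Uminus C₂

/-- An essential annular continuum: a compact connected set whose complement has
exactly two connected components, both unbounded. -/
def IsEssentialAnnularContinuum (E : Set 𝔸) : Prop :=
  IsCompact E ∧ IsConnected E ∧
  ∃ U V : Set 𝔸, U ∈ comps Eᶜ ∧ V ∈ comps Eᶜ ∧ U ≠ V ∧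
    UnbAbove U ∧ UnbBelow V ∧ ∀ C ∈ comps Eᶜ, C = U ∨ C = V

/-- The infimum distance between two subsets of the annulus. -/
def setDist (s t : Set 𝔸) : ℝ := sInf {r | ∃ x ∈ s, ∃ y ∈ t, r = dist x y}

/-- The upper width of `A ⊆ 𝔸`. -/
def uw (A : Set 𝔸) : ℝ :=
  sSup {r | ∃ C₁ C₂ : Set 𝔸, IsEssentialContinuum C₁ ∧ IsEssentialContinuum C₂ ∧
    C₁ ⊆ A ∧ C₂ ⊆ A ∧ r = hausdorffDist C₁ C₂}

/-- The lower width of `A ⊆ 𝔸`. -/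
def lw (A : Set 𝔸) : ℝ :=
  sSup {r | ∃ C₁ C₂ : Set 𝔸, IsEssentialContinuum C₁ ∧ IsEssentialContinuum C₂ ∧
    C₁ ⊆ A ∧ C₂ ⊆ A ∧ r = setDist C₁ C₂}

/-- A horizontal annular continuum in the torus. -/
def IsHorizontalAnnularContinuum (C : Set 𝕋2) : Prop :=
  IsCompact C ∧ IsConnected C ∧
  ∀ z ∈ θ ⁻¹' C, IsEssentialAnnularContinuum (connectedComponentIn (θ ⁻¹' C) z)

/-- A horizontal map `h : 𝕋² → S¹`. -/
def IsHorizontalMap (h : 𝕋2 → 𝕊) : Prop :=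
  Continuous h ∧ Function.Surjective h ∧ ∀ t : 𝕊, IsHorizontalAnnularContinuum (h ⁻¹' {t})

/-- The lower density of a set of natural numbers. -/
def lowerDensity (G : Set ℕ) : ℝ :=
  liminf (fun n : ℕ => ((G ∩ Set.Icc 1 n).ncard : ℝ) / n) atTop

/-- An essential simple loop, regarded as a subset of the annulus. -/
def IsEssentialSimpleLoop (Γ : Set 𝔸) : Prop :=
  (∃ γ : 𝕊 → 𝔸, Continuous γ ∧ Function.Injective γ ∧ Γ = Set.range γ) ∧
  IsEssentialContinuum Γ

/-- A closed essential topological annulus: a homeomorphic copy of `S¹ × [0,1]`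
containing an essential loop. -/
def IsClosedEssentialAnnulus (A : Set 𝔸) : Prop :=
  (∃ φ : 𝕊 × (Set.Icc (0:ℝ) 1) → 𝔸, Continuous φ ∧ Function.Injective φ ∧ A = Set.range φ) ∧
  ∃ Γ ⊆ A, IsEssentialSimpleLoop Γ

/-- The rotation set of a lift `F : ℝ² → ℝ²`. -/
def rotSet (F : ℝ × ℝ → ℝ × ℝ) : Set (ℝ × ℝ) :=
  {v | ∃ (n : ℕ → ℕ) (x : ℕ → ℝ × ℝ),
    Tendsto n atTop atTop ∧
    Tendsto (fun i => (n i : ℝ)⁻¹ • (F^[n i] (x i) - x i)) atTop (𝓝 v)}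


/-! ### Möbius automorphisms of the unit disc -/

/-- The disc automorphism sending `w` to `0`. -/
def mob (w z : ℂ) : ℂ := (z - w) / (1 - (starRingEnd ℂ) w * z)

theorem mob_denom_ne {w z : ℂ} (hw : ‖w‖ < 1) (hz : ‖z‖ ≤ 1) :
    1 - (starRingEnd ℂ) w * z ≠ 0 := by
  intro h
  have h1 : (starRingEnd ℂ) w * z = 1 := (sub_eq_zero.1 h).symm
  have h2 : ‖w‖ * ‖z‖ = 1 := by
    have := congrArg norm h1
    simpa using this
  nlinarith [norm_nonneg w, norm_nonneg z]

theorem one_sub_norm_mob_sq {w z : ℂ} (hw : ‖w‖ < 1) (hz : ‖z‖ ≤ 1) :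
    (1 - ‖mob w z‖ ^ 2) * ‖1 - (starRingEnd ℂ) w * z‖ ^ 2 = (1 - ‖w‖ ^ 2) * (1 - ‖z‖ ^ 2) := by
  have hd := mob_denom_ne hw hz
  have hd' : ‖1 - (starRingEnd ℂ) w * z‖ ≠ 0 := norm_ne_zero_iff.2 hd
  have h1 : ‖mob w z‖ ^ 2 * ‖1 - (starRingEnd ℂ) w * z‖ ^ 2 = ‖z - w‖ ^ 2 := by
    rw [mob, norm_div, div_pow, div_mul_cancel₀ _ (pow_ne_zero 2 hd')]
  have : ‖1 - (starRingEnd ℂ) w * z‖ ^ 2 - ‖z - w‖ ^ 2 = (1 - ‖w‖ ^ 2) * (1 - ‖z‖ ^ 2) := by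
    simp only [← Complex.normSq_eq_norm_sq, Complex.normSq_apply, Complex.sub_re, Complex.sub_im,
      Complex.mul_re, Complex.mul_im, Complex.conj_re, Complex.conj_im, Complex.one_re,
      Complex.one_im]
    ring
  linarith

theorem norm_mob_lt {w z : ℂ} (hw : ‖w‖ < 1) (hz : ‖z‖ < 1) : ‖mob w z‖ < 1 := by
  have h := one_sub_norm_mob_sq hw hz.le
  have hd : 0 < ‖1 - (starRingEnd ℂ) w * z‖ := norm_pos_iff.2 (mob_denom_ne hw hz.le)
  have h2 : 0 < (1 - ‖w‖ ^ 2) * (1 - ‖z‖ ^ 2) := by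
    apply mul_pos <;> nlinarith [norm_nonneg w, norm_nonneg z]
  rw [← h] at h2
  have := pos_of_mul_pos_left h2 (by positivity)
  nlinarith [norm_nonneg (mob w z)]

theorem norm_mob_le {w z : ℂ} (hw : ‖w‖ < 1) (hz : ‖z‖ ≤ 1) : ‖mob w z‖ ≤ 1 := by
  have h := one_sub_norm_mob_sq hw hz
  have hd : 0 < ‖1 - (starRingEnd ℂ) w * z‖ := norm_pos_iff.2 (mob_denom_ne hw hz)
  have h2 : 0 ≤ (1 - ‖w‖ ^ 2) * (1 - ‖z‖ ^ 2) := by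
    apply mul_nonneg <;> nlinarith [norm_nonneg w, norm_nonneg z]
  rw [← h] at h2
  have := nonneg_of_mul_nonneg_left h2 (by positivity)
  nlinarith [norm_nonneg (mob w z)]

theorem mob_neg_mob {w z : ℂ} (hw : ‖w‖ < 1) (hz : ‖z‖ ≤ 1) : mob (-w) (mob w z) = z := by
  have hd := mob_denom_ne hw hz
  have he : mob w z * (1 - (starRingEnd ℂ) w * z) = z - w := div_mul_cancel₀ _ hd
  have hd2 : 1 - (starRingEnd ℂ) (-w) * mob w z ≠ 0 :=
    mob_denom_ne (by simpa using hw) (norm_mob_le hw hz)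
  rw [mob, div_eq_iff hd2, map_neg]
  apply mul_right_cancel₀ hd
  linear_combination (1 - z * (starRingEnd ℂ) w) * he

theorem mob_mob_neg {w z : ℂ} (hw : ‖w‖ < 1) (hz : ‖z‖ ≤ 1) : mob w (mob (-w) z) = z := by
  simpa using mob_neg_mob (w := -w) (by simpa using hw) hz

@[simp] theorem mob_self (w : ℂ) : mob w w = 0 := by simp [mob]

@[simp] theorem mob_zero_right (w : ℂ) : mob w 0 = -w := by simp [mob]

theorem hasDerivAt_mob {w z : ℂ} (hw : ‖w‖ < 1) (hz : ‖z‖ ≤ 1) :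
    HasDerivAt (mob w) ((1 - (‖w‖ : ℂ) ^ 2) / (1 - (starRingEnd ℂ) w * z) ^ 2) z := by
  have hd := mob_denom_ne hw hz
  have h1 : HasDerivAt (fun z : ℂ => z - w) 1 z := (hasDerivAt_id z).sub_const w
  have h2 : HasDerivAt (fun z : ℂ => 1 - (starRingEnd ℂ) w * z) (-((starRingEnd ℂ) w * 1)) z :=
    ((hasDerivAt_id z).const_mul _).const_sub 1
  convert! h1.div h2 hd using 1
  rw [← Complex.mul_conj']
  ring

theorem continuousOn_mob {w : ℂ} (hw : ‖w‖ < 1) : ContinuousOn (mob w) (closedBall 0 1) :=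
  fun z hz => (hasDerivAt_mob hw (by simpa using hz)).continuousAt.continuousWithinAt

theorem differentiableOn_mob {w : ℂ} (hw : ‖w‖ < 1) : DifferentiableOn ℂ (mob w) (ball 0 1) :=
  fun z hz => (hasDerivAt_mob hw
    (by simpa using (mem_ball_zero_iff.1 hz).le)).differentiableAt.differentiableWithinAt

/-! ### Square roots on domains with connected complement -/

theorem exists_continuousOn_sqrt_of_near {K : Set ℂ} {w w' : ℂ} {s : ℂ → ℂ}
    (hs : ContinuousOn s K) (hsq : ∀ z ∈ K, s z ^ 2 = z - w)
    (hlt : ∀ z ∈ K, ‖w - w'‖ < ‖z - w‖) :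
    ∃ s' : ℂ → ℂ, ContinuousOn s' K ∧ ∀ z ∈ K, s' z ^ 2 = z - w' := by
  have hne : ∀ z ∈ K, z - w ≠ 0 := fun z hz h => by
    have := hlt z hz
    rw [h, norm_zero] at this
    exact absurd this (not_lt.2 (norm_nonneg _))
  have hslit : ∀ z ∈ K, (z - w') / (z - w) ∈ Complex.slitPlane := fun z hz => by
    have h1 : (z - w') / (z - w) = 1 + (w - w') / (z - w) := by
      have := hne z hz
      field_simp
      ring
    rw [h1]
    apply Complex.mem_slitPlane_of_norm_lt_one
    rw [norm_div, div_lt_one (norm_pos_iff.2 (hne z hz))]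
    exact hlt z hz
  refine ⟨fun z => s z * Complex.exp (Complex.log ((z - w') / (z - w)) / 2), ?_, ?_⟩
  · refine hs.mul (Complex.continuous_exp.comp_continuousOn (ContinuousOn.div_const ?_ 2))
    refine ContinuousOn.clog ?_ hslit
    exact ContinuousOn.div (by fun_prop) (by fun_prop) hne
  · intro z hz
    have h0 : (z - w') / (z - w) ≠ 0 := Complex.slitPlane_ne_zero (hslit z hz)
    rw [mul_pow, hsq z hz, ← Complex.exp_nat_mul]
    have : ((2 : ℕ) : ℂ) * (Complex.log ((z - w') / (z - w)) / 2)
      = Complex.log ((z - w') / (z - w)) := by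
      push_cast
      ring
    rw [this, Complex.exp_log h0, mul_div_cancel₀ _ (hne z hz)]

theorem exists_continuousOn_sqrt_of_gap {K L : Set ℂ} {η : ℝ} (hη : 0 < η)
    (hK : K ⊆ ball 0 1) (hL : IsPreconnected L) (h1L : (1 : ℂ) ∈ L)
    (hgap : ∀ z ∈ K, ∀ w ∈ L, η ≤ ‖z - w‖) {w : ℂ} (hw : w ∈ L) :
    ∃ s : ℂ → ℂ, ContinuousOn s K ∧ ∀ z ∈ K, s z ^ 2 = z - w := by
  let S : ℂ → Prop := fun w => ∃ s : ℂ → ℂ, ContinuousOn s K ∧ ∀ z ∈ K, s z ^ 2 = z - w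
  have h1 : S 1 := by
    refine ⟨fun z => Complex.I * Complex.exp (Complex.log (1 - z) / 2), ?_, ?_⟩
    · refine continuousOn_const.mul (Complex.continuous_exp.comp_continuousOn
        (ContinuousOn.div_const ?_ 2))
      refine ContinuousOn.clog (by fun_prop) fun z hz => ?_
      rw [sub_eq_add_neg]
      exact Complex.mem_slitPlane_of_norm_lt_one (by simpa using hK hz)
    · intro z hz
      have h0 : (1 - z) ≠ 0 := by
        intro h
        have := hK hz
        rw [← sub_eq_zero.1 h] at this
        simp at this
      rw [mul_pow, ← Complex.exp_nat_mul]
      have : ((2 : ℕ) : ℂ) * (Complex.log (1 - z) / 2) = Complex.log (1 - z) := by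
        push_cast
        ring
      rw [this, Complex.exp_log h0, Complex.I_sq]
      ring
  have key : S 1 ↔ S w := by
    refine hL.induction₂ (fun a b => S a ↔ S b) (fun a ha => ?_) (fun a b c _ _ _ => Iff.trans)
      (fun a b _ _ => Iff.symm) h1L hw
    filter_upwards [self_mem_nhdsWithin, nhdsWithin_le_nhds (ball_mem_nhds a hη)] with b hb hab
    have hab' : ‖a - b‖ < η := by
      rw [← dist_eq_norm, dist_comm]
      exact hab
    constructor
    · rintro ⟨s, hs, hsq⟩
      exact exists_continuousOn_sqrt_of_near hs hsq fun z hz => hab'.trans_le (hgap z hz a ha)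
    · rintro ⟨s, hs, hsq⟩
      refine exists_continuousOn_sqrt_of_near hs hsq fun z hz => ?_
      rw [norm_sub_rev]
      exact hab'.trans_le (hgap z hz b hb)
  exact key.1 h1

/-- On a subdomain `Ω` of the unit disc with connected complement in the closed disc, the
functions `z - w` with `w` in the complement have continuous square roots. -/
theorem exists_continuousOn_sqrt {Ω : Set ℂ} (hΩo : IsOpen Ω) (hΩc : IsConnected Ω)
    (hΩ1 : Ω ⊆ ball 0 1) (hL : IsPreconnected (closedBall 0 1 \ Ω)) {w : ℂ}
    (hw : w ∈ closedBall 0 1 \ Ω) :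
    ∃ s : ℂ → ℂ, ContinuousOn s Ω ∧ ∀ z ∈ Ω, s z ^ 2 = z - w := by
  set L := closedBall (0 : ℂ) 1 \ Ω with hLdef
  obtain ⟨a, ha⟩ := hΩc.nonempty
  have hLcl : IsClosed L := isClosed_closedBall.sdiff hΩo
  have hLne : L.Nonempty := ⟨w, hw⟩
  have h1L : (1 : ℂ) ∈ L := by
    refine ⟨by simp, fun h => ?_⟩
    have := hΩ1 h
    simp at this
  have haw : a - w ≠ 0 := fun h => hw.2 (by rwa [← sub_eq_zero.1 h])
  obtain ⟨c, hc⟩ : ∃ c : ℂ, c ^ 2 = a - w := ⟨(a - w) ^ ((2 : ℂ)⁻¹), by simp⟩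
  -- the exhaustion
  let V : ℕ → Set ℂ := fun n => {z ∈ Ω | (1 : ℝ) / (n + 1) < infDist z L}
  let U : ℕ → Set ℂ := fun n => connectedComponentIn (V n) a
  have hVo : ∀ n, IsOpen (V n) := fun n =>
    hΩo.inter (isOpen_lt continuous_const (continuous_infDist_pt L))
  have hUo : ∀ n, IsOpen (U n) := fun n => (hVo n).connectedComponentIn
  have hVmono : ∀ {m n}, m ≤ n → V m ⊆ V n := fun {m n} hmn z hz =>
    ⟨hz.1, lt_of_le_of_lt (one_div_le_one_div_of_le (by positivity) (by gcongr)) hz.2⟩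
  have hUmono : ∀ {m n}, m ≤ n → U m ⊆ U n := fun hmn => connectedComponentIn_mono a (hVmono hmn)
  have hUV : ∀ n, U n ⊆ V n := fun n => connectedComponentIn_subset _ _
  have hcover : ∀ z ∈ Ω, ∃ n, z ∈ U n := by
    intro z hz
    have hpc : IsPathConnected Ω := hΩo.isConnected_iff_isPathConnected.1 hΩc
    obtain ⟨γ, hγ⟩ := hpc.joinedIn a ha z hz
    have hcomp : IsCompact (range γ) := isCompact_range γ.continuous
    have hdisj : Disjoint (range γ) L := by
      rw [Set.disjoint_left]
      rintro _ ⟨t, rfl⟩ h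
      exact h.2 (hγ t)
    obtain ⟨r, hr, hr'⟩ : ∃ r > 0, ∀ x ∈ range γ, r ≤ infDist x L := by
      obtain ⟨x0, hx0, hmin⟩ := hcomp.exists_isMinOn (range_nonempty _)
        (continuous_infDist_pt L).continuousOn
      refine ⟨infDist x0 L, ?_, fun x hx => hmin hx⟩
      exact (hLcl.notMem_iff_infDist_pos hLne).1 (Set.disjoint_left.1 hdisj hx0)
    obtain ⟨n, hn⟩ := exists_nat_one_div_lt hr
    refine ⟨n, ?_⟩
    have : range γ ⊆ U n := by
      apply (isPreconnected_range γ.continuous).subset_connectedComponentIn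
      · exact ⟨0, γ.source⟩
      · rintro _ ⟨t, rfl⟩
        exact ⟨hγ t, hn.trans_le (hr' _ ⟨t, rfl⟩)⟩
    exact this ⟨1, γ.target⟩
  have hsq0 : ∀ n, a ∈ U n → ∃ s : ℂ → ℂ, ContinuousOn s (U n) ∧ (∀ z ∈ U n, s z ^ 2 = z - w) ∧
      s a = c := by
    intro n han
    obtain ⟨s, hs, hsq⟩ := exists_continuousOn_sqrt_of_gap (K := U n) (L := L)
      (η := 1 / ((n : ℝ) + 1)) (by positivity) (fun z hz => hΩ1 (hUV n hz).1) hL h1L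
      (fun z hz v hv => by
        rw [← dist_eq_norm]
        exact (hUV n hz).2.le.trans (infDist_le_dist_of_mem hv)) hw
    have : s a = c ∨ s a = -c := by
      apply sq_eq_sq_iff_eq_or_eq_neg.1
      rw [hsq a han, hc]
    rcases this with h | h
    · exact ⟨s, hs, hsq, h⟩
    · exact ⟨fun z => -s z, hs.neg, fun z hz => by rw [neg_sq, hsq z hz], by simp [h]⟩
  obtain ⟨n0, hn0⟩ := hcover a ha
  have hsq1 : ∀ n, ∃ s : ℂ → ℂ, n0 ≤ n → ContinuousOn s (U n) ∧ (∀ z ∈ U n, s z ^ 2 = z - w) ∧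
      s a = c := by
    intro n
    by_cases h : n0 ≤ n
    · obtain ⟨s, hs⟩ := hsq0 n (hUmono h hn0)
      exact ⟨s, fun _ => hs⟩
    · exact ⟨0, fun h' => absurd h' h⟩
  choose s hs using hsq1
  have hcompat : ∀ {m n}, n0 ≤ m → m ≤ n → EqOn (s m) (s n) (U m) := by
    intro m n hm hmn
    have h1 := hs m hm
    have h2 := hs n (hm.trans hmn)
    refine IsPreconnected.eq_of_sq_eq isPreconnected_connectedComponentIn h1.1
      (h2.1.mono (hUmono hmn)) (fun z hz => ?_) (fun {z} hz h0 => ?_) (hUmono hm hn0) ?_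
    · simp only [Pi.pow_apply]
      rw [h1.2.1 z hz, h2.2.1 z (hUmono hmn hz)]
    · have := h2.2.1 z (hUmono hmn hz)
      rw [h0] at this
      have hzw : z = w := by
        rw [eq_comm, ← sub_eq_zero] at this ⊢
        simpa [sub_eq_zero, eq_comm] using this
      exact hw.2 (hzw ▸ (hUV m hz).1)
    · rw [h1.2.2, h2.2.2]
  have hcover' : ∀ z ∈ Ω, ∃ n, n0 ≤ n ∧ z ∈ U n := fun z hz => by
    obtain ⟨n, hn⟩ := hcover z hz
    exact ⟨max n n0, le_max_right _ _, hUmono (le_max_left _ _) hn⟩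
  choose! N hN0 hN using hcover'
  have hval : ∀ n, n0 ≤ n → ∀ z ∈ U n, s (N z) z = s n z := by
    intro n hn z hz
    have hzΩ := (hUV n hz).1
    rcases le_total (N z) n with h | h
    · exact hcompat (hN0 z hzΩ) h (hN z hzΩ)
    · exact (hcompat hn h hz).symm
  refine ⟨fun z => s (N z) z, fun z hz => ?_, fun z hz => (hs _ (hN0 z hz)).2.1 z (hN z hz)⟩
  have hc1 : ContinuousAt (s (N z)) z :=
    (hs _ (hN0 z hz)).1.continuousAt ((hUo _).mem_nhds (hN z hz))
  refine (hc1.congr ?_).continuousWithinAt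
  filter_upwards [(hUo _).mem_nhds (hN z hz)] with x hx
  exact (hval _ (hN0 z hz) x hx).symm

/-! ### Conformal charts of a planar domain -/

/-- A holomorphic embedding `φ` of `Ω` into the unit disc, normalised at `0`, whose image has
connected complement in the closed disc, together with a continuous extension `p` of its inverse
to the closed disc. -/
structure IsDiscChart (Ω : Set ℂ) (φ p : ℂ → ℂ) : Prop where
  differentiableOn : DifferentiableOn ℂ φ Ω
  mapsTo : MapsTo φ Ω (ball 0 1)
  map_zero : φ 0 = 0
  continuousOn : ContinuousOn p (closedBall 0 1)
  left_inv : ∀ z ∈ Ω, p (φ z) = z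
  norm_le : ∀ ζ ∈ closedBall (0 : ℂ) 1, ‖p ζ‖ ≤ ‖ζ‖
  preconnected : IsPreconnected (closedBall 0 1 \ φ '' Ω)

/-- A subdomain of the unit disc containing `0` with connected complement. -/
structure IsDiscDomain (Ω : Set ℂ) : Prop where
  isOpen : IsOpen Ω
  isConnected : IsConnected Ω
  subset_ball : Ω ⊆ ball 0 1
  zero_mem : (0 : ℂ) ∈ Ω
  preconnected : IsPreconnected (closedBall 0 1 \ Ω)

namespace IsDiscChart

variable {Ω : Set ℂ} {φ p : ℂ → ℂ}

theorem injOn (hc : IsDiscChart Ω φ p) : InjOn φ Ω := fun a ha b hb hab => by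
  rw [← hc.left_inv a ha, ← hc.left_inv b hb, hab]

theorem isOpen_image (hc : IsDiscChart Ω φ p) (hΩ : IsDiscDomain Ω) {U : Set ℂ} (hU : IsOpen U)
    (hUΩ : U ⊆ Ω) : IsOpen (φ '' U) := by
  have han : AnalyticOnNhd ℂ φ Ω := hc.differentiableOn.analyticOnNhd hΩ.isOpen
  rcases han.is_constant_or_isOpen hΩ.isConnected.isPreconnected with ⟨w, hw⟩ | h
  · exfalso
    obtain ⟨r, hr, hrΩ⟩ := Metric.isOpen_iff.1 hΩ.isOpen 0 hΩ.zero_mem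
    have hm : ((r / 2 : ℝ) : ℂ) ∈ Ω := hrΩ (by
      rw [mem_ball_zero_iff, Complex.norm_real, Real.norm_of_nonneg (by positivity)]; linarith)
    have := hc.injOn hm hΩ.zero_mem (by rw [hw _ hm, hw _ hΩ.zero_mem])
    have h2 : r / 2 = 0 := by exact_mod_cast this
    linarith
  · exact h U hUΩ hU

theorem isDiscDomain_image (hc : IsDiscChart Ω φ p) (hΩ : IsDiscDomain Ω) :
    IsDiscDomain (φ '' Ω) where
  isOpen := hc.isOpen_image hΩ hΩ.isOpen subset_rfl
  isConnected := hΩ.isConnected.image _ hc.differentiableOn.continuousOn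
  subset_ball := hc.mapsTo.image_subset
  zero_mem := ⟨0, hΩ.zero_mem, hc.map_zero⟩
  preconnected := hc.preconnected

theorem comp {φ' p' : ℂ → ℂ} (hc' : IsDiscChart (φ '' Ω) φ' p') (hc : IsDiscChart Ω φ p) :
    IsDiscChart Ω (φ' ∘ φ) (p ∘ p') := by
  have hp' : MapsTo p' (closedBall 0 1) (closedBall 0 1) := fun ζ hζ => by
    have := hc'.norm_le ζ hζ
    rw [mem_closedBall_zero_iff] at *
    linarith
  exact
  { differentiableOn := hc'.differentiableOn.comp hc.differentiableOn (mapsTo_image _ _)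
    mapsTo := hc'.mapsTo.comp (mapsTo_image _ _)
    map_zero := by simp [hc.map_zero, hc'.map_zero]
    continuousOn := hc.continuousOn.comp hc'.continuousOn hp'
    left_inv := fun z hz => by
      simp [hc'.left_inv (φ z) (mem_image_of_mem _ hz), hc.left_inv z hz]
    norm_le := fun ζ hζ => (hc.norm_le _ (hp' hζ)).trans (hc'.norm_le ζ hζ)
    preconnected := by rw [image_comp]; exact hc'.preconnected }

end IsDiscChart

theorem IsDiscDomain.isDiscChart_id {Ω : Set ℂ} (hΩ : IsDiscDomain Ω) : IsDiscChart Ω id id where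
  differentiableOn := differentiableOn_id
  mapsTo := hΩ.subset_ball
  map_zero := rfl
  continuousOn := continuousOn_id
  left_inv := fun _ _ => rfl
  norm_le := fun _ _ => le_rfl
  preconnected := by simpa using hΩ.preconnected

/-- The preimage under squaring of a connected subset of the closed disc containing `0`. -/
theorem isPreconnected_sq_preimage {L : Set ℂ} (hL : IsPreconnected L) (hLc : IsCompact L)
    (h0 : (0 : ℂ) ∈ L) : IsPreconnected {ζ : ℂ | ζ ^ 2 ∈ L} := by
  have hTc : IsClosed {ζ : ℂ | ζ ^ 2 ∈ L} := hLc.isClosed.preimage (by fun_prop)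
  have hTb : IsCompact {ζ : ℂ | ζ ^ 2 ∈ L} := by
    obtain ⟨R, hR⟩ := hLc.isBounded.exists_norm_le
    refine Metric.isCompact_of_isClosed_isBounded hTc
      ((Metric.isBounded_closedBall (x := (0 : ℂ)) (r := R + 1)).subset fun ζ hζ => ?_)
    have h1 := hR _ hζ
    rw [norm_pow] at h1
    rw [mem_closedBall_zero_iff]
    nlinarith [norm_nonneg ζ]
  have hopen : IsOpenMap (fun ζ : ℂ => ζ ^ 2) := by
    have han : AnalyticOnNhd ℂ (fun ζ : ℂ => ζ ^ 2) univ := fun z _ => by fun_prop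
    rcases han.is_constant_or_isOpen isPreconnected_univ with ⟨w, hw⟩ | h
    · have h1 := hw 0 (mem_univ _)
      have h2 := hw 1 (mem_univ _)
      simp at h1 h2
      exact absurd (h1.trans h2.symm) zero_ne_one
    · exact fun U hU => h U (subset_univ _) hU
  have key : ∀ t t' : Set ℂ, IsClosed t → IsClosed t' → {ζ : ℂ | ζ ^ 2 ∈ L} ⊆ t ∪ t' →
      (0 : ℂ) ∈ t → ({ζ : ℂ | ζ ^ 2 ∈ L} ∩ t').Nonempty →
      ({ζ : ℂ | ζ ^ 2 ∈ L} ∩ (t ∩ t')).Nonempty := by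
    intro t t' ht ht' hcov h0t hne
    by_contra hcon
    rw [not_nonempty_iff_eq_empty] at hcon
    set T := {ζ : ℂ | ζ ^ 2 ∈ L} with hT
    set A := T ∩ t
    set B := T ∩ t'
    have hAc : IsClosed A := hTc.inter ht
    have hBc : IsCompact ((fun ζ : ℂ => ζ ^ 2) '' B) :=
      (hTb.inter_right ht').image (by fun_prop)
    have hAB : ∀ ζ ∈ T, ζ ∉ A → ζ ∈ B := fun ζ hζ hA =>
      ⟨hζ, (hcov hζ).resolve_left fun h => hA ⟨hζ, h⟩⟩
    have hBA : ∀ ζ ∈ B, ζ ∉ A := fun ζ hζ hA => by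
      have : ζ ∈ T ∩ (t ∩ t') := ⟨hζ.1, hA.2, hζ.2⟩
      rw [hcon] at this; exact this
    have hrel : ∀ l ∈ L, l ∈ (fun ζ : ℂ => ζ ^ 2) '' Aᶜ → l ∈ (fun ζ : ℂ => ζ ^ 2) '' B := by
      rintro _ hl ⟨ζ, hζ, rfl⟩
      exact ⟨ζ, hAB ζ hl hζ, rfl⟩
    have h0B : (0 : ℂ) ∉ (fun ζ : ℂ => ζ ^ 2) '' B := by
      rintro ⟨ζ, hζ, h⟩
      have : ζ = 0 := by simpa using h
      subst this
      exact hBA _ hζ ⟨hζ.1, h0t⟩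
    obtain ⟨b, hb⟩ := hne
    obtain ⟨l, hl, hl1, hl2⟩ := hL _ _ (hopen _ hAc.isOpen_compl) hBc.isClosed.isOpen_compl
      (fun l _ => by
        by_cases hlB : l ∈ (fun ζ : ℂ => ζ ^ 2) '' B
        · obtain ⟨ζ, hζ, rfl⟩ := hlB
          exact Or.inl ⟨ζ, hBA ζ hζ, rfl⟩
        · exact Or.inr hlB)
      ⟨b ^ 2, hb.1, b, hBA b hb, rfl⟩ ⟨0, h0, h0B⟩
    exact hl2 (hrel l hl hl1)
  rw [isPreconnected_closed_iff]
  intro t t' ht ht' hcov hne hne'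
  have h0T : (0 : ℂ) ∈ {ζ : ℂ | ζ ^ 2 ∈ L} := by simpa using h0
  rcases hcov h0T with h | h
  · exact key t t' ht ht' hcov h hne'
  · rw [inter_comm t t']
    exact key t' t ht' ht (by rwa [union_comm]) h hne

theorem mob_image_closedBall_diff {w : ℂ} (hw : ‖w‖ < 1) {S : Set ℂ} (hS : S ⊆ closedBall 0 1) :
    mob w '' (closedBall 0 1 \ S) = closedBall 0 1 \ mob w '' S := by
  ext z
  simp only [mem_image, Set.mem_sdiff, mem_closedBall_zero_iff]
  constructor
  · rintro ⟨a, ⟨ha, haS⟩, rfl⟩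
    refine ⟨norm_mob_le hw ha, ?_⟩
    rintro ⟨b, hb, hab⟩
    apply haS
    rw [← mob_neg_mob hw ha, ← hab, mob_neg_mob hw (by simpa using hS hb)]
    exact hb
  · rintro ⟨hz, hzS⟩
    refine ⟨mob (-w) z, ⟨norm_mob_le (by simpa using hw) hz, fun h => hzS ⟨_, h, ?_⟩⟩, ?_⟩ <;>
      exact mob_mob_neg hw hz

/-- Koebe's square root trick. -/
theorem IsDiscDomain.exists_isDiscChart_of_notMem {Ω : Set ℂ} (hΩ : IsDiscDomain Ω) {w : ℂ}
    (hw1 : ‖w‖ < 1) (hwΩ : w ∉ Ω) :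
    ∃ φ p, IsDiscChart Ω φ p ∧ ‖deriv φ 0‖ = (1 + ‖w‖) / (2 * √‖w‖) := by
  have hw1' : ‖-w‖ < 1 := by simpa using hw1
  have hball : ∀ z ∈ Ω, ‖z‖ < 1 := fun z hz => by simpa using hΩ.subset_ball hz
  obtain ⟨s₀, hs₀c, hs₀⟩ := exists_continuousOn_sqrt hΩ.isOpen hΩ.isConnected hΩ.subset_ball
    hΩ.preconnected (w := w) ⟨by simpa using hw1.le, hwΩ⟩
  obtain ⟨s, hsc, hs⟩ : ∃ s : ℂ → ℂ, ContinuousOn s Ω ∧ ∀ z ∈ Ω, s z ^ 2 = mob w z := by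
    have hre : ∀ z ∈ Ω, 1 - (starRingEnd ℂ) w * z ∈ Complex.slitPlane := fun z hz => by
      rw [sub_eq_add_neg]
      apply Complex.mem_slitPlane_of_norm_lt_one
      rw [norm_neg, norm_mul, RCLike.norm_conj]
      nlinarith [norm_nonneg w, norm_nonneg z, hball z hz]
    refine ⟨fun z => s₀ z * Complex.exp (-(Complex.log (1 - (starRingEnd ℂ) w * z) / 2)), ?_, ?_⟩
    · refine hs₀c.mul (Complex.continuous_exp.comp_continuousOn (ContinuousOn.neg
        (ContinuousOn.div_const (ContinuousOn.clog (by fun_prop) hre) 2)))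
    · intro z hz
      rw [mul_pow, hs₀ z hz, ← Complex.exp_nat_mul, mob]
      have : ((2 : ℕ) : ℂ) * (-(Complex.log (1 - (starRingEnd ℂ) w * z) / 2))
        = -(Complex.log (1 - (starRingEnd ℂ) w * z)) := by
        push_cast
        ring
      rw [this, Complex.exp_neg, Complex.exp_log (Complex.slitPlane_ne_zero (hre z hz)),
        div_eq_mul_inv]
  have hsne : ∀ z ∈ Ω, s z ≠ 0 := fun z hz h => by
    have h1 := hs z hz
    have h2 := mob_neg_mob hw1 (hball z hz).le
    rw [← h1, h, zero_pow two_ne_zero, mob_zero_right, neg_neg] at h2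
    exact hwΩ (h2 ▸ hz)
  have hs1 : ∀ z ∈ Ω, ‖s z‖ < 1 := fun z hz => by
    have h1 : ‖s z‖ ^ 2 < 1 := by
      rw [← norm_pow, hs z hz]
      exact norm_mob_lt hw1 (hball z hz)
    nlinarith [norm_nonneg (s z)]
  have hsinv : ∀ z ∈ Ω, mob (-w) (s z ^ 2) = z := fun z hz => by
    rw [hs z hz, mob_neg_mob hw1 (hball z hz).le]
  have hsinj : ∀ a ∈ Ω, ∀ b ∈ Ω, s a ^ 2 = s b ^ 2 → a = b := fun a ha b hb hab => by
    rw [← hsinv a ha, ← hsinv b hb, hab]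
  set c := s 0 with hc
  have hc1 : ‖c‖ < 1 := hs1 0 hΩ.zero_mem
  have hc1' : ‖-c‖ < 1 := by simpa using hc1
  have hc0 : c ≠ 0 := hsne 0 hΩ.zero_mem
  have hcw : c ^ 2 = -w := by rw [hc, hs 0 hΩ.zero_mem, mob_zero_right]
  have hsder : ∀ z ∈ Ω, HasDerivAt s
      ((1 - (‖-w‖ : ℂ) ^ 2) / (1 - (starRingEnd ℂ) (-w) * s z ^ 2) ^ 2 * (2 * s z))⁻¹ z := by
    intro z hz
    have hsz2 : ‖s z ^ 2‖ ≤ 1 := by rw [hs z hz]; exact norm_mob_le hw1 (hball z hz).le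
    have hsq : HasDerivAt (fun ζ : ℂ => ζ ^ 2) (2 * s z) (s z) := by
      simpa using hasDerivAt_pow 2 (s z)
    have h1 : HasDerivAt (fun ζ : ℂ => mob (-w) (ζ ^ 2))
        ((1 - (‖-w‖ : ℂ) ^ 2) / (1 - (starRingEnd ℂ) (-w) * s z ^ 2) ^ 2 * (2 * s z)) (s z) :=
      HasDerivAt.comp (h₂ := mob (-w)) (s z) (hasDerivAt_mob hw1' hsz2) hsq
    refine h1.of_local_left_inverse (hsc.continuousAt (hΩ.isOpen.mem_nhds hz)) ?_ ?_
    · refine mul_ne_zero (div_ne_zero ?_ (pow_ne_zero 2 (mob_denom_ne hw1' hsz2)))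
        (mul_ne_zero two_ne_zero (hsne z hz))
      have : (1 - ‖-w‖ ^ 2 : ℝ) ≠ 0 := by nlinarith [norm_nonneg (-w)]
      exact_mod_cast this
    · filter_upwards [hΩ.isOpen.mem_nhds hz] with y hy using hsinv y hy
  have hmc : ∀ ζ ∈ closedBall (0 : ℂ) 1, ‖mob (-c) ζ‖ ≤ 1 := fun ζ hζ =>
    norm_mob_le hc1' (by simpa using hζ)
  have hmc2 : ∀ ζ ∈ closedBall (0 : ℂ) 1, ‖mob (-c) ζ ^ 2‖ ≤ 1 := fun ζ hζ => by
    rw [norm_pow]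
    exact pow_le_one₀ (norm_nonneg _) (hmc ζ hζ)
  let P : ℂ → ℂ := fun ζ => mob (-w) (mob (-c) ζ ^ 2)
  have hP1 : ∀ ζ ∈ closedBall (0 : ℂ) 1, ‖P ζ‖ ≤ 1 := fun ζ hζ => norm_mob_le hw1' (hmc2 ζ hζ)
  have hPd : DifferentiableOn ℂ P (ball 0 1) := by
    refine (differentiableOn_mob hw1').comp ((differentiableOn_mob hc1').pow 2) ?_
    intro ζ hζ
    rw [mem_ball_zero_iff] at hζ ⊢
    change ‖mob (-c) ζ ^ 2‖ < 1
    rw [norm_pow]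
    exact pow_lt_one₀ (norm_nonneg _) (norm_mob_lt hc1' hζ) two_ne_zero
  have hP0 : P 0 = 0 := by simp [P, hcw]
  have hPc : ContinuousOn P (closedBall 0 1) := by
    refine (continuousOn_mob hw1').comp ((continuousOn_mob hc1').pow 2) ?_
    intro ζ hζ
    simpa using hmc2 ζ hζ
  refine ⟨mob c ∘ s, P, ?_, ?_⟩
  · refine ⟨?_, ?_, by simp [← hc], hPc, ?_, ?_, ?_⟩
    · exact (differentiableOn_mob hc1).comp
        (fun z hz => (hsder z hz).differentiableAt.differentiableWithinAt)
        (fun z hz => by simpa using hs1 z hz)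
    · intro z hz
      simpa using norm_mob_lt hc1 (hs1 z hz)
    · intro z hz
      simp only [P, comp_apply]
      rw [mob_neg_mob hc1 (hs1 z hz).le, hsinv z hz]
    · intro ζ hζ
      rcases (mem_closedBall_zero_iff.1 hζ).lt_or_eq with h | h
      · exact Complex.norm_le_norm_of_mapsTo_ball hPd
          (fun x hx => by
            have := hP1 x (ball_subset_closedBall hx)
            simpa using this) hP0 h
      · rw [h]; exact hP1 ζ hζ
    · rw [image_comp]
      have hsub : s '' Ω ⊆ closedBall 0 1 := by
        rintro _ ⟨z, hz, rfl⟩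
        simpa using (hs1 z hz).le
      rw [← mob_image_closedBall_diff hc1 hsub]
      refine IsPreconnected.image ?_ _ ((continuousOn_mob hc1).mono sdiff_subset)
      set L' := mob w '' (closedBall 0 1 \ Ω) with hL'
      have hLc : IsCompact (closedBall (0 : ℂ) 1 \ Ω) := (isCompact_closedBall 0 1).diff hΩ.isOpen
      have hL'c : IsCompact L' :=
        hLc.image_of_continuousOn ((continuousOn_mob hw1).mono sdiff_subset)
      have hL'p : IsPreconnected L' :=
        hΩ.preconnected.image _ ((continuousOn_mob hw1).mono sdiff_subset)
      have h0L' : (0 : ℂ) ∈ L' := ⟨w, ⟨by simpa using hw1.le, hwΩ⟩, mob_self w⟩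
      have hL'eq : L' = closedBall 0 1 \ mob w '' Ω :=
        mob_image_closedBall_diff hw1 (hΩ.subset_ball.trans ball_subset_closedBall)
      set T := {ζ : ℂ | ζ ^ 2 ∈ L'} with hT
      have hTp : IsPreconnected T := isPreconnected_sq_preimage hL'p hL'c h0L'
      have hTc : IsClosed T := hL'c.isClosed.preimage (by fun_prop)
      have h0T : (0 : ℂ) ∈ T := by simpa [hT] using h0L'
      have hTs : ∀ z ∈ Ω, s z ∉ T := fun z hz h => by
        rw [hT, mem_ofPred_eq, hs z hz, hL'eq] at h
        exact h.2 ⟨z, hz, rfl⟩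
      have hTneg : ∀ ζ, -ζ ∈ T ↔ ζ ∈ T := fun ζ => by simp [hT]
      have hTb : T ⊆ closedBall 0 1 := fun ζ hζ => by
        have h1 : ζ ^ 2 ∈ closedBall (0 : ℂ) 1 := by
          rw [hT, mem_ofPred_eq, hL'eq] at hζ; exact hζ.1
        rw [mem_closedBall_zero_iff, norm_pow] at h1
        rw [mem_closedBall_zero_iff]
        nlinarith [norm_nonneg ζ]
      have hcases : ∀ ζ ∈ closedBall (0 : ℂ) 1, ζ ∉ T → ζ ∈ s '' Ω ∨ -ζ ∈ s '' Ω := by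
        intro ζ hζ hζT
        have h1 : ζ ^ 2 ∈ mob w '' Ω := by
          by_contra hcon
          apply hζT
          rw [hT, mem_ofPred_eq, hL'eq]
          refine ⟨?_, hcon⟩
          rw [mem_closedBall_zero_iff, norm_pow]
          exact pow_le_one₀ (norm_nonneg _) (by simpa using hζ)
        obtain ⟨z, hz, hzeq⟩ := h1
        rw [← hs z hz] at hzeq
        rcases sq_eq_sq_iff_eq_or_eq_neg.1 hzeq with h | h
        · exact Or.inl ⟨z, hz, h⟩
        · exact Or.inr ⟨z, hz, h⟩
      set N := (fun ζ : ℂ => -ζ) '' (s '' Ω) with hN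
      have hNp : IsPreconnected N :=
        (hΩ.isConnected.isPreconnected.image _ hsc).image _ (by fun_prop)
      have hunion : closedBall 0 1 \ s '' Ω = T ∪ N := by
        ext ζ
        constructor
        · rintro ⟨h1, h2⟩
          by_cases hζT : ζ ∈ T
          · exact Or.inl hζT
          · exact Or.inr ⟨-ζ, (hcases ζ h1 hζT).resolve_left h2, neg_neg ζ⟩
        · rintro (h | ⟨_, ⟨z, hz, rfl⟩, rfl⟩)
          · refine ⟨hTb h, ?_⟩
            rintro ⟨z, hz, rfl⟩
            exact hTs z hz h
          · refine ⟨by simpa using (hs1 z hz).le, ?_⟩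
            rintro ⟨z', hz', h⟩
            simp only at h
            have h2 : z' = z := hsinj z' hz' z hz (by rw [h]; ring)
            rw [h2] at h
            exact hsne z hz (CharZero.eq_neg_self_iff.1 h)
      have hmeet : (closure N ∩ T).Nonempty := by
        by_contra hcon
        rw [not_nonempty_iff_eq_empty] at hcon
        have hd1 : ∀ ζ ∈ closure N, ζ ∉ T := fun ζ h1 h2 => by
          have : ζ ∈ closure N ∩ T := ⟨h1, h2⟩
          rw [hcon] at this; exact this
        have hd2 : ∀ ζ ∈ closure (s '' Ω), ζ ∉ T := fun ζ h1 h2 => by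
          refine hd1 (-ζ) ?_ ((hTneg ζ).2 h2)
          exact image_closure_subset_closure_image (f := fun ζ : ℂ => -ζ) (by fun_prop)
            ⟨ζ, h1, rfl⟩
        obtain ⟨ζ, hζ, h1, h2⟩ := isPreconnected_closed_iff.1
          (convex_closedBall (0 : ℂ) 1).isPreconnected T (closure N ∪ closure (s '' Ω)) hTc
          (isClosed_closure.union isClosed_closure)
          (fun ζ hζ => by
            by_cases hζT : ζ ∈ T
            · exact Or.inl hζT
            · rcases hcases ζ hζ hζT with h | h
              · exact Or.inr (Or.inr (subset_closure h))
              · exact Or.inr (Or.inl (subset_closure ⟨-ζ, h, neg_neg ζ⟩)))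
          ⟨0, by simp, h0T⟩
          ⟨c, by simpa using hc1.le, Or.inr (subset_closure ⟨0, hΩ.zero_mem, rfl⟩)⟩
        rcases h2 with h2 | h2
        · exact hd1 ζ h2 h1
        · exact hd2 ζ h2 h1
      obtain ⟨t, htN, htT⟩ := hmeet
      have h1 : IsPreconnected (insert t N) :=
        hNp.subset_closure (subset_insert _ _) (insert_subset htN subset_closure)
      have h2 := hTp.union t htT (mem_insert t N) h1
      rw [hunion]
      convert h2 using 1
      ext ζ
      simp only [mem_union, mem_insert_iff]
      constructor
      · tauto
      · rintro (h | rfl | h)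
        · exact Or.inl h
        · exact Or.inl htT
        · exact Or.inr h
  · have h1 := (hasDerivAt_mob hc1 hc1.le).comp 0 (hsder 0 hΩ.zero_mem)
    rw [h1.deriv, ← hc, hcw, norm_mul, norm_div, norm_inv, norm_mul, norm_div]
    have hcn : ‖c‖ ^ 2 = ‖w‖ := by rw [← norm_pow, hcw, norm_neg]
    have hsqrt : √‖w‖ = ‖c‖ := by rw [← hcn, Real.sqrt_sq (norm_nonneg _)]
    have hcpos : 0 < ‖c‖ := norm_pos_iff.2 hc0
    have e1 : ‖(1 : ℂ) - (‖c‖ : ℂ) ^ 2‖ = 1 - ‖c‖ ^ 2 := by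
      have : (1 : ℂ) - (‖c‖ : ℂ) ^ 2 = ((1 - ‖c‖ ^ 2 : ℝ) : ℂ) := by push_cast; ring
      rw [this, Complex.norm_real, Real.norm_of_nonneg (by nlinarith)]
    have e2 : ‖(1 - (starRingEnd ℂ) c * c) ^ 2‖ = (1 - ‖c‖ ^ 2) ^ 2 := by
      rw [Complex.conj_mul', norm_pow, e1]
    have e3 : ‖(1 : ℂ) - (‖-w‖ : ℂ) ^ 2‖ = 1 - (‖c‖ ^ 2) ^ 2 := by
      have : (1 : ℂ) - (‖-w‖ : ℂ) ^ 2 = ((1 - ‖w‖ ^ 2 : ℝ) : ℂ) := by push_cast; simp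
      rw [this, Complex.norm_real, hcn, Real.norm_of_nonneg (by nlinarith [norm_nonneg w])]
    have e4 : ‖(1 - (starRingEnd ℂ) (-w) * -w) ^ 2‖ = (1 - (‖c‖ ^ 2) ^ 2) ^ 2 := by
      rw [Complex.conj_mul', norm_pow, e3]
    have e5 : ‖2 * c‖ = 2 * ‖c‖ := by rw [norm_mul]; simp
    rw [e1, e2, e3, e4, e5, hsqrt, ← hcn]
    have p1 : (1 - ‖c‖ ^ 2 : ℝ) ≠ 0 := by nlinarith
    have p2 : (1 - (‖c‖ ^ 2) ^ 2 : ℝ) ≠ 0 := by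
      have : ‖c‖ ^ 2 < 1 := by nlinarith
      nlinarith [sq_nonneg ‖c‖]
    field_simp
    ring

/-- A quantitative form of the Riemann mapping theorem: the image of a chart can be made to contain
any given smaller disc. -/
theorem IsDiscDomain.exists_isDiscChart_closedBall_subset {Ω : Set ℂ} (hΩ : IsDiscDomain Ω) {R : ℝ}
    (hR0 : 0 < R) (hR1 : R < 1) :
    ∃ φ p, IsDiscChart Ω φ p ∧ closedBall 0 R ⊆ φ '' Ω := by
  obtain ⟨ρ, hρ, hρΩ⟩ := Metric.isOpen_iff.1 hΩ.isOpen 0 hΩ.zero_mem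
  set D : Set ℝ := {d | ∃ φ p, IsDiscChart Ω φ p ∧ d = ‖deriv φ 0‖} with hD
  have hDb : BddAbove D := by
    refine ⟨1 / ρ, ?_⟩
    rintro _ ⟨φ, p, hφ, rfl⟩
    refine Complex.norm_deriv_le_div_of_mapsTo_ball (hφ.differentiableOn.mono hρΩ) ?_ hρ
    rw [hφ.map_zero]
    exact fun z hz => ball_subset_closedBall (hφ.mapsTo (hρΩ hz))
  have h1D : (1 : ℝ) ∈ D := ⟨id, id, hΩ.isDiscChart_id, by simp⟩
  have hS1 : 1 ≤ sSup D := le_csSup hDb h1D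
  set q : ℝ := (1 + R) / (2 * √R) with hq
  have hsR0 : 0 < √R := Real.sqrt_pos.2 hR0
  have hsR1 : √R < 1 := by rw [Real.sqrt_lt' one_pos]; simpa using hR1
  have hsR2 : √R ^ 2 = R := Real.sq_sqrt hR0.le
  have hq1 : 1 < q := by
    rw [hq, lt_div_iff₀ (by positivity)]
    nlinarith [sq_nonneg (1 - √R), mul_pos (sub_pos.2 hsR1) (sub_pos.2 hsR1)]
  obtain ⟨_, ⟨φ, p, hφ, rfl⟩, hlt⟩ := exists_lt_of_lt_csSup ⟨1, h1D⟩
    (show sSup D / q < sSup D by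
      rw [div_lt_iff₀ (by linarith)]
      nlinarith)
  refine ⟨φ, p, hφ, fun w hw => ?_⟩
  by_contra hwφ
  rw [mem_closedBall_zero_iff] at hw
  have hΩ' := hφ.isDiscDomain_image hΩ
  obtain ⟨φ', p', hφ', hd⟩ := hΩ'.exists_isDiscChart_of_notMem (hw.trans_lt hR1) hwφ
  have hw0 : 0 < ‖w‖ := norm_pos_iff.2 fun h => hwφ (h ▸ hΩ'.zero_mem)
  have hs0 : 0 < √‖w‖ := Real.sqrt_pos.2 hw0
  have hsw : √‖w‖ ≤ √R := Real.sqrt_le_sqrt hw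
  have hsw2 : √‖w‖ ^ 2 = ‖w‖ := Real.sq_sqrt hw0.le
  have hqd : q ≤ ‖deriv φ' 0‖ := by
    have key : (1 + √R ^ 2) * (2 * √‖w‖) ≤ (1 + √‖w‖ ^ 2) * (2 * √R) := by
      nlinarith [mul_nonneg (sub_nonneg.2 hsw) (show 0 ≤ 1 - √R * √‖w‖ by nlinarith)]
    rw [hsR2, hsw2] at key
    rwa [hd, hq, div_le_div_iff₀ (by positivity) (by positivity)]
  have hcomp : deriv (φ' ∘ φ) 0 = deriv φ' 0 * deriv φ 0 := by
    have h1 : DifferentiableAt ℂ φ 0 :=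
      hφ.differentiableOn.differentiableAt (hΩ.isOpen.mem_nhds hΩ.zero_mem)
    have h2 : DifferentiableAt ℂ φ' (φ 0) := by
      rw [hφ.map_zero]
      exact hφ'.differentiableOn.differentiableAt (hΩ'.isOpen.mem_nhds hΩ'.zero_mem)
    rw [deriv_comp 0 h2 h1, hφ.map_zero]
  have hle : ‖deriv (φ' ∘ φ) 0‖ ≤ sSup D := le_csSup hDb ⟨_, _, hφ'.comp hφ, rfl⟩
  rw [hcomp, norm_mul] at hle
  rw [div_lt_iff₀ (by linarith)] at hlt
  nlinarith [norm_nonneg (deriv φ 0)]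

/-! ### Uniform bounds for maps into the disc -/

theorem exists_norm_le_of_mapsTo_ball {Ω : Set ℂ} {a : ℂ} {d ρ : ℝ} (hd : 0 < d)
    (had : ball a d ⊆ Ω) (hρ : ρ < 1) :
    ∃ r < 1, ∀ φ : ℂ → ℂ, DifferentiableOn ℂ φ Ω → MapsTo φ Ω (ball 0 1) → ‖φ a‖ ≤ ρ →
      ∀ z ∈ ball a (d / 2), ‖φ z‖ ≤ r := by
  by_cases hρ0 : ρ < 0
  · exact ⟨0, one_pos, fun φ _ _ h => absurd ((norm_nonneg _).trans h) (not_le.2 hρ0)⟩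
  rw [not_lt] at hρ0
  refine ⟨√(1 - 3 * (1 - ρ ^ 2) / 16), ?_, ?_⟩
  · rw [Real.sqrt_lt' one_pos]
    nlinarith
  intro φ hφ hφm hφa z hz
  have hzΩ : z ∈ ball a d := ball_subset_ball (by linarith) hz
  set w := φ a with hw
  have hw1 : ‖w‖ < 1 := hφa.trans_lt hρ
  have hz1 : ‖φ z‖ < 1 := by simpa using hφm (had hzΩ)
  have hmw : MapsTo φ (ball a d) (ball 0 1) := fun x hx => hφm (had hx)
  have hD : DifferentiableOn ℂ (mob w ∘ φ) (ball a d) :=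
    (differentiableOn_mob hw1).comp (hφ.mono had) hmw
  have hη : ‖mob w (φ z)‖ ≤ 1 / 2 := by
    have h1 := Complex.dist_le_div_mul_dist_of_mapsTo_ball (R₂ := 1) hD (fun x hx => by
      simp only [comp_apply, ← hw, mob_self, mem_closedBall_zero_iff]
      exact (norm_mob_lt hw1 (by simpa using hmw hx)).le) hzΩ
    simp only [comp_apply, ← hw, mob_self, dist_zero_right] at h1
    rw [mem_ball] at hz
    calc ‖mob w (φ z)‖ ≤ 1 / d * dist z a := h1
      _ ≤ 1 / d * (d / 2) := by gcongr
      _ = 1 / 2 := by field_simp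
  have hsq := one_sub_norm_mob_sq hw1 hz1.le
  have hden : ‖1 - (starRingEnd ℂ) w * φ z‖ ≥ 1 - ρ := by
    have h1 := norm_sub_norm_le (1 : ℂ) ((starRingEnd ℂ) w * φ z)
    rw [norm_mul, RCLike.norm_conj, norm_one] at h1
    nlinarith [norm_nonneg w, norm_nonneg (φ z)]
  have hinv : φ z = mob (-w) (mob w (φ z)) := (mob_neg_mob hw1 hz1.le).symm
  have hw1' : ‖-w‖ < 1 := by simpa using hw1
  have hη1 : ‖mob w (φ z)‖ ≤ 1 := hη.trans (by norm_num)
  have hsq' := one_sub_norm_mob_sq hw1' hη1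
  rw [← hinv, norm_neg] at hsq'
  set E := ‖1 - (starRingEnd ℂ) (-w) * mob w (φ z)‖ with hE
  have hE2 : E ≤ 2 := by
    refine (norm_sub_le _ _).trans ?_
    rw [norm_mul, RCLike.norm_conj, norm_one, norm_neg]
    nlinarith [norm_nonneg w, norm_nonneg (mob w (φ z))]
  apply Real.le_sqrt_of_sq_le
  have hE0 : 0 ≤ E := norm_nonneg _
  have hEsq : E ^ 2 ≤ 4 := by nlinarith
  have hb1 : ‖w‖ ^ 2 ≤ ρ ^ 2 := by gcongr
  have hb2 : ‖mob w (φ z)‖ ^ 2 ≤ 1 / 4 := by nlinarith [norm_nonneg (mob w (φ z))]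
  have hb3 : (1 - ρ ^ 2) * (3 / 4) ≤ (1 - ‖w‖ ^ 2) * (1 - ‖mob w (φ z)‖ ^ 2) :=
    mul_le_mul (by linarith) (by linarith) (by norm_num) (by nlinarith [norm_nonneg w])
  have hpos : 0 ≤ 1 - ‖φ z‖ ^ 2 := by nlinarith [norm_nonneg (φ z)]
  nlinarith

theorem IsCompact.exists_norm_le_of_mapsTo_ball {Ω K : Set ℂ} (hK : IsCompact K) (hKΩ : K ⊆ Ω)
    (hΩ : IsDiscDomain Ω) :
    ∃ r < 1, ∀ φ : ℂ → ℂ, DifferentiableOn ℂ φ Ω → MapsTo φ Ω (ball 0 1) → φ 0 = 0 →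
      ∀ z ∈ K, ‖φ z‖ ≤ r := by
  let Q : Set ℂ → Prop := fun S => ∃ r < 1, ∀ φ : ℂ → ℂ, DifferentiableOn ℂ φ Ω →
    MapsTo φ Ω (ball 0 1) → φ 0 = 0 → ∀ z ∈ S, ‖φ z‖ ≤ r
  have hQmono : ∀ {S S'}, S ⊆ S' → Q S' → Q S := by
    rintro S S' hSS ⟨r, hr, h⟩
    exact ⟨r, hr, fun φ h1 h2 h3 z hz => h φ h1 h2 h3 z (hSS hz)⟩
  let G : Set ℂ := {a | ∃ U, IsOpen U ∧ a ∈ U ∧ Q U}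
  have hGo : IsOpen G := isOpen_iff_forall_mem_open.2 fun a ⟨U, hU, haU, hQ⟩ =>
    ⟨U, fun b hb => ⟨U, hU, hb, hQ⟩, hU, haU⟩
  have hstep : ∀ b d, 0 < d → ball b d ⊆ Ω → Q {b} → Q (ball b (d / 2)) := by
    rintro b d hd hbd ⟨ρ, hρ, h⟩
    obtain ⟨r, hr, h'⟩ := _root_.exists_norm_le_of_mapsTo_ball hd hbd hρ
    exact ⟨r, hr, fun φ h1 h2 h3 z hz => h' φ h1 h2 (h φ h1 h2 h3 b rfl) z hz⟩
  have hG : Ω ⊆ G := by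
    refine hΩ.isConnected.isPreconnected.subset_of_closure_inter_subset hGo ⟨0, hΩ.zero_mem, ?_⟩ ?_
    · obtain ⟨d, hd, hdΩ⟩ := Metric.isOpen_iff.1 hΩ.isOpen 0 hΩ.zero_mem
      refine ⟨ball 0 (d / 2), isOpen_ball, mem_ball_self (by positivity), hstep 0 d hd hdΩ ?_⟩
      refine ⟨0, one_pos, ?_⟩
      rintro φ h1 h2 h3 z rfl
      rw [h3, norm_zero]
    · rintro a ⟨haG, haΩ⟩
      obtain ⟨d, hd, hdΩ⟩ := Metric.isOpen_iff.1 hΩ.isOpen a haΩ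
      obtain ⟨b, ⟨U, hU, hbU, hQ⟩, hab⟩ := Metric.mem_closure_iff.1 haG (d / 4) (by positivity)
      refine ⟨ball b (3 * d / 4 / 2), isOpen_ball, ?_, hstep b (3 * d / 4) (by positivity) ?_
        (hQmono (by simpa using hbU) hQ)⟩
      · rw [mem_ball]; linarith
      · refine (ball_subset_ball' ?_).trans hdΩ
        rw [dist_comm]; linarith
  refine hK.induction_on (p := Q) ⟨0, one_pos, by simp⟩ (fun _ _ h => hQmono h) ?_ ?_
  · rintro S S' ⟨r, hr, h⟩ ⟨r', hr', h'⟩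
    refine ⟨max r r', max_lt hr hr', fun φ h1 h2 h3 z hz => ?_⟩
    rcases hz with hz | hz
    · exact (h φ h1 h2 h3 z hz).trans (le_max_left _ _)
    · exact (h' φ h1 h2 h3 z hz).trans (le_max_right _ _)
  · intro a ha
    obtain ⟨U, hU, haU, hQ⟩ := hG (hKΩ ha)
    exact ⟨U, mem_nhdsWithin_of_mem_nhds (hU.mem_nhds haU), hQ⟩

theorem IsDiscDomain.exists_isDiscChart_of_exhaustion {Ω : Set ℂ} (hΩ : IsDiscDomain Ω)
    {K : ℝ → Set ℂ} {s s₁ : ℝ} (hs₁ : s₁ < s) (hK : ∀ t < s, IsCompact (K t))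
    (hKΩ : ∀ t < s, K t ⊆ Ω) (hexh : ∀ C, IsCompact C → C ⊆ Ω → ∃ t < s, C ⊆ K t) :
    ∃ s₃ < s, ∃ (φ p : ℂ → ℂ) (a b R : ℝ), 0 < a ∧ a < b ∧ b < R ∧ R < 1 ∧ IsDiscChart Ω φ p ∧
      closedBall 0 R ⊆ φ '' Ω ∧ p '' closedBall 0 a ⊆ K s₃ ∧ (∀ z ∈ K s₁, ‖φ z‖ < a) ∧
      ∀ z ∈ K s₃, ‖φ z‖ < b := by
  obtain ⟨r₁, hr₁, h₁⟩ := (hK s₁ hs₁).exists_norm_le_of_mapsTo_ball (hKΩ s₁ hs₁) hΩ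
  set a : ℝ := (max r₁ 0 + 1) / 2 with ha
  have hm1 : max r₁ 0 < 1 := max_lt hr₁ one_pos
  have ha0 : 0 < a := by have := le_max_right r₁ 0; rw [ha]; linarith
  have ha1 : a < 1 := by rw [ha]; linarith
  have hra : r₁ < a := by have := le_max_left r₁ 0; rw [ha]; linarith
  obtain ⟨φ₁, p₁, hφ₁, hsub₁⟩ := hΩ.exists_isDiscChart_closedBall_subset ha0 ha1
  have hCc : IsCompact (p₁ '' closedBall 0 a) :=
    (isCompact_closedBall 0 a).image_of_continuousOn
      (hφ₁.continuousOn.mono (closedBall_subset_closedBall ha1.le))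
  have hCΩ : p₁ '' closedBall 0 a ⊆ Ω := by
    rintro _ ⟨ζ, hζ, rfl⟩
    obtain ⟨z, hz, rfl⟩ := hsub₁ hζ
    rwa [hφ₁.left_inv z hz]
  obtain ⟨s₃, hs₃, hCK⟩ := hexh _ hCc hCΩ
  obtain ⟨r₃, hr₃, h₃⟩ := (hK s₃ hs₃).exists_norm_le_of_mapsTo_ball (hKΩ s₃ hs₃) hΩ
  set b : ℝ := (max r₃ a + 1) / 2 with hb
  have hm3 : max r₃ a < 1 := max_lt hr₃ ha1
  have hab : a < b := by have := le_max_right r₃ a; rw [hb]; linarith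
  have hb1 : b < 1 := by rw [hb]; linarith
  have hrb : r₃ < b := by have := le_max_left r₃ a; rw [hb]; linarith
  obtain ⟨φ₂, p₂, hφ₂, hsub₂⟩ := (hφ₁.isDiscDomain_image hΩ).exists_isDiscChart_closedBall_subset
    (show (0 : ℝ) < (b + 1) / 2 by linarith) (show (b + 1) / 2 < 1 by linarith)
  have hφ := hφ₂.comp hφ₁
  refine ⟨s₃, hs₃, φ₂ ∘ φ₁, p₁ ∘ p₂, a, b, (b + 1) / 2, ha0, hab, by linarith, by linarith, hφ,
    by rwa [image_comp], ?_, ?_, ?_⟩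
  · rw [image_comp]
    refine (image_mono ?_).trans hCK
    rintro _ ⟨ζ, hζ, rfl⟩
    rw [mem_closedBall_zero_iff] at hζ ⊢
    exact (hφ₂.norm_le ζ (by rw [mem_closedBall_zero_iff]; linarith)).trans hζ
  · exact fun z hz => (h₁ _ hφ.differentiableOn hφ.mapsTo hφ.map_zero z hz).trans_lt hra
  · exact fun z hz => (h₃ _ hφ.differentiableOn hφ.mapsTo hφ.map_zero z hz).trans_lt hrb

/-! ### Exponential coordinates on the annulus -/

/-- The embedding of the annulus into the punctured plane, sending height `M` to the unit
circle. -/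
def annExp (M : ℝ) (z : 𝔸) : ℂ :=
  (Real.exp (2 * Real.pi * (z.2 - M)) : ℂ) * (AddCircle.toCircle z.1 : ℂ)

/-- The inverse of `annExp M` on the punctured plane. -/
def annLog (M : ℝ) (z : ℂ) : 𝔸 :=
  ((AddCircle.homeomorphCircle (one_ne_zero' ℝ)).symm (Circle.exp z.arg),
    Real.log ‖z‖ / (2 * Real.pi) + M)

theorem coe_circleExp_arg {z : ℂ} (hz : z ≠ 0) : (Circle.exp z.arg : ℂ) = z / ‖z‖ := by
  rw [Circle.coe_exp, eq_div_iff (by simpa using hz), mul_comm, Complex.norm_mul_exp_arg_mul_I]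

theorem continuous_annExp (M : ℝ) : Continuous (annExp M) := by
  unfold annExp
  have : Continuous (AddCircle.toCircle : 𝕊 → Circle) := AddCircle.continuous_toCircle
  fun_prop

theorem norm_annExp (M : ℝ) (z : 𝔸) : ‖annExp M z‖ = Real.exp (2 * Real.pi * (z.2 - M)) := by
  rw [annExp, norm_mul, Circle.norm_coe, mul_one, Complex.norm_real,
    Real.norm_of_nonneg (Real.exp_pos _).le]

theorem annExp_ne_zero (M : ℝ) (z : 𝔸) : annExp M z ≠ 0 := by
  rw [← norm_ne_zero_iff, norm_annExp]
  exact (Real.exp_pos _).ne'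

theorem annLog_annExp (M : ℝ) (z : 𝔸) : annLog M (annExp M z) = z := by
  have hpi := Real.pi_pos
  refine Prod.ext ?_ ?_
  · simp only [annLog]
    rw [Homeomorph.symm_apply_eq, AddCircle.homeomorphCircle_apply]
    ext
    rw [coe_circleExp_arg (annExp_ne_zero M z), norm_annExp, annExp]
    exact mul_div_cancel_left₀ _ (by exact_mod_cast (Real.exp_pos _).ne')
  · simp only [annLog, norm_annExp, Real.log_exp]
    field_simp
    ring

theorem annExp_annLog (M : ℝ) {z : ℂ} (hz : z ≠ 0) : annExp M (annLog M z) = z := by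
  have hpi := Real.pi_pos
  have hn : 0 < ‖z‖ := norm_pos_iff.2 hz
  have h1 : 2 * Real.pi * ((annLog M z).2 - M) = Real.log ‖z‖ := by
    simp only [annLog]
    field_simp
    ring
  have h2 : (AddCircle.toCircle (annLog M z).1 : ℂ) = z / ‖z‖ := by
    rw [← AddCircle.homeomorphCircle_apply (one_ne_zero' ℝ)]
    simp only [annLog, Homeomorph.apply_symm_apply, coe_circleExp_arg hz]
  rw [annExp, h1, h2, Real.exp_log hn]
  exact mul_div_cancel₀ _ (by exact_mod_cast hn.ne')

theorem continuousOn_annLog (M : ℝ) : ContinuousOn (annLog M) {0}ᶜ := by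
  unfold annLog
  refine ContinuousOn.prodMk ?_ ?_
  · refine (Homeomorph.continuous _).comp_continuousOn ?_
    have hemb : @IsEmbedding Circle ℂ _ _ (fun z => (z : ℂ)) := IsEmbedding.subtypeVal
    refine hemb.continuousOn_iff.2 ?_
    have h1 : ContinuousOn (fun z : ℂ => z / ‖z‖) {0}ᶜ :=
      ContinuousOn.div (by fun_prop) (by fun_prop) (fun z hz => by simpa using hz)
    exact h1.congr fun z hz => coe_circleExp_arg hz
  · refine ContinuousOn.add (ContinuousOn.div_const (ContinuousOn.log (by fun_prop) ?_) _)
      continuousOn_const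
    intro z hz
    simpa using hz

theorem mem_annExp_image {M : ℝ} {S : Set 𝔸} {z : ℂ} (hz : z ≠ 0) :
    z ∈ annExp M '' S ↔ annLog M z ∈ S := by
  constructor
  · rintro ⟨w, hw, rfl⟩
    rwa [annLog_annExp]
  · exact fun h => ⟨_, h, annExp_annLog M hz⟩

theorem norm_eq_exp_annLog (M : ℝ) {z : ℂ} (hz : z ≠ 0) :
    ‖z‖ = Real.exp (2 * Real.pi * ((annLog M z).2 - M)) := by
  rw [← norm_annExp, annExp_annLog M hz]

section Height

variable {u : 𝔸 → ℝ} {C : ℝ}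

theorem isOpen_annExp_preimage (M : ℝ) (hu : Continuous u) {V : Set ℝ} (hV : IsOpen V) :
    IsOpen ({0}ᶜ ∩ (fun z => u (annLog M z)) ⁻¹' V) :=
  (hu.comp_continuousOn (continuousOn_annLog M)).isOpen_inter_preimage isOpen_compl_singleton hV

theorem isOpen_insert_zero_annExp (M : ℝ) (hu : Continuous u) (hC : ∀ z, |u z - z.2| ≤ C) (t : ℝ) :
    IsOpen (insert 0 (annExp M '' {z | u z < t})) := by
  have hpi := Real.pi_pos
  rw [isOpen_iff_mem_nhds]
  intro z hz
  by_cases hz0 : z = 0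
  · subst hz0
    refine mem_of_superset (ball_mem_nhds 0 (Real.exp_pos (2 * Real.pi * (t - C - M)))) ?_
    intro z hz
    by_cases hz0 : z = 0
    · exact Or.inl hz0
    · refine Or.inr ((mem_annExp_image hz0).2 ?_)
      rw [mem_ball_zero_iff, norm_eq_exp_annLog M hz0, Real.exp_lt_exp] at hz
      have h1 := lt_of_mul_lt_mul_left hz (by positivity)
      have h2 := abs_le.1 (hC (annLog M z))
      change u (annLog M z) < t
      linarith [h2.2]
  · refine mem_of_superset ((isOpen_annExp_preimage M hu (isOpen_Iio (a := t))).mem_nhds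
      ⟨hz0, (mem_annExp_image hz0).1 (hz.resolve_left hz0)⟩) ?_
    rintro w ⟨hw0, hw⟩
    exact Or.inr ((mem_annExp_image hw0).2 hw)

theorem isCompact_insert_zero_annExp (M : ℝ) (hu : Continuous u) (hC : ∀ z, |u z - z.2| ≤ C)
    (t : ℝ) : IsCompact (insert 0 (annExp M '' {z | u z ≤ t})) := by
  have hpi := Real.pi_pos
  refine Metric.isCompact_of_isClosed_isBounded ?_ ?_
  · rw [← isOpen_compl_iff]
    convert isOpen_annExp_preimage M hu (isOpen_Ioi (a := t)) using 1
    ext z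
    by_cases hz0 : z = 0
    · simp [hz0]
    · have := mem_annExp_image (M := M) (S := {z | u z ≤ t}) hz0
      simp only [mem_compl_iff, mem_insert_iff, hz0, false_or, this, mem_inter_iff,
        mem_singleton_iff, not_false_eq_true, true_and, mem_preimage, mem_Ioi]
      exact not_le (a := u (annLog M z)) (b := t)
  · refine (Metric.isBounded_closedBall (x := (0 : ℂ))
      (r := Real.exp (2 * Real.pi * (t + C - M)))).subset ?_
    intro z hz
    by_cases hz0 : z = 0
    · rw [mem_closedBall_zero_iff, hz0, norm_zero]
      exact (Real.exp_pos _).le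
    · have h1 : u (annLog M z) ≤ t := (mem_annExp_image hz0).1 (hz.resolve_left hz0)
      rw [mem_closedBall_zero_iff, norm_eq_exp_annLog M hz0, Real.exp_le_exp]
      have h2 := abs_le.1 (hC (annLog M z))
      refine mul_le_mul_of_nonneg_left ?_ (by positivity)
      linarith [h2.1]

theorem isDiscDomain_insert_zero_annExp (hu : Continuous u) (hC : ∀ z, |u z - z.2| ≤ C) {s : ℝ}
    (hlow : IsPreconnected {z | u z < s}) (hup : IsPreconnected {z | s ≤ u z}) :
    IsDiscDomain (insert 0 (annExp (s + C) '' {z | u z < s})) := by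
  have hpi := Real.pi_pos
  set M := s + C with hM
  have hopen := isOpen_insert_zero_annExp M hu hC s
  have hlt : ∀ z : 𝔸, u z < s → z.2 < M := fun z hz => by
    have := abs_le.1 (hC z); rw [hM]; linarith [this.1]
  have hnorm : ∀ z : 𝔸, ‖annExp M z‖ ≤ 1 ↔ z.2 ≤ M := fun z => by
    rw [norm_annExp, Real.exp_le_one_iff]
    constructor
    · intro h; nlinarith
    · intro h; nlinarith
  refine ⟨hopen, ?_, ?_, mem_insert _ _, ?_⟩
  · refine ⟨⟨0, mem_insert _ _⟩, ?_⟩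
    refine (hlow.image _ (continuous_annExp M).continuousOn).subset_closure (subset_insert _ _) ?_
    refine insert_subset ?_ subset_closure
    rw [mem_closure_iff_nhds]
    intro U hU
    have h1 : U ∩ insert 0 (annExp M '' {z | u z < s}) ∈ 𝓝 (0 : ℂ) :=
      inter_mem hU (hopen.mem_nhds (mem_insert _ _))
    have h2 : (U ∩ insert 0 (annExp M '' {z | u z < s})) ∩ {0}ᶜ ∈ 𝓝[≠] (0 : ℂ) :=
      inter_mem (mem_nhdsWithin_of_mem_nhds h1) self_mem_nhdsWithin
    obtain ⟨z, ⟨hzU, hz⟩, hz0⟩ := NeBot.nonempty_of_mem (by infer_instance) h2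
    exact ⟨z, hzU, hz.resolve_left hz0⟩
  · rintro z (rfl | ⟨w, hw, rfl⟩)
    · simp
    · rw [mem_ball_zero_iff, norm_annExp, Real.exp_lt_one_iff]
      have := hlt w hw
      nlinarith
  · have hg : Continuous (fun z : 𝔸 => ((z.1, min z.2 M) : 𝔸)) := by fun_prop
    convert (hup.image _ hg.continuousOn).image _ (continuous_annExp M).continuousOn using 1
    ext z
    constructor
    · rintro ⟨hz, hzn⟩
      have hz0 : z ≠ 0 := fun h => hzn (Or.inl h)
      have h1 : ¬ u (annLog M z) < s := fun h => hzn (Or.inr ((mem_annExp_image hz0).2 h))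
      rw [mem_closedBall_zero_iff, ← annExp_annLog M hz0, hnorm] at hz
      refine ⟨annLog M z, ⟨annLog M z, not_lt.1 h1, ?_⟩, annExp_annLog M hz0⟩
      simp [min_eq_left hz]
    · rintro ⟨_, ⟨w, hw, rfl⟩, rfl⟩
      refine ⟨by rw [mem_closedBall_zero_iff, hnorm]; exact min_le_right _ _, ?_⟩
      rintro (h | ⟨w', hw', h⟩)
      · exact annExp_ne_zero _ _ h
      · have h2 : w' = (w.1, min w.2 M) := by
          rw [← annLog_annExp M w', h, annLog_annExp]
        rcases le_or_gt w.2 M with h3 | h3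
        · rw [min_eq_left h3] at h2
          rw [h2] at hw'
          exact absurd (show u w < s from hw') (not_lt.2 hw)
        · rw [min_eq_right h3.le] at h2
          have := hlt w' hw'
          rw [h2] at this
          exact lt_irrefl _ this

/-- Polar coordinates near the upper end of a lower half annulus. -/
theorem exists_polar_coordinates (hu : Continuous u) (hC : ∀ z, |u z - z.2| ≤ C) {s s₁ : ℝ}
    (hs₁ : s₁ < s) (hlow : IsPreconnected {z | u z < s}) (hup : IsPreconnected {z | s ≤ u z}) :
    ∃ (s₃ : ℝ) (ψ : ℂ → 𝔸) (a b R : ℝ), 0 < a ∧ a < b ∧ b < R ∧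
      ContinuousOn ψ (closedBall 0 R \ {0}) ∧ InjOn ψ (closedBall 0 R \ {0}) ∧
      (∀ r ≤ R, IsOpen (ψ '' (ball 0 r \ {0}))) ∧
      (∀ r ≤ R, IsClosed (ψ '' (closedBall 0 r \ {0}))) ∧
      (∀ ζ ∈ closedBall 0 R \ {0}, u (ψ ζ) < s) ∧
      (∀ ζ ∈ closedBall 0 a \ {0}, u (ψ ζ) ≤ s₃) ∧
      {z | u z ≤ s₁} ⊆ ψ '' (ball 0 a \ {0}) ∧ {z | u z ≤ s₃} ⊆ ψ '' (ball 0 b \ {0}) := by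
  set M := s + C with hM
  set Ω := insert 0 (annExp M '' {z | u z < s}) with hΩdef
  have hΩ : IsDiscDomain Ω := isDiscDomain_insert_zero_annExp hu hC hlow hup
  obtain ⟨s₃, hs₃, φ, p, a, b, R, ha, hab, hbR, hR1, hφ, hR, hpa, h1, h3⟩ :=
    hΩ.exists_isDiscChart_of_exhaustion (K := fun t => insert 0 (annExp M '' {z | u z ≤ t})) hs₁
      (fun t _ => isCompact_insert_zero_annExp M hu hC t)
      (fun t ht => insert_subset_insert (image_mono fun z (hz : u z ≤ t) => hz.trans_lt ht))
      (by
        intro K hK hKΩ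
        have hdir : Directed (· ⊆ ·)
            (fun t : Iio s => (insert 0 (annExp M '' {z | u z < (t : ℝ)}) : Set ℂ)) :=
          Monotone.directed_le fun t t' htt => insert_subset_insert
            (image_mono fun z (hz : u z < t) => hz.trans_le htt)
        have : Nonempty (Iio s) := ⟨⟨s₁, hs₁⟩⟩
        obtain ⟨t, ht⟩ := hK.elim_directed_cover
          (fun t : Iio s => (insert 0 (annExp M '' {z | u z < (t : ℝ)}) : Set ℂ))
          (fun t => isOpen_insert_zero_annExp M hu hC t) (fun z hz => by
            rw [mem_iUnion]
            rcases hKΩ hz with h | ⟨w, hw, rfl⟩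
            · exact ⟨⟨s₁, hs₁⟩, Or.inl h⟩
            · obtain ⟨t, ht1, ht2⟩ := exists_between (show u w < s from hw)
              exact ⟨⟨t, ht2⟩, Or.inr ⟨w, ht1, rfl⟩⟩) hdir
        exact ⟨t, t.2, ht.trans (insert_subset_insert
          (image_mono fun z (hz : u z < t) => hz.le))⟩)
  have hp0 : p 0 = 0 := by
    have := hφ.left_inv 0 hΩ.zero_mem
    rwa [hφ.map_zero] at this
  have hpΩ : ∀ ζ ∈ closedBall (0 : ℂ) R, p ζ ∈ Ω ∧ φ (p ζ) = ζ := fun ζ hζ => by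
    obtain ⟨z, hz, rfl⟩ := hR hζ
    rw [hφ.left_inv z hz]
    exact ⟨hz, rfl⟩
  have hpinj : InjOn p (closedBall 0 R) := fun x hx y hy hxy => by
    rw [← (hpΩ x hx).2, hxy, (hpΩ y hy).2]
  have hR0 : 0 < R := by linarith
  have hpne : ∀ ζ ∈ closedBall (0 : ℂ) R \ {0}, p ζ ≠ 0 := fun ζ hζ h =>
    hζ.2 (hpinj hζ.1 (by simpa using hR0.le) (h.trans hp0.symm))
  have hpc : ContinuousOn p (closedBall 0 R) :=
    hφ.continuousOn.mono (closedBall_subset_closedBall hR1.le)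
  have himage : ∀ S ⊆ closedBall (0 : ℂ) R, (fun ζ => annLog M (p ζ)) '' (S \ {0}) =
      annExp M ⁻¹' (p '' S) := by
    intro S hS
    ext w
    constructor
    · rintro ⟨ζ, hζ, rfl⟩
      exact ⟨ζ, hζ.1, (annExp_annLog M (hpne ζ ⟨hS hζ.1, hζ.2⟩)).symm⟩
    · rintro ⟨ζ, hζ, h⟩
      refine ⟨ζ, ⟨hζ, fun h0 => ?_⟩, ?_⟩
      · rw [mem_singleton_iff] at h0
        rw [h0, hp0] at h
        exact annExp_ne_zero _ _ h.symm
      · simp only [h, annLog_annExp]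
  have hsub : ∀ t r, r ≤ R → t < s → (∀ z ∈ insert 0 (annExp M '' {z | u z ≤ t}), ‖φ z‖ < r) →
      {z | u z ≤ t} ⊆ (fun ζ => annLog M (p ζ)) '' (ball 0 r \ {0}) := by
    intro t r hr ht h w hw
    rw [himage _ (ball_subset_closedBall.trans (closedBall_subset_closedBall hr))]
    have hwt : annExp M w ∈ annExp M '' {z | u z ≤ t} := ⟨w, hw, rfl⟩
    refine ⟨φ (annExp M w), by simpa using h _ (Or.inr hwt), hφ.left_inv _ (Or.inr ?_)⟩
    exact ⟨w, lt_of_le_of_lt hw ht, rfl⟩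
  refine ⟨s₃, fun ζ => annLog M (p ζ), a, b, R, ha, hab, hbR, ?_, ?_, ?_, ?_, ?_, ?_,
    hsub s₁ a (by linarith) hs₁ h1, hsub s₃ b hbR.le hs₃ h3⟩
  · exact (continuousOn_annLog M).comp (hpc.mono sdiff_subset) hpne
  · intro x hx y hy hxy
    refine hpinj hx.1 hy.1 ?_
    rw [← annExp_annLog M (hpne x hx), ← annExp_annLog M (hpne y hy)]
    exact congrArg _ hxy
  · intro r hr
    have hrR : ball (0 : ℂ) r ⊆ closedBall 0 R :=
      ball_subset_closedBall.trans (closedBall_subset_closedBall hr)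
    rw [himage _ hrR]
    refine IsOpen.preimage (continuous_annExp M) ?_
    convert hφ.differentiableOn.continuousOn.isOpen_inter_preimage hΩ.isOpen (isOpen_ball (x := 0)
      (ε := r)) using 1
    ext z
    constructor
    · rintro ⟨ζ, hζ, rfl⟩
      refine ⟨(hpΩ ζ (hrR hζ)).1, ?_⟩
      rw [mem_preimage, (hpΩ ζ (hrR hζ)).2]
      exact hζ
    · rintro ⟨hz, hzr⟩
      exact ⟨φ z, hzr, hφ.left_inv z hz⟩
  · intro r hr
    have hrR : closedBall (0 : ℂ) r ⊆ closedBall 0 R := closedBall_subset_closedBall hr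
    rw [himage _ hrR]
    exact ((isCompact_closedBall 0 r).image_of_continuousOn (hpc.mono hrR)).isClosed.preimage
      (continuous_annExp M)
  · intro ζ hζ
    exact (mem_annExp_image (hpne ζ hζ)).1 ((hpΩ ζ hζ.1).1.resolve_left (hpne ζ hζ))
  · intro ζ hζ
    have hζR : ζ ∈ closedBall (0 : ℂ) R \ {0} :=
      ⟨closedBall_subset_closedBall (by linarith) hζ.1, hζ.2⟩
    exact (mem_annExp_image (hpne ζ hζR)).1 ((hpa ⟨ζ, hζ.1, rfl⟩).resolve_left (hpne ζ hζR))

end Height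

/-! ### Essential continua and annuli from level-like sets -/

section Height

variable {u : 𝔸 → ℝ} {C : ℝ}

/-- A continuum which is, up to closure, the boundary of a lower neighbourhood is essential. -/
theorem isEssentialContinuum_of_boundary (hC : ∀ z, |u z - z.2| ≤ C) {E W : Set 𝔸} {a b : ℝ}
    (hE : IsCompact E) (hEc : IsConnected E) (hW : IsOpen W) (hWE : Disjoint W E)
    (hcl : IsClosed (W ∪ E)) (ha : {z | u z ≤ a} ⊆ W) (hb : W ⊆ {z | u z < b}) :
    IsEssentialContinuum E := by
  have hC' : ∀ z : 𝔸, u z - C ≤ z.2 ∧ z.2 ≤ u z + C := fun z => by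
    have := abs_le.1 (hC z)
    constructor <;> linarith [this.1, this.2]
  obtain ⟨m, hm⟩ := (hE.image continuous_snd).bddAbove
  have hmE : ∀ z ∈ E, z.2 ≤ m := fun z hz => hm ⟨z, hz, rfl⟩
  set cp := max m (b + C) with hcp
  set cm := a - C with hcm
  have hdown : ∀ z : 𝔸, z.2 < cm → z ∈ W := fun z hz => ha (by
    have := (hC' z).1
    rw [mem_ofPred_eq]; linarith)
  have hWcp : ∀ z ∈ W, z.2 ≤ cp := fun z hz =>
    ((hC' z).2.trans (by have : u z < b := hb hz; linarith)).trans (le_max_right _ _)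
  have hEcp : ∀ z ∈ E, z.2 ≤ cp := fun z hz => (hmE z hz).trans (le_max_left _ _)
  have hEW : ∀ z ∈ W, z ∉ E := fun z h1 h2 => disjoint_left.1 hWE h1 h2
  let Dp : Set 𝔸 := univ ×ˢ Ioi cp
  let Dm : Set 𝔸 := univ ×ˢ Iio cm
  have hDp : IsPreconnected Dp := isPreconnected_univ.prod isPreconnected_Ioi
  have hDm : IsPreconnected Dm := isPreconnected_univ.prod isPreconnected_Iio
  have hDpE : Dp ⊆ Eᶜ := fun z hz hzE => absurd (hEcp z hzE) (not_le.2 hz.2)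
  have hDmE : Dm ⊆ Eᶜ := fun z hz => hEW z (hdown z hz.2)
  let zp : 𝔸 := (0, cp + 1)
  let zm : 𝔸 := (0, cm - 1)
  have hzp : zp ∈ Dp := ⟨mem_univ _, by simp [zp]⟩
  have hzm : zm ∈ Dm := ⟨mem_univ _, by simp [zm]⟩
  have hDpU : Dp ⊆ connectedComponentIn Eᶜ zp := hDp.subset_connectedComponentIn hzp hDpE
  have hDmV : Dm ⊆ connectedComponentIn Eᶜ zm := hDm.subset_connectedComponentIn hzm hDmE
  have hsep : ∀ S : Set 𝔸, IsPreconnected S → S ⊆ Eᶜ →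
      (S ∩ W).Nonempty → S ⊆ W := fun S hS hSE hne =>
    hS.subset_left_of_subset_union hW hcl.isOpen_compl
      (disjoint_compl_right.mono_left subset_union_left)
      (fun z hz => by
        by_cases hzW : z ∈ W
        · exact Or.inl hzW
        · exact Or.inr fun h => h.elim hzW (hSE hz)) hne
  have hV : connectedComponentIn Eᶜ zm ⊆ W :=
    hsep _ isPreconnected_connectedComponentIn (connectedComponentIn_subset _ _)
      ⟨zm, mem_connectedComponentIn (hDmE hzm), hdown zm hzm.2⟩
  have hU : ∀ z ∈ connectedComponentIn Eᶜ zp, z ∉ W := fun z hz hzW => by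
    have := hsep _ isPreconnected_connectedComponentIn (connectedComponentIn_subset _ _)
      ⟨z, hz, hzW⟩ (mem_connectedComponentIn (hDpE hzp))
    exact absurd (hWcp _ this) (not_le.2 hzp.2)
  refine ⟨hE, hEc, connectedComponentIn Eᶜ zp, connectedComponentIn Eᶜ zm,
    ⟨zp, hDpE hzp, rfl⟩, ⟨zm, hDmE hzm, rfl⟩, ?_, ?_, ?_, ?_, ?_, ?_⟩
  · intro h
    exact hU zm (h ▸ mem_connectedComponentIn (hDmE hzm)) (hdown zm hzm.2)
  · rintro ⟨B, hB⟩
    have h1 : ((0, max cp B + 1) : 𝔸) ∈ Dp :=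
      ⟨mem_univ _, by have := le_max_left cp B; rw [mem_Ioi]; linarith⟩
    have h2 := hB ⟨_, hDpU h1, rfl⟩
    have := le_max_right cp B
    simp only at h2
    linarith
  · intro h
    apply h
    refine ⟨cm, ?_⟩
    rintro _ ⟨z, hz, rfl⟩
    by_contra hcon
    exact hU z hz (hdown z (not_le.1 hcon))
  · rintro ⟨B, hB⟩
    have h1 : ((0, min cm B - 1) : 𝔸) ∈ Dm :=
      ⟨mem_univ _, by have := min_le_left cm B; rw [mem_Iio]; linarith⟩
    have h2 := hB ⟨_, hDmV h1, rfl⟩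
    have := min_le_right cm B
    simp only at h2
    linarith
  · intro h
    apply h
    refine ⟨cp, ?_⟩
    rintro _ ⟨z, hz, rfl⟩
    exact hWcp z (hV hz)
  · rintro _ ⟨z, hz, rfl⟩ hunb
    by_cases h1 : ∃ w ∈ connectedComponentIn Eᶜ z, w ∈ Dp
    · obtain ⟨w, hw, hwD⟩ := h1
      left
      rw [connectedComponentIn_eq hw, ← connectedComponentIn_eq (hDpU hwD)]
    by_cases h2 : ∃ w ∈ connectedComponentIn Eᶜ z, w ∈ Dm
    · obtain ⟨w, hw, hwD⟩ := h2
      right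
      rw [connectedComponentIn_eq hw, ← connectedComponentIn_eq (hDmV hwD)]
    exfalso
    push Not at h1 h2
    apply hunb
    refine ((isCompact_univ (X := 𝕊)).prod (isCompact_Icc (a := cm) (b := cp))).isBounded.subset ?_
    intro w hw
    refine ⟨mem_univ _, ?_, ?_⟩
    · exact not_lt.1 fun h => h2 w hw ⟨mem_univ _, h⟩
    · exact not_lt.1 fun h => h1 w hw ⟨mem_univ _, h⟩

theorem le_setDist {s t : Set 𝔸} {c : ℝ} (hs : s.Nonempty) (ht : t.Nonempty)
    (h : ∀ x ∈ s, ∀ y ∈ t, c ≤ dist x y) : c ≤ setDist s t := by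
  obtain ⟨x, hx⟩ := hs
  obtain ⟨y, hy⟩ := ht
  refine le_csInf ⟨_, x, hx, y, hy, rfl⟩ ?_
  rintro _ ⟨x, hx, y, hy, rfl⟩
  exact h x hx y hy

theorem setDist_le_lw {A C₁ C₂ : Set 𝔸} (hA : Bornology.IsBounded A)
    (h₁ : IsEssentialContinuum C₁) (h₂ : IsEssentialContinuum C₂) (h₁A : C₁ ⊆ A) (h₂A : C₂ ⊆ A) :
    setDist C₁ C₂ ≤ lw A := by
  refine le_csSup ⟨Metric.diam A, ?_⟩ ⟨C₁, C₂, h₁, h₂, h₁A, h₂A, rfl⟩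
  rintro _ ⟨D₁, D₂, hD₁, hD₂, hD₁A, hD₂A, rfl⟩
  obtain ⟨x, hx⟩ := hD₁.2.1.nonempty
  obtain ⟨y, hy⟩ := hD₂.2.1.nonempty
  have hb : BddBelow {r | ∃ x ∈ D₁, ∃ y ∈ D₂, r = dist x y} :=
    ⟨0, by rintro _ ⟨x, _, y, _, rfl⟩; exact dist_nonneg⟩
  have h : setDist D₁ D₂ ≤ dist x y := csInf_le hb ⟨x, hx, y, hy, rfl⟩
  exact h.trans (Metric.dist_le_diam_of_mem hA (hD₁A hx) (hD₂A hy))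

theorem circle_image_eq {r : ℝ} (hr : 0 < r) :
    range (fun t : 𝕊 => (r : ℂ) * (AddCircle.toCircle t : ℂ)) = sphere 0 r := by
  ext z
  rw [mem_sphere_zero_iff_norm]
  constructor
  · rintro ⟨t, rfl⟩
    beta_reduce
    rw [norm_mul, Circle.norm_coe, mul_one, Complex.norm_real, Real.norm_of_nonneg hr.le]
  · rintro h
    have hz : z ≠ 0 := by
      rintro rfl
      simp at h
      exact hr.ne h
    refine ⟨(AddCircle.homeomorphCircle (one_ne_zero' ℝ)).symm (Circle.exp z.arg), ?_⟩
    have h1 := AddCircle.homeomorphCircle_apply (one_ne_zero' ℝ)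
      ((AddCircle.homeomorphCircle (one_ne_zero' ℝ)).symm (Circle.exp z.arg))
    rw [Homeomorph.apply_symm_apply] at h1
    simp only [← h1, coe_circleExp_arg hz, h]
    exact mul_div_cancel₀ _ (by exact_mod_cast hr.ne')

theorem exists_annulus_and_loop (hu : UniformContinuous u) (hC : ∀ z, |u z - z.2| ≤ C)
    {s s₁ : ℝ} (hs₁ : s₁ < s) (hlow : IsPreconnected {z | u z < s})
    (hup : IsPreconnected {z | s ≤ u z}) :
    ∃ A Γ W : Set 𝔸, IsClosedEssentialAnnulus A ∧ IsEssentialSimpleLoop Γ ∧ Γ ⊆ Aᶜ ∧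
      IsOpen W ∧ IsClosed (W ∪ Γ) ∧ {z | u z ≤ s₁} ⊆ W ∧ W ⊆ {z | u z < s} ∧
      A ⊆ {z | s₁ < u z ∧ u z < s} ∧
      (∀ z, u z ≤ s₁ → ∀ w ∈ Γ, connectedComponentIn Aᶜ z ≠ connectedComponentIn Aᶜ w) ∧
      ∃ c > 0, ∀ g : 𝔸 → 𝔸, IsHomeomorph g → ∀ e, (∀ z, u (g z) = u z + e) →
        c ≤ lw (g '' A) := by
  obtain ⟨s₃, ψ, a, b, R, ha, hab, hbR, hψc, hψi, hop, hcl, hs, hs₃, hK₁, hK₃⟩ :=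
    exists_polar_coordinates hu.continuous hC hs₁ hlow hup
  have hmem : ∀ {r : ℝ} {ζ : ℂ}, 0 < r → r ≤ R → ζ ∈ sphere (0 : ℂ) r →
      ζ ∈ closedBall (0 : ℂ) R \ {0} := fun {r ζ} hr hrR hζ => by
    rw [mem_sphere_zero_iff_norm] at hζ
    refine ⟨by rw [mem_closedBall_zero_iff, hζ]; exact hrR, ?_⟩
    rw [mem_singleton_iff, ← norm_eq_zero, hζ]
    exact hr.ne'
  have hball : ∀ {r : ℝ}, r ≤ R → ball (0 : ℂ) r \ {0} ⊆ closedBall 0 R \ {0} := fun {r} hr =>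
    sdiff_subset_sdiff_left (ball_subset_closedBall.trans (closedBall_subset_closedBall hr))
  have hdisj : ∀ r, r ≤ R → 0 < r → ∀ r', r ≤ r' → r' ≤ R →
      Disjoint (ψ '' (ball 0 r \ {0})) (ψ '' sphere 0 r') := by
    intro r hr hr0 r' hrr hr'
    rw [disjoint_left]
    rintro _ ⟨ζ, hζ, rfl⟩ ⟨ζ', hζ', h⟩
    have := hψi (hmem (hr0.trans_le hrr) hr' hζ') (hball hr hζ) h
    subst this
    have h1 := mem_ball_zero_iff.1 hζ.1
    rw [mem_sphere_zero_iff_norm.1 hζ'] at h1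
    linarith
  have hunion : ∀ r, 0 < r → ψ '' (ball 0 r \ {0}) ∪ ψ '' sphere 0 r =
      ψ '' (closedBall 0 r \ {0}) := by
    intro r hr
    rw [← image_union, ← ball_union_sphere, union_sdiff_distrib]
    congr 2
    refine (sdiff_singleton_eq_self ?_).symm
    rw [mem_sphere_zero_iff_norm, norm_zero]
    exact hr.ne
  have hinvol : ∀ r, 0 < r → r ≤ R → ∃ γ : 𝕊 → 𝔸, Continuous γ ∧ Function.Injective γ ∧
      ψ '' sphere 0 r = range γ := by
    intro r hr hrR
    have hcont : Continuous (fun t : 𝕊 => (r : ℂ) * (AddCircle.toCircle t : ℂ)) := by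
      have : Continuous (AddCircle.toCircle : 𝕊 → Circle) := AddCircle.continuous_toCircle
      fun_prop
    have hmaps : ∀ t : 𝕊, (r : ℂ) * (AddCircle.toCircle t : ℂ) ∈ sphere (0 : ℂ) r := fun t => by
      rw [← circle_image_eq hr]; exact mem_range_self t
    refine ⟨fun t => ψ ((r : ℂ) * (AddCircle.toCircle t : ℂ)), ?_, ?_, ?_⟩
    · exact hψc.comp_continuous hcont fun t => hmem hr hrR (hmaps t)
    · intro t t' h
      have h1 := hψi (hmem hr hrR (hmaps t)) (hmem hr hrR (hmaps t')) h
      have h2 := mul_left_cancel₀ (show (r : ℂ) ≠ 0 by exact_mod_cast hr.ne') h1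
      exact AddCircle.injective_toCircle one_ne_zero (Circle.ext h2)
    · rw [← circle_image_eq hr, ← range_comp]
      rfl
  have hlev : ∀ {r : ℝ}, r ≤ R → ψ '' (ball 0 r \ {0}) ⊆ {z | u z < s} := by
    rintro r hr _ ⟨ζ, hζ, rfl⟩
    exact hs ζ (hball hr hζ)
  have hmono : ∀ {r r' : ℝ}, r ≤ r' → ψ '' (ball 0 r \ {0}) ⊆ ψ '' (ball 0 r' \ {0}) :=
    fun hr => image_mono (sdiff_subset_sdiff_left (ball_subset_ball hr))
  have hess : ∀ r, a ≤ r → r ≤ R → ∀ g : 𝔸 → 𝔸, IsHomeomorph g → ∀ e, (∀ z, u (g z) = u z + e) →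
      IsEssentialContinuum (g '' (ψ '' sphere 0 r)) := by
    intro r har hrR g hg e hge
    have hr : 0 < r := ha.trans_le har
    obtain ⟨γ, hγ, -, hγr⟩ := hinvol r hr hrR
    have hcomp : IsCompact (ψ '' sphere 0 r) := hγr ▸ isCompact_range hγ
    have hconn : IsConnected (ψ '' sphere 0 r) := hγr ▸ isConnected_range hγ
    refine isEssentialContinuum_of_boundary hC (W := g '' (ψ '' (ball 0 r \ {0})))
      (a := s₁ + e) (b := s + e) (hcomp.image hg.continuous)
      (hconn.image _ hg.continuous.continuousOn) (hg.isOpenMap _ (hop r hrR)) ?_ ?_ ?_ ?_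
    · exact (disjoint_image_iff hg.injective).2 (hdisj r hrR hr r le_rfl hrR)
    · rw [← image_union, hunion r hr]
      exact hg.isClosedMap _ (hcl r hrR)
    · intro z hz
      obtain ⟨w, rfl⟩ := hg.surjective z
      rw [mem_ofPred_eq, hge] at hz
      exact ⟨w, hmono har (hK₁ (show u w ≤ s₁ by linarith)), rfl⟩
    · rintro _ ⟨w, hw, rfl⟩
      rw [mem_ofPred_eq, hge]
      have : u w < s := hlev hrR hw
      linarith
  have hess' : ∀ r, a ≤ r → r ≤ R → IsEssentialSimpleLoop (ψ '' sphere 0 r) := by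
    intro r har hrR
    refine ⟨hinvol r (ha.trans_le har) hrR, ?_⟩
    have := hess r har hrR id (Homeomorph.refl 𝔸).isHomeomorph 0 (by simp)
    rwa [image_id] at this
  set D : Set ℂ := {ζ | a ≤ ‖ζ‖ ∧ ‖ζ‖ ≤ b} with hD
  have hDR : D ⊆ closedBall 0 R \ {0} := fun ζ hζ =>
    hmem (ha.trans_le hζ.1) (hζ.2.trans hbR.le) (mem_sphere_zero_iff_norm.2 rfl)
  have hDc : IsCompact D := by
    refine (isCompact_closedBall (0 : ℂ) b).of_isClosed_subset ?_ fun ζ hζ => by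
      simpa using hζ.2
    exact (isClosed_le continuous_const continuous_norm).inter
      (isClosed_le continuous_norm continuous_const)
  have hAW : Disjoint (ψ '' (ball 0 a \ {0})) (ψ '' D) := by
    rw [disjoint_left]
    rintro _ ⟨ζ, hζ, rfl⟩ ⟨ζ', hζ', h⟩
    have := hψi (hDR hζ') (hball (by linarith) hζ) h
    subst this
    have h1 := mem_ball_zero_iff.1 hζ.1
    linarith [hζ'.1]
  have hca : ψ '' sphere 0 a ⊆ ψ '' D := image_mono fun ζ hζ => by
    rw [mem_sphere_zero_iff_norm] at hζ
    exact ⟨hζ.ge, hζ.le.trans hab.le⟩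
  have hcb : ψ '' sphere 0 b ⊆ ψ '' D := image_mono fun ζ hζ => by
    rw [mem_sphere_zero_iff_norm] at hζ
    exact ⟨hab.le.trans hζ.ge, hζ.le⟩
  have hR0 : 0 < R := by linarith
  refine ⟨ψ '' D, ψ '' sphere 0 R, ψ '' (ball 0 R \ {0}),
    ⟨?_, _, hca, hess' a le_rfl (by linarith)⟩,
    hess' R (by linarith) le_rfl, ?_, hop R le_rfl, ?_, hK₁.trans (hmono (by linarith)),
    hlev le_rfl, ?_, ?_, ?_⟩
  · have hcont : Continuous (fun q : 𝕊 × Icc (0 : ℝ) 1 =>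
        ((a + q.2 * (b - a) : ℝ) : ℂ) * (AddCircle.toCircle q.1 : ℂ)) := by
      have : Continuous (AddCircle.toCircle : 𝕊 → Circle) := AddCircle.continuous_toCircle
      fun_prop
    have hpos : ∀ l : Icc (0 : ℝ) 1, 0 < a + l * (b - a) := fun l => by
      nlinarith [l.2.1]
    have hle : ∀ l : Icc (0 : ℝ) 1, a + l * (b - a) ≤ b := fun l => by
      nlinarith [l.2.2]
    have hnorm : ∀ q : 𝕊 × Icc (0 : ℝ) 1,
        ‖((a + q.2 * (b - a) : ℝ) : ℂ) * (AddCircle.toCircle q.1 : ℂ)‖ = a + q.2 * (b - a) :=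
      fun q => by
        rw [norm_mul, Circle.norm_coe, mul_one, Complex.norm_real, Real.norm_of_nonneg (hpos _).le]
    have hmaps : ∀ q : 𝕊 × Icc (0 : ℝ) 1,
        ((a + q.2 * (b - a) : ℝ) : ℂ) * (AddCircle.toCircle q.1 : ℂ) ∈ D := fun q => by
      rw [hD, mem_ofPred_eq, hnorm]
      exact ⟨by nlinarith [q.2.2.1], hle _⟩
    refine ⟨fun q => ψ (((a + q.2 * (b - a) : ℝ) : ℂ) * (AddCircle.toCircle q.1 : ℂ)), ?_, ?_, ?_⟩
    · exact hψc.comp_continuous hcont fun q => hDR (hmaps q)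
    · intro q q' h
      have h1 := hψi (hDR (hmaps q)) (hDR (hmaps q')) h
      have h2 : a + (q.2 : ℝ) * (b - a) = a + (q'.2 : ℝ) * (b - a) := by
        rw [← hnorm q, h1, hnorm q']
      have h3 : (q.2 : ℝ) = q'.2 := mul_right_cancel₀ (sub_pos.2 hab).ne' (add_left_cancel h2)
      rw [h3] at h1
      have h4 := mul_left_cancel₀
        (show ((a + q'.2 * (b - a) : ℝ) : ℂ) ≠ 0 by exact_mod_cast (hpos q'.2).ne') h1
      exact Prod.ext (AddCircle.injective_toCircle one_ne_zero (Circle.ext h4)) (Subtype.ext h3)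
    · ext z
      constructor
      · rintro ⟨ζ, hζ, rfl⟩
        have hζ0 : 0 < ‖ζ‖ := ha.trans_le hζ.1
        have hζs : ζ ∈ sphere (0 : ℂ) ‖ζ‖ := mem_sphere_zero_iff_norm.2 rfl
        rw [← circle_image_eq hζ0] at hζs
        obtain ⟨t, ht⟩ := hζs
        have hba : 0 < b - a := sub_pos.2 hab
        refine ⟨(t, ⟨(‖ζ‖ - a) / (b - a), div_nonneg (by linarith [hζ.1]) hba.le,
          (div_le_one hba).2 (by linarith [hζ.2])⟩), ?_⟩
        simp only [div_mul_cancel₀ _ hba.ne', add_sub_cancel]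
        exact congrArg ψ ht
      · rintro ⟨q, rfl⟩
        exact ⟨_, hmaps q, rfl⟩
  · rintro _ ⟨ζ, hζ, rfl⟩ ⟨ζ', hζ', h⟩
    have := hψi (hDR hζ') (hmem hR0 le_rfl hζ) h
    subst this
    rw [mem_sphere_zero_iff_norm] at hζ
    linarith [hζ'.2]
  · rw [hunion R hR0]
    exact hcl R le_rfl
  · rintro _ ⟨ζ, hζ, rfl⟩
    refine ⟨?_, hs ζ (hDR hζ)⟩
    by_contra hcon
    exact disjoint_left.1 hAW (hK₁ (not_lt.1 hcon)) ⟨ζ, hζ, rfl⟩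
  · intro z hz w hw heq
    have hzW : z ∈ ψ '' (ball 0 a \ {0}) := hK₁ hz
    have hzA : z ∈ (ψ '' D)ᶜ := fun h => disjoint_left.1 hAW hzW h
    have hsub : connectedComponentIn (ψ '' D)ᶜ z ⊆ ψ '' (ball 0 a \ {0}) :=
      isPreconnected_connectedComponentIn.subset_left_of_subset_union (hop a (by linarith))
        (hcl a (by linarith)).isOpen_compl
        (disjoint_compl_right.mono_left
          (image_mono (sdiff_subset_sdiff_left ball_subset_closedBall)))
        (fun x hx => by
          by_cases hxW : x ∈ ψ '' (ball 0 a \ {0})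
          · exact Or.inl hxW
          · refine Or.inr fun h => ?_
            rw [← hunion a ha] at h
            exact connectedComponentIn_subset _ _ hx (hca (h.resolve_left hxW)))
        ⟨z, mem_connectedComponentIn hzA, hzW⟩
    by_cases hwA : w ∈ ψ '' D
    · have h1 := mem_connectedComponentIn hzA
      rw [heq, connectedComponentIn_eq_empty (by simpa using hwA)] at h1
      exact h1
    · have h1 := mem_connectedComponentIn (show w ∈ (ψ '' D)ᶜ from hwA)
      rw [← heq] at h1
      exact disjoint_left.1 (hdisj a (by linarith) ha R (by linarith) le_rfl) (hsub h1) hw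
  · obtain ⟨γ, hγ, -, hγr⟩ := hinvol b (ha.trans hab) hbR.le
    have hcompb : IsCompact (ψ '' sphere 0 b) := hγr ▸ isCompact_range hγ
    have hneb : (ψ '' sphere 0 b).Nonempty := hγr ▸ range_nonempty γ
    obtain ⟨m, hm, hmin⟩ := hcompb.exists_isMinOn hneb hu.continuous.continuousOn
    have hm3 : s₃ < u m := by
      by_contra hcon
      exact disjoint_left.1 (hdisj b hbR.le (ha.trans hab) b le_rfl hbR.le)
        (hK₃ (not_lt.1 hcon)) hm
    obtain ⟨c, hc, hcu⟩ := Metric.uniformContinuous_iff.1 hu (u m - s₃) (sub_pos.2 hm3)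
    refine ⟨c, hc, fun g hg e hge => ?_⟩
    have hA : IsCompact (ψ '' D) := hDc.image_of_continuousOn (hψc.mono hDR)
    have h1 := hess a le_rfl (by linarith) g hg e hge
    have h2 := hess b hab.le hbR.le g hg e hge
    refine le_trans ?_ (setDist_le_lw (hA.image hg.continuous).isBounded h1 h2
      (image_mono hca) (image_mono hcb))
    refine le_setDist h1.2.1.nonempty h2.2.1.nonempty ?_
    rintro _ ⟨_, ⟨ζ, hζ, rfl⟩, rfl⟩ _ ⟨y, hy, rfl⟩
    by_contra hcon
    have h3 := hcu (not_le.1 hcon)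
    rw [hge, hge, Real.dist_eq] at h3
    have h4 : u (ψ ζ) ≤ s₃ := hs₃ ζ ⟨by simpa using (mem_sphere_zero_iff_norm.1 hζ).le,
      (hmem ha (by linarith) hζ).2⟩
    have h5 : u m ≤ u y := hmin hy
    have h6 := neg_abs_le (u (ψ ζ) + e - (u y + e))
    linarith

end Height

/-! ### Lifting circle valued maps -/

section Lifting

theorem isOpenQuotientMap_coe_circle : IsOpenQuotientMap ((↑) : ℝ → 𝕊) :=
  QuotientAddGroup.isOpenQuotientMap_mk

theorem isOpenQuotientMap_τ : IsOpenQuotientMap τ :=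
  isOpenQuotientMap_coe_circle.prodMap IsOpenQuotientMap.id

theorem isOpenQuotientMap_θ : IsOpenQuotientMap θ :=
  IsOpenQuotientMap.id.prodMap isOpenQuotientMap_coe_circle

instance locallyConnectedSpace_annulus : LocallyConnectedSpace 𝔸 :=
  isOpenQuotientMap_τ.isQuotientMap.isCoinducing.locallyConnectedSpace

theorem coe_eq_coe_iff {a b : ℝ} : (a : 𝕊) = b ↔ ∃ n : ℤ, a = b + n := by
  rw [← sub_eq_zero, ← AddCircle.coe_sub, AddCircle.coe_eq_zero_iff]
  constructor
  · rintro ⟨n, hn⟩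
    exact ⟨n, by simp only [zsmul_eq_mul, mul_one] at hn; linarith⟩
  · rintro ⟨n, hn⟩
    exact ⟨n, by simp only [zsmul_eq_mul, mul_one]; linarith⟩

theorem τ_eq_τ_iff {p q : ℝ × ℝ} : τ p = τ q ↔ ∃ n : ℤ, p = q + ((n : ℝ), 0) := by
  simp only [τ, Prod.ext_iff, coe_eq_coe_iff, Prod.fst_add, Prod.snd_add, add_zero]
  exact ⟨fun ⟨⟨n, hn⟩, h⟩ => ⟨n, hn, h⟩, fun ⟨n, hn, h⟩ => ⟨⟨n, hn⟩, h⟩⟩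

theorem θ_eq_θ_iff {p q : 𝔸} : θ p = θ q ↔ ∃ n : ℤ, p = (q.1, q.2 + n) := by
  simp only [θ, Prod.ext_iff, coe_eq_coe_iff]
  exact ⟨fun ⟨h, n, hn⟩ => ⟨n, h, hn⟩, fun ⟨n, h, hn⟩ => ⟨h, n, hn⟩⟩

theorem exists_int_of_coe_eq_zero {X : Type*} [TopologicalSpace X] {g : X → ℝ} {s : Set X}
    (hs : IsPreconnected s) (hg : ContinuousOn g s) (h : ∀ x ∈ s, (g x : 𝕊) = 0) :
    ∃ n : ℤ, ∀ x ∈ s, g x = n := by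
  have hsub : g '' s ⊆ range ((↑) : ℤ → ℝ) := by
    rintro _ ⟨x, hx, rfl⟩
    obtain ⟨n, hn⟩ := AddCircle.coe_eq_zero_iff (1 : ℝ) |>.1 (h x hx)
    exact ⟨n, by simpa using hn⟩
  have hss := (countable_range ((↑) : ℤ → ℝ)).isTotallyDisconnected _ hsub (hs.image g hg)
  rcases s.eq_empty_or_nonempty with rfl | ⟨x, hx⟩
  · exact ⟨0, by simp⟩
  · obtain ⟨n, hn⟩ := hsub ⟨x, hx, rfl⟩
    exact ⟨n, fun y hy => (hss ⟨y, hy, rfl⟩ ⟨x, hx, rfl⟩).trans hn.symm⟩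

theorem exists_real_lift {X : Type*} [TopologicalSpace X] [SimplyConnectedSpace X]
    [LocallyPathConnectedSpace X] {g : X → 𝕊} (hg : Continuous g) :
    ∃ G : X → ℝ, Continuous G ∧ ∀ x, (G x : 𝕊) = g x := by
  obtain ⟨x₀⟩ : Nonempty X := inferInstance
  obtain ⟨e, he⟩ := isOpenQuotientMap_coe_circle.surjective (g x₀)
  obtain ⟨G, ⟨-, hG⟩, -⟩ := (AddCircle.isCoveringMap_coe (1 : ℝ)).existsUnique_continuousMap_lifts
    ⟨g, hg⟩ x₀ e he
  exact ⟨G, G.continuous, fun x => congrFun hG x⟩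

theorem exists_continuous_descent {X Y Z : Type*} [TopologicalSpace X] [TopologicalSpace Y]
    [TopologicalSpace Z] {π : X → Y} (hπ : IsOpenQuotientMap π) {g : X → Z} (hg : Continuous g)
    (h : ∀ a b, π a = π b → g a = g b) : ∃ g' : Y → Z, Continuous g' ∧ ∀ x, g' (π x) = g x := by
  refine ⟨fun y => g (surjInv hπ.surjective y), ?_, fun x => h _ _ (surjInv_eq _ _)⟩
  rw [hπ.isQuotientMap.continuous_iff]
  convert! hg using 1
  exact funext fun x => h _ _ (surjInv_eq _ _)

theorem apply_add_intCast {g : ℝ → ℝ} {d : ℝ} (h : ∀ x, g (x + 1) = g x + d) (n : ℤ) (x : ℝ) :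
    g (x + n) = g x + n * d := by
  induction n using Int.induction_on with
  | zero => simp
  | succ n ih =>
    push_cast at ih ⊢
    rw [← add_assoc, h, ih]; ring
  | pred n ih =>
    push_cast at ih ⊢
    have := h (x + (-(n : ℝ) - 1))
    rw [show x + (-(n : ℝ) - 1) + 1 = x + -n by ring, ih] at this
    linarith

theorem exists_height (h : 𝕋2 → 𝕊) (hh : IsHorizontalMap h) :
    ∃ u : 𝔸 → ℝ, Continuous u ∧ (∀ z, (u z : 𝕊) = h (θ z)) ∧
      ∃ k : ℤ, ∀ z : 𝔸, u (z.1, z.2 + 1) = u z + k := by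
  obtain ⟨hc, hsurj, hcont⟩ := hh
  have hgc : Continuous fun z : 𝔸 => h (θ z) := hc.comp isOpenQuotientMap_θ.continuous
  have hτc := isOpenQuotientMap_τ.continuous
  obtain ⟨H, hH, hHl⟩ := exists_real_lift (X := ℝ × ℝ) (hgc.comp hτc)
  simp only [comp_apply] at hHl
  have hshift : ∀ p : ℝ × ℝ, τ (p.1 + 1, p.2) = τ p := fun p =>
    τ_eq_τ_iff.2 ⟨1, by ext <;> simp⟩
  obtain ⟨d, hd⟩ := exists_int_of_coe_eq_zero (g := fun p : ℝ × ℝ => H (p.1 + 1, p.2) - H p)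
    isPreconnected_univ (by fun_prop) (fun p _ => by
      rw [AddCircle.coe_sub, hHl, hHl, hshift, sub_self])
  -- the degree along the circle direction vanishes
  have hd0 : d = 0 := by
    obtain ⟨p₀, hp₀⟩ := hsurj 0
    obtain ⟨z₀, rfl⟩ := isOpenQuotientMap_θ.surjective p₀
    have hopen : ∀ S : Set 𝔸, IsClosed S → ∀ z, IsOpen (connectedComponentIn Sᶜ z) :=
      fun S hS z => hS.isOpen_compl.connectedComponentIn
    set S := θ ⁻¹' (h ⁻¹' {0}) with hS
    set E := connectedComponentIn S z₀ with hE
    obtain ⟨hEc, -, U, V, ⟨zu, hzu, rfl⟩, ⟨zv, hzv, rfl⟩, hUV, hU, hV, -⟩ :=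
      (hcont 0).2.2 z₀ hp₀
    obtain ⟨M, hM⟩ := (hEc.image continuous_snd).isBounded.subset_closedBall (0 : ℝ)
    have hM' : ∀ z ∈ E, |z.2| ≤ M := fun z hz => by
      have := hM ⟨z, hz, rfl⟩
      rwa [mem_closedBall_zero_iff, Real.norm_eq_abs] at this
    have hup : (univ ×ˢ Ioi M : Set 𝔸) ⊆ connectedComponentIn Eᶜ zu := by
      obtain ⟨w, hw, hwM⟩ : ∃ w ∈ connectedComponentIn Eᶜ zu, M < w.2 := by
        by_contra! hcon
        exact hU ⟨M, by rintro _ ⟨w, hw, rfl⟩; exact hcon w hw⟩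
      rw [connectedComponentIn_eq hw]
      refine (isPreconnected_univ.prod isPreconnected_Ioi).subset_connectedComponentIn
        ⟨mem_univ _, hwM⟩ fun z hz hzE => ?_
      have h1 := (le_abs_self _).trans (hM' z hzE)
      exact absurd hz.2 (not_lt.2 h1)
    have hdown : (univ ×ˢ Iio (-M) : Set 𝔸) ⊆ connectedComponentIn Eᶜ zv := by
      obtain ⟨w, hw, hwM⟩ : ∃ w ∈ connectedComponentIn Eᶜ zv, w.2 < -M := by
        by_contra! hcon
        exact hV ⟨-M, by rintro _ ⟨w, hw, rfl⟩; exact hcon w hw⟩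
      rw [connectedComponentIn_eq hw]
      refine (isPreconnected_univ.prod isPreconnected_Iio).subset_connectedComponentIn
        ⟨mem_univ _, hwM⟩ fun z hz hzE => ?_
      have h1 := (neg_le_abs _).trans (hM' z hzE)
      have h2 : z.2 < -M := hz.2
      linarith
    have hdisj : ∀ z ∈ connectedComponentIn Eᶜ zu, z ∉ connectedComponentIn Eᶜ zv :=
      fun z h1 h2 => hUV ((connectedComponentIn_eq h1).trans (connectedComponentIn_eq h2).symm)
    classical
    set V := connectedComponentIn Eᶜ zv with hVdef
    have hVo : IsOpen V := hopen E hEc.isClosed zv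
    have hfr : ∀ z ∈ frontier V, h (θ z) = 0 := by
      intro z hz
      suffices hzE : z ∈ E from connectedComponentIn_subset S z₀ hzE
      by_contra hzE
      rw [hVo.frontier_eq] at hz
      have h1 := (hopen E hEc.isClosed z).mem_nhds (mem_connectedComponentIn (F := Eᶜ) hzE)
      obtain ⟨w, hw1, hw2⟩ := mem_closure_iff_nhds.1 hz.1 _ h1
      apply hz.2
      rw [hVdef, connectedComponentIn_eq hw2, ← connectedComponentIn_eq hw1]
      exact mem_connectedComponentIn hzE
    have hqc : Continuous fun z : 𝔸 => if z ∈ V then h (θ z) else 0 :=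
      Continuous.if (fun z hz => hfr z hz) hgc continuous_const
    obtain ⟨Q, hQ, hQl⟩ := exists_real_lift (X := ℝ × ℝ) (hqc.comp hτc)
    simp only [comp_apply] at hQl
    obtain ⟨d', hd'⟩ := exists_int_of_coe_eq_zero (g := fun p : ℝ × ℝ => Q (p.1 + 1, p.2) - Q p)
      isPreconnected_univ (by fun_prop) (fun p _ => by
        rw [AddCircle.coe_sub, hQl, hQl, hshift, sub_self])
    obtain ⟨a, ha⟩ := exists_int_of_coe_eq_zero (g := Q) (s := univ ×ˢ Ioi M)
      (isPreconnected_univ.prod isPreconnected_Ioi) (by fun_prop) (fun p hp => by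
        rw [hQl, if_neg]
        exact hdisj _ (hup ⟨mem_univ _, hp.2⟩))
    obtain ⟨b, hb⟩ := exists_int_of_coe_eq_zero (g := fun p => Q p - H p) (s := univ ×ˢ Iio (-M))
      (isPreconnected_univ.prod isPreconnected_Iio) (by fun_prop) (fun p hp => by
        rw [AddCircle.coe_sub, hQl, if_pos, hHl, sub_self]
        exact hdown ⟨mem_univ _, hp.2⟩)
    have e1 := ha (0, M + 1) ⟨mem_univ _, by simp⟩
    have e2 := ha (0 + 1, M + 1) ⟨mem_univ _, by simp⟩
    have e3 := hd' (0, M + 1) (mem_univ _)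
    have e4 := hb (0, -M - 1) ⟨mem_univ _, by simp⟩
    have e5 := hb (0 + 1, -M - 1) ⟨mem_univ _, by simp⟩
    have e6 := hd (0, -M - 1) (mem_univ _)
    have e7 := hd' (0, -M - 1) (mem_univ _)
    simp only at e1 e2 e3 e4 e5 e6 e7
    have : (d : ℝ) = 0 := by linarith
    exact_mod_cast this
  subst hd0
  have hper : ∀ (n : ℤ) (x y : ℝ), H (x + n, y) = H (x, y) := fun n x y => by
    have := apply_add_intCast (g := fun x => H (x, y)) (d := 0) (fun x => by
      have := hd (x, y) (mem_univ _)
      simp only [Int.cast_zero] at this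
      linarith) n x
    simpa using this
  obtain ⟨u, hu, huH⟩ := exists_continuous_descent isOpenQuotientMap_τ hH (fun p q hpq => by
    obtain ⟨n, rfl⟩ := τ_eq_τ_iff.1 hpq
    rw [← hper n q.1 q.2]
    congr 1
    ext <;> simp)
  have hul : ∀ z, (u z : 𝕊) = h (θ z) := fun z => by
    obtain ⟨p, rfl⟩ := isOpenQuotientMap_τ.surjective z
    rw [huH, hHl]
  refine ⟨u, hu, hul, ?_⟩
  obtain ⟨k, hk⟩ := exists_int_of_coe_eq_zero (g := fun z : 𝔸 => u (z.1, z.2 + 1) - u z)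
    isPreconnected_univ (by fun_prop) (fun z _ => by
      rw [AddCircle.coe_sub, hul, hul, sub_eq_zero]
      congr 1
      exact θ_eq_θ_iff.2 ⟨1, by simp⟩)
  exact ⟨k, fun z => by linarith [hk z (mem_univ _)]⟩

end Lifting

/-! ### The height function of a horizontal map -/

section HeightFunction

variable {u : 𝔸 → ℝ}

theorem height_add_intCast {k : ℝ} (hu1 : ∀ z : 𝔸, u (z.1, z.2 + 1) = u z + k) (n : ℤ) (z : 𝔸) :
    u (z.1, z.2 + n) = u z + n * k :=
  apply_add_intCast (g := fun y => u (z.1, y)) (fun y => hu1 (z.1, y)) n z.2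

theorem exists_height_bound (hu : Continuous u) (hu1 : ∀ z : 𝔸, u (z.1, z.2 + 1) = u z + 1) :
    (∃ C, ∀ z, |u z - z.2| ≤ C) ∧ UniformContinuous u := by
  obtain ⟨v, hv, hvu⟩ := exists_continuous_descent isOpenQuotientMap_θ
    (g := fun z : 𝔸 => u z - z.2) (by fun_prop) (fun a b hab => by
      obtain ⟨n, rfl⟩ := θ_eq_θ_iff.1 hab
      have := height_add_intCast hu1 n b
      simp only [mul_one] at this
      rw [this]; ring)
  constructor
  · obtain ⟨C, hC⟩ := (isCompact_range hv).isBounded.subset_closedBall (0 : ℝ)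
    refine ⟨C, fun z => ?_⟩
    have := hC (mem_range_self (θ z))
    rwa [hvu, mem_closedBall_zero_iff, Real.norm_eq_abs] at this
  · have h1 : UniformContinuous v := CompactSpace.uniformContinuous_of_continuous hv
    have h2 : UniformContinuous θ := by
      refine uniformContinuous_fst.prodMk ?_
      have h3 : UniformContinuous ((↑) : ℝ → 𝕊) := by
        refine Metric.uniformContinuous_iff.2 fun ε hε => ⟨ε, hε, fun {a b} hab => ?_⟩
        rw [dist_eq_norm, ← AddCircle.coe_sub]
        exact QuotientAddGroup.norm_mk_le_norm.trans_lt (by rwa [← dist_eq_norm])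
      exact h3.comp uniformContinuous_snd
    have h3 : u = fun z => v (θ z) + z.2 := funext fun z => by rw [hvu]; ring
    rw [h3]
    exact (h1.comp h2).add uniformContinuous_snd

theorem eq_of_ne_of_eq_or_eq {X : Type*} {a b c U V : X} (ha : a = U ∨ a = V) (hb : b = U ∨ b = V)
    (hc : c = U ∨ c = V) (hac : a ≠ c) (hbc : b ≠ c) : a = b := by
  grind

theorem isPreconnected_height {h : 𝕋2 → 𝕊} (hh : IsHorizontalMap h) (hu : Continuous u)
    (huh : ∀ z, (u z : 𝕊) = h (θ z)) (hu1 : ∀ z : 𝔸, u (z.1, z.2 + 1) = u z + 1) (t : ℝ) :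
    IsPreconnected {z | u z < t} ∧ IsPreconnected {z | t ≤ u z} := by
  obtain ⟨⟨C, hC⟩, -⟩ := exists_height_bound hu hu1
  have hC' : ∀ z : 𝔸, u z - C ≤ z.2 ∧ z.2 ≤ u z + C := fun z => by
    have := abs_le.1 (hC z)
    constructor <;> linarith [this.1, this.2]
  have hθinj : ∀ z w, u z = t → u w = t → θ z = θ w → z = w := by
    intro z w hz hw hzw
    obtain ⟨n, rfl⟩ := θ_eq_θ_iff.1 hzw
    rw [height_add_intCast hu1] at hz
    have : (n : ℝ) = 0 := by linarith
    simp [this]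
  have hθE : h ⁻¹' {(t : 𝕊)} ⊆ θ '' {z | u z = t} := by
    intro p hp
    obtain ⟨z, rfl⟩ := isOpenQuotientMap_θ.surjective p
    have h1 : (u z : 𝕊) = t := (huh z).trans hp
    obtain ⟨n, hn⟩ := coe_eq_coe_iff.1 h1
    refine ⟨(z.1, z.2 + (-n : ℤ)), ?_, θ_eq_θ_iff.2 ⟨-n, rfl⟩⟩
    rw [mem_ofPred_eq, height_add_intCast hu1, hn]
    push_cast; ring
  have hcl : IsClosed {z | u z = t} := isClosed_eq hu continuous_const
  have hcomp : IsCompact {z | u z = t} := by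
    refine ((isCompact_univ (X := 𝕊)).prod
      (isCompact_Icc (a := t - C) (b := t + C))).of_isClosed_subset hcl ?_
    intro z hz
    have := hC' z
    rw [mem_ofPred_eq] at hz
    exact ⟨mem_univ _, by constructor <;> linarith [this.1, this.2]⟩
  have hne : ∃ z, u z = t := by
    obtain ⟨p, hp⟩ := hh.2.1 t
    obtain ⟨z, hz, -⟩ := hθE hp
    exact ⟨z, hz⟩
  have hE : IsPreconnected {z | u z = t} := by
    rw [isPreconnected_closed_iff]
    rintro P Q hP hQ hPQ ⟨z, hz⟩ ⟨w, hw⟩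
    have hpre := isPreconnected_closed_iff.1 (hh.2.2 t).2.1.isPreconnected
      (θ '' ({z | u z = t} ∩ P)) (θ '' ({z | u z = t} ∩ Q))
      ((hcomp.inter_right hP).image isOpenQuotientMap_θ.continuous).isClosed
      ((hcomp.inter_right hQ).image isOpenQuotientMap_θ.continuous).isClosed
      (fun p hp => by
        obtain ⟨z, hz, rfl⟩ := hθE hp
        exact (hPQ hz).imp (fun h => ⟨z, ⟨hz, h⟩, rfl⟩) (fun h => ⟨z, ⟨hz, h⟩, rfl⟩))
      ⟨θ z, by
        have h1 : u z = t := hz.1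
        rw [mem_preimage, ← huh, h1]; rfl, z, hz, rfl⟩
      ⟨θ w, by
        have h1 : u w = t := hw.1
        rw [mem_preimage, ← huh, h1]; rfl, w, hw, rfl⟩
    obtain ⟨_, -, ⟨a, ha, rfl⟩, ⟨b, hb, hab⟩⟩ := hpre
    obtain rfl := hθinj b a hb.1 ha.1 hab
    exact ⟨b, hb.1, ha.2, hb.2⟩
  obtain ⟨z₀, hz₀⟩ := hne
  have hz₀S : z₀ ∈ θ ⁻¹' (h ⁻¹' {(t : 𝕊)}) := by
    rw [mem_preimage, mem_preimage, ← huh, hz₀]; rfl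
  have hEeq : connectedComponentIn (θ ⁻¹' (h ⁻¹' {(t : 𝕊)})) z₀ = {z | u z = t} := by
    refine Subset.antisymm ?_ (hE.subset_connectedComponentIn hz₀ fun z hz => by
      rw [mem_ofPred_eq] at hz
      rw [mem_preimage, mem_preimage, ← huh, hz]; rfl)
    obtain ⟨n, hn⟩ := exists_int_of_coe_eq_zero (g := fun z => u z - t)
      (isPreconnected_connectedComponentIn (F := θ ⁻¹' (h ⁻¹' {(t : 𝕊)})) (x := z₀))
      (by fun_prop) (fun z hz => by
        rw [AddCircle.coe_sub, huh, sub_eq_zero]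
        exact connectedComponentIn_subset (θ ⁻¹' (h ⁻¹' {(t : 𝕊)})) z₀ hz)
    intro z hz
    have h1 := hn z hz
    have h2 := hn z₀ (mem_connectedComponentIn hz₀S)
    rw [mem_ofPred_eq]
    linarith
  obtain ⟨-, -, U, V, -, -, -, -, -, hUV⟩ := hEeq ▸ (hh.2.2 t).2.2 z₀ hz₀S
  have hlo : IsOpen {z | u z < t} := isOpen_lt hu continuous_const
  have hho : IsOpen {z | t < u z} := isOpen_lt continuous_const hu
  have hdisj : Disjoint {z | u z < t} {z | t < u z} := by
    rw [disjoint_left]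
    intro z hz hz'
    rw [mem_ofPred_eq] at hz hz'
    exact lt_asymm hz hz'
  have hcover : {z | u z = t}ᶜ ⊆ {z | u z < t} ∪ {z | t < u z} := fun z hz =>
    lt_or_gt_of_ne hz
  have hlow : ∀ z, u z < t → connectedComponentIn {z | u z = t}ᶜ z ⊆ {z | u z < t} := fun z hz =>
    isPreconnected_connectedComponentIn.subset_left_of_subset_union hlo hho hdisj
      ((connectedComponentIn_subset _ _).trans hcover) ⟨z, mem_connectedComponentIn hz.ne, hz⟩
  have hhigh : ∀ z, t < u z → connectedComponentIn {z | u z = t}ᶜ z ⊆ {z | t < u z} := fun z hz =>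
    isPreconnected_connectedComponentIn.subset_right_of_subset_union hlo hho hdisj
      ((connectedComponentIn_subset _ _).trans hcover) ⟨z, mem_connectedComponentIn hz.ne', hz⟩
  have hlh : ∀ z w, u z < t → t < u w →
      connectedComponentIn {z | u z = t}ᶜ z ≠ connectedComponentIn {z | u z = t}ᶜ w := by
    intro z w hz hw heq
    have h1 := hlow z hz (heq ▸ mem_connectedComponentIn (F := {z | u z = t}ᶜ) hw.ne')
    exact lt_asymm hw h1
  have hcomps : ∀ z, u z ≠ t → connectedComponentIn {z | u z = t}ᶜ z = U ∨
      connectedComponentIn {z | u z = t}ᶜ z = V := fun z hz => hUV _ ⟨z, hz, rfl⟩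
  have hlne : ∃ z, u z < t := by
    refine ⟨(z₀.1, z₀.2 + (-1 : ℤ)), ?_⟩
    rw [height_add_intCast hu1, hz₀]; simp
  have hhne : ∃ z, t < u z := ⟨(z₀.1, z₀.2 + 1), by rw [hu1, hz₀]; simp⟩
  obtain ⟨zl, hzl⟩ := hlne
  obtain ⟨zh, hzh⟩ := hhne
  have hlcon : IsPreconnected {z | u z < t} := by
    have : {z | u z < t} = connectedComponentIn {z | u z = t}ᶜ zl := by
      refine Subset.antisymm (fun z hz => ?_) (hlow zl hzl)
      have h1 := hlh z zh hz hzh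
      have h2 := hlh zl zh hzl hzh
      have h3 : connectedComponentIn {z | u z = t}ᶜ z = connectedComponentIn {z | u z = t}ᶜ zl := by
        have hz' : u z < t := hz
        exact eq_of_ne_of_eq_or_eq (hcomps z hz'.ne) (hcomps zl hzl.ne) (hcomps zh hzh.ne') h1 h2
      rw [← h3]
      have hz' : u z < t := hz
      exact mem_connectedComponentIn hz'.ne
    rw [this]
    exact isPreconnected_connectedComponentIn
  have hhcon : IsPreconnected {z | t < u z} := by
    have : {z | t < u z} = connectedComponentIn {z | u z = t}ᶜ zh := by
      refine Subset.antisymm (fun z hz => ?_) (hhigh zh hzh)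
      have h1 := hlh zl z hzl hz
      have h2 := hlh zl zh hzl hzh
      have hz' : t < u z := hz
      have h3 : connectedComponentIn {z | u z = t}ᶜ z = connectedComponentIn {z | u z = t}ᶜ zh := by
        exact eq_of_ne_of_eq_or_eq (hcomps z hz'.ne') (hcomps zh hzh.ne') (hcomps zl hzl.ne)
          h1.symm h2.symm
      rw [← h3]
      exact mem_connectedComponentIn hz'.ne'
    rw [this]
    exact isPreconnected_connectedComponentIn
  refine ⟨hlcon, ?_⟩
  have hclos : closure {z | t < u z} ⊆ {z | t ≤ u z} :=
    closure_minimal (fun z (hz : t < u z) => show t ≤ u z from hz.le)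
      (isClosed_le continuous_const hu)
  have hmeet : ∃ z ∈ closure {z | t < u z}, u z = t := by
    by_contra! hcon
    have hclopen : IsClopen {z | t < u z} := by
      refine ⟨isClosed_of_closure_subset fun z hz => ?_, hho⟩
      exact lt_of_le_of_ne (hclos hz) (hcon z hz).symm
    rcases isClopen_iff.1 hclopen with h1 | h1
    · have : zh ∈ ({z | t < u z} : Set 𝔸) := hzh
      rw [h1] at this
      exact this
    · have : zl ∈ ({z | t < u z} : Set 𝔸) := h1 ▸ mem_univ _
      exact lt_asymm hzl this
  obtain ⟨z₁, hz₁, hz₁t⟩ := hmeet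
  have : {z | t ≤ u z} = closure {z | t < u z} ∪ {z | u z = t} := by
    refine Subset.antisymm (fun z hz => ?_) (union_subset hclos fun z hz => ge_of_eq hz)
    have hz' : t ≤ u z := hz
    rcases hz'.lt_or_eq with h1 | h1
    · exact Or.inl (subset_closure h1)
    · exact Or.inr h1.symm
  rw [this]
  exact IsPreconnected.union z₁ hz₁ hz₁t hhcon.closure hE

theorem natAbs_eq_one_of_height {h : 𝕋2 → 𝕊} (hh : IsHorizontalMap h) (hu : Continuous u)
    (huh : ∀ z, (u z : 𝕊) = h (θ z)) {k : ℤ} (hk0 : k ≠ 0)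
    (huk : ∀ z : 𝔸, u (z.1, z.2 + 1) = u z + k) : k = 1 ∨ k = -1 := by
  have hk : (k : ℝ) ≠ 0 := by exact_mod_cast hk0
  obtain ⟨v, hv, hvu⟩ := exists_continuous_descent isOpenQuotientMap_θ
    (g := fun z : 𝔸 => Real.cos (u z / k * (2 * Real.pi))) (by fun_prop) (fun a b hab => by
      obtain ⟨n, rfl⟩ := θ_eq_θ_iff.1 hab
      rw [height_add_intCast huk, add_div, mul_div_cancel_right₀ _ hk, add_mul]
      exact Real.cos_add_int_mul_two_pi _ n)
  have hpre := (hh.2.2 0).2.1.isPreconnected.image v hv.continuousOn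
  have hcount : (v '' (h ⁻¹' {0})).Countable := by
    refine (countable_range fun j : ℤ => Real.cos ((j : ℝ) / k * (2 * Real.pi))).mono ?_
    rintro _ ⟨p, hp, rfl⟩
    obtain ⟨z, rfl⟩ := isOpenQuotientMap_θ.surjective p
    have h1 : (u z : 𝕊) = 0 := (huh z).trans hp
    obtain ⟨n, hn⟩ := (AddCircle.coe_eq_zero_iff (1 : ℝ)).1 h1
    refine ⟨n, ?_⟩
    rw [hvu, ← hn]; simp
  have hss := hcount.isTotallyDisconnected _ Subset.rfl hpre
  have hsurj : ∀ j : ℤ, ∃ z, u z = j := by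
    intro j
    let z : 𝔸 := (0, 0)
    obtain ⟨n, hn⟩ : ∃ n : ℤ, u z + n * k ≤ j := by
      refine ⟨-(⌈|u z - j|⌉ * k.sign), ?_⟩
      have h1 := Int.le_ceil |u z - j|
      have h2 : (k.sign * k : ℤ) = |k| := Int.sign_mul_self_eq_abs k
      have h2' : ((k.sign : ℝ) * k) = |(k : ℝ)| := by exact_mod_cast h2
      have h3 : (1 : ℝ) ≤ |(k : ℝ)| := by exact_mod_cast Int.one_le_abs hk0
      push_cast
      have h4 : -((⌈|u z - j|⌉ : ℝ) * k.sign) * k = -(⌈|u z - j|⌉ * |(k : ℝ)|) := by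
        rw [← h2']; ring
      rw [h4]
      have h5 := abs_nonneg (u z - j)
      have h6 := le_abs_self (u z - j)
      nlinarith
    obtain ⟨m, hm⟩ : ∃ m : ℤ, (j : ℝ) ≤ u z + m * k := by
      refine ⟨⌈|u z - j|⌉ * k.sign, ?_⟩
      have h1 := Int.le_ceil |u z - j|
      have h2 : (k.sign * k : ℤ) = |k| := Int.sign_mul_self_eq_abs k
      have h2' : ((k.sign : ℝ) * k) = |(k : ℝ)| := by exact_mod_cast h2
      have h3 : (1 : ℝ) ≤ |(k : ℝ)| := by exact_mod_cast Int.one_le_abs hk0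
      push_cast
      have h4 : ((⌈|u z - j|⌉ : ℝ) * k.sign) * k = ⌈|u z - j|⌉ * |(k : ℝ)| := by
        rw [← h2']; ring
      rw [h4]
      have h5 := abs_nonneg (u z - j)
      have h6 := neg_abs_le (u z - j)
      nlinarith
    rw [← height_add_intCast huk] at hn hm
    exact mem_range_of_exists_le_of_exists_ge hu ⟨_, hn⟩ ⟨_, hm⟩
  obtain ⟨a, ha⟩ := hsurj 0
  obtain ⟨b, hb⟩ := hsurj 1
  have ha' : v (θ a) ∈ v '' (h ⁻¹' {0}) := ⟨θ a, by
    rw [mem_preimage, ← huh, ha]; simp, rfl⟩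
  have hb' : v (θ b) ∈ v '' (h ⁻¹' {0}) := ⟨θ b, by
    rw [mem_preimage, ← huh, hb, mem_singleton_iff, AddCircle.coe_eq_zero_iff]
    exact ⟨1, by simp⟩, rfl⟩
  have := hss hb' ha'
  rw [hvu, hvu, ha, hb, Int.cast_zero, zero_div, zero_mul, Real.cos_zero,
    Real.cos_eq_one_iff] at this
  obtain ⟨n, hn⟩ := this
  have h1 := mul_right_cancel₀ Real.two_pi_pos.ne' hn
  have h2 : (n * k : ℤ) = 1 := by
    have : (n : ℝ) * k = 1 := by rw [h1]; push_cast; field_simp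
    exact_mod_cast this
  exact Int.eq_one_or_neg_one_of_mul_eq_one (mul_comm n k ▸ h2)

theorem exists_normalized_height {h : 𝕋2 → 𝕊} (hh : IsHorizontalMap h) {f : 𝕋2 → 𝕋2} {α₀ : ℝ}
    (hα₀ : Irrational α₀) (hsemi : ∀ z, h (f z) = h z + (α₀ : 𝕊)) {fh : 𝔸 → 𝔸}
    (hfh : Continuous fh) (hliftθ : ∀ z, θ (fh z) = f (θ z)) :
    ∃ (u : 𝔸 → ℝ) (β : ℝ), Continuous u ∧ Irrational β ∧
      (∀ z : 𝔸, u (z.1, z.2 + 1) = u z + 1) ∧ (∀ z, u (fh z) = u z + β) ∧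
      ∀ t, IsPreconnected {z | u z < t} ∧ IsPreconnected {z | t ≤ u z} := by
  obtain ⟨u, hu, huh, k, hk⟩ := exists_height h hh
  obtain ⟨m, hm⟩ := exists_int_of_coe_eq_zero (g := fun z => u (fh z) - u z - α₀)
    isPreconnected_univ (by fun_prop) (fun z _ => by
      rw [AddCircle.coe_sub, AddCircle.coe_sub, huh, huh, hliftθ, hsemi]
      abel)
  have hstep : ∀ z, u (fh z) = u z + (α₀ + m) := fun z => by linarith [hm z (mem_univ _)]
  have hβ : Irrational (α₀ + m) := hα₀.add_intCast m
  have hk0 : k ≠ 0 := by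
    rintro rfl
    obtain ⟨v, hv, hvu⟩ := exists_continuous_descent isOpenQuotientMap_θ hu (fun a b hab => by
      obtain ⟨n, rfl⟩ := θ_eq_θ_iff.1 hab
      rw [height_add_intCast hk]; simp)
    obtain ⟨C, hC⟩ := (isCompact_range hv).isBounded.subset_closedBall (0 : ℝ)
    have hC' : ∀ z, |u z| ≤ C := fun z => by
      have := hC (mem_range_self (θ z))
      rwa [hvu, mem_closedBall_zero_iff, Real.norm_eq_abs] at this
    have hiter : ∀ n : ℕ, u (fh^[n] 0) = u 0 + n * (α₀ + m) := fun n => by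
      induction n with
      | zero => simp
      | succ n ih => rw [iterate_succ_apply', hstep, ih]; push_cast; ring
    obtain ⟨n, hn⟩ := exists_nat_gt (2 * C / |α₀ + m|)
    rw [div_lt_iff₀ (abs_pos.2 hβ.ne_zero)] at hn
    have h1 : |(n : ℝ) * (α₀ + m)| ≤ 2 * C := by
      have : (n : ℝ) * (α₀ + m) = u (fh^[n] 0) - u 0 := by rw [hiter]; ring
      rw [this]
      exact (abs_sub _ _).trans (by linarith [hC' (fh^[n] 0), hC' 0])
    rw [abs_mul, Nat.abs_cast] at h1
    linarith
  rcases natAbs_eq_one_of_height hh hu huh hk0 hk with rfl | rfl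
  · simp only [Int.cast_one] at hk
    exact ⟨u, _, hu, hβ, hk, hstep, isPreconnected_height hh hu huh hk⟩
  · have hk' : ∀ z : 𝔸, -u (z.1, z.2 + 1) = -u z + 1 := fun z => by rw [hk]; push_cast; ring
    have hh' : IsHorizontalMap fun p => -h p := by
      refine ⟨hh.1.neg, neg_surjective.comp hh.2.1, fun t => ?_⟩
      have : (fun p => -h p) ⁻¹' {t} = h ⁻¹' {-t} := by
        ext p
        simp only [mem_preimage, mem_singleton_iff, neg_eq_iff_eq_neg]
      rw [this]
      exact hh.2.2 _
    refine ⟨fun z => -u z, -(α₀ + m), hu.neg, hβ.neg, hk', fun z => by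
        beta_reduce
        rw [hstep]; ring,
      isPreconnected_height hh' hu.neg (fun z => by rw [AddCircle.coe_neg, huh]) hk'⟩

end HeightFunction

/-! ### Points realising extremal rotation numbers -/

section Rotation

theorem add_birkhoffSum_iterate {X : Type*} (T : X → X) (φ : X → ℝ) (k j : ℕ) (z : X) :
    birkhoffSum T φ (k + j) z = birkhoffSum T φ k z + birkhoffSum T φ j (T^[k] z) :=
  birkhoffSum_add T φ k j z

theorem continuous_birkhoffSum {X : Type*} [TopologicalSpace X] {T : X → X} {φ : X → ℝ}
    (hT : Continuous T) (hφ : Continuous φ) (n : ℕ) : Continuous (birkhoffSum T φ n) :=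
  continuous_finsetSum _ fun i _ => hφ.comp (hT.iterate i)

theorem abs_birkhoffSum_le {X : Type*} {T : X → X} {φ : X → ℝ} {M : ℝ} (hM : ∀ z, |φ z| ≤ M)
    (n : ℕ) (z : X) : |birkhoffSum T φ n z| ≤ n * M := by
  refine (Finset.abs_sum_le_sum_abs _ _).trans ?_
  simpa using Finset.sum_le_sum fun i (_ : i ∈ Finset.range n) => hM (T^[i] z)

/-- Good starting points: along a long orbit segment with large average, some point has all its
initial averages large. -/
theorem exists_forall_le_birkhoffSum {X : Type*} {T : X → X} {φ : X → ℝ} {M c c' : ℝ}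
    (hM : ∀ z, |φ z| ≤ M) (hcc : c < c') (h : ∀ N, ∃ n ≥ N, ∃ p, n * c' ≤ birkhoffSum T φ n p)
    (N : ℕ) : ∃ z, ∀ j ≤ N, j * c ≤ birkhoffSum T φ j z := by
  obtain ⟨L, hL⟩ := exists_nat_gt (N * (M + |c|) / (c' - c))
  rw [div_lt_iff₀ (sub_pos.2 hcc)] at hL
  obtain ⟨n, hn, p, hp⟩ := h (max L (N + 1))
  have hnL : (L : ℝ) ≤ n := by exact_mod_cast (le_max_left _ _).trans hn
  have hnN : N + 1 ≤ n := (le_max_right _ _).trans hn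
  obtain ⟨k, hk, hmin⟩ := (Finset.range (n + 1)).exists_min_image
    (fun k => birkhoffSum T φ k p - k * c) ⟨0, by simp⟩
  have hkn : k ≤ n := Nat.lt_succ_iff.1 (Finset.mem_range.1 hk)
  have hkN : k + N ≤ n := by
    by_contra hcon
    have h1 := hmin 0 (by simp)
    simp only [birkhoffSum_zero, Nat.cast_zero, zero_mul, sub_zero] at h1
    have h2 : birkhoffSum T φ n p = birkhoffSum T φ k p + birkhoffSum T φ (n - k) (T^[k] p) := by
      rw [← add_birkhoffSum_iterate, Nat.add_sub_cancel' hkn]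
    have h3 := (le_abs_self _).trans (abs_birkhoffSum_le (T := T) hM (n - k) (T^[k] p))
    have h4 : ((n - k : ℕ) : ℝ) = n - k := Nat.cast_sub hkn
    rw [h4] at h3
    have h5 : (n : ℝ) - k ≤ N := by
      have : n ≤ k + N := by omega
      have : (n : ℝ) ≤ k + N := by exact_mod_cast this
      linarith
    have h6 : 0 ≤ M := (abs_nonneg _).trans (hM p)
    have h7 : (0 : ℝ) ≤ n - k := by
      have : (k : ℝ) ≤ n := by exact_mod_cast hkn
      linarith
    have h8 : (n - k) * (M + |c|) ≤ N * (M + |c|) := by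
      have := abs_nonneg c
      gcongr
    have h9 : -((n - k) * |c|) ≤ (n - k) * c := by
      have := neg_abs_le c
      nlinarith
    have h10 : (L : ℝ) * (c' - c) ≤ n * (c' - c) := by
      have := sub_pos.2 hcc
      gcongr
    linarith
  refine ⟨T^[k] p, fun j hj => ?_⟩
  have h1 := hmin (k + j) (by rw [Finset.mem_range]; omega)
  rw [add_birkhoffSum_iterate] at h1
  push_cast at h1
  linarith

theorem exists_forall_mul_le_birkhoffSum {X : Type*} [TopologicalSpace X] [CompactSpace X]
    {T : X → X} {φ : X → ℝ} (hT : Continuous T) (hφ : Continuous φ) {ρ : ℝ}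
    (h : ∀ c < ρ, ∀ N, ∃ n ≥ N, ∃ p, n * c ≤ birkhoffSum T φ n p) :
    ∃ z, ∀ n : ℕ, n * ρ ≤ birkhoffSum T φ n z := by
  obtain ⟨M, hM⟩ := (isCompact_range hφ).isBounded.subset_closedBall (0 : ℝ)
  have hM' : ∀ z, |φ z| ≤ M := fun z => by
    have := hM (mem_range_self z)
    rwa [mem_closedBall_zero_iff, Real.norm_eq_abs] at this
  let Z : ℕ → Set X := fun N =>
    {z | ∀ j ≤ N, j * (ρ - 1 / ((N : ℝ) + 1)) ≤ birkhoffSum T φ j z}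
  have hcl : ∀ N, IsClosed (Z N) := fun N => by
    simp only [Z, ofPred_forall]
    exact isClosed_iInter fun j => isClosed_iInter fun _ =>
      isClosed_le continuous_const (continuous_birkhoffSum hT hφ j)
  obtain ⟨z, hz⟩ := IsCompact.nonempty_iInter_of_sequence_nonempty_isCompact_isClosed Z
    (fun N z hz j hj => by
      refine le_trans ?_ (hz j (hj.trans N.le_succ))
      gcongr
      exact_mod_cast N.le_succ)
    (fun N => by
      have h1 : (0 : ℝ) < 1 / ((N : ℝ) + 1) := Nat.one_div_pos_of_nat
      have h2 : ρ - 1 / ((N : ℝ) + 1) < ρ - 1 / ((N : ℝ) + 1) / 2 := by linarith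
      exact exists_forall_le_birkhoffSum hM' h2 (h _ (by linarith)) N)
    (hcl 0).isCompact hcl
  refine ⟨z, fun n => ?_⟩
  rw [mem_iInter] at hz
  have hlim : Tendsto (fun N : ℕ => n * (ρ - 1 / ((N : ℝ) + 1))) atTop (𝓝 (n * (ρ - 0))) :=
    (tendsto_const_nhds.sub tendsto_one_div_add_atTop_nhds_zero_nat).const_mul _
  rw [sub_zero] at hlim
  exact le_of_tendsto hlim ((eventually_ge_atTop n).mono fun N hN => hz N n hN)

theorem exists_tendsto_birkhoffAverage {X : Type*} [TopologicalSpace X] [CompactSpace X]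
    {T : X → X} {φ : X → ℝ} (hT : Continuous T) (hφ : Continuous φ) {ρ : ℝ}
    (h : ∀ c < ρ, ∀ N, ∃ n ≥ N, ∃ p, n * c ≤ birkhoffSum T φ n p)
    (h' : ∀ c > ρ, ∃ N, ∀ n ≥ N, ∀ p, birkhoffSum T φ n p ≤ n * c) :
    ∃ z, Tendsto (fun n : ℕ => birkhoffSum T φ n z / n) atTop (𝓝 ρ) := by
  obtain ⟨z, hz⟩ := exists_forall_mul_le_birkhoffSum hT hφ h
  refine ⟨z, tendsto_order.2 ⟨fun a ha => ?_, fun b hb => ?_⟩⟩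
  · filter_upwards [eventually_gt_atTop 0] with n hn
    have hn' : (0 : ℝ) < n := by exact_mod_cast hn
    refine ha.trans_le ((le_div_iff₀ hn').2 ?_)
    rw [mul_comm]; exact hz n
  · obtain ⟨N, hN⟩ := h' ((ρ + b) / 2) (by change ρ < _; linarith)
    filter_upwards [eventually_gt_atTop 0, eventually_ge_atTop N] with n hn hnN
    have hn' : (0 : ℝ) < n := by exact_mod_cast hn
    have h1 : birkhoffSum T φ n z / n ≤ (ρ + b) / 2 := by
      rw [div_le_iff₀ hn', mul_comm]
      exact hN n hnN z
    have h2 : ρ < b := hb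
    linarith

/-- A lift to the plane of a torus map homotopic to the identity commutes with the vertical
deck transformation. -/
theorem map_add_vertical {f : 𝕋2 → 𝕋2} (hf : Continuous f)
    (hhtpy : ContinuousMap.Homotopic ⟨f, hf⟩ (ContinuousMap.id 𝕋2))
    {fh : 𝔸 → 𝔸} (hliftθ : ∀ z, θ (fh z) = f (θ z))
    (hfhT2 : ∀ z : 𝔸, fh (z.1, z.2 + 1) = ((fh z).1, (fh z).2 + 1))
    {F : ℝ × ℝ → ℝ × ℝ} (hF : Continuous F) (hliftτ : ∀ p, τ (F p) = fh (τ p)) (p : ℝ × ℝ) :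
    F (p + (0, 1)) = F p + (0, 1) := by
  have hτs : ∀ p, τ (p + (0, 1)) = ((τ p).1, (τ p).2 + 1) := fun p => by simp [τ]
  have hθs : ∀ z : 𝔸, θ (z.1, z.2 + 1) = θ z := fun z => θ_eq_θ_iff.2 ⟨1, by simp⟩
  obtain ⟨K⟩ := hhtpy
  have hcont : Continuous fun q : (ℝ × ℝ) × ℝ =>
      (K (projIcc 0 1 zero_le_one q.2, θ (τ q.1))).1 :=
    continuous_fst.comp (K.continuous.comp ((continuous_projIcc.comp continuous_snd).prodMk
      (isOpenQuotientMap_θ.continuous.comp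
        (isOpenQuotientMap_τ.continuous.comp continuous_fst))))
  obtain ⟨G, hG, hGl⟩ := exists_real_lift hcont
  obtain ⟨d, hd⟩ := exists_int_of_coe_eq_zero
    (g := fun q : (ℝ × ℝ) × ℝ => G (q.1 + (0, 1), q.2) - G q) isPreconnected_univ (by fun_prop)
    (fun q _ => by
      rw [AddCircle.coe_sub, hGl, hGl, hτs, hθs, sub_self])
  obtain ⟨a, ha⟩ := exists_int_of_coe_eq_zero
    (g := fun p : ℝ × ℝ => G (p, 1) - p.1) isPreconnected_univ (by fun_prop)
    (fun q _ => by
      rw [AddCircle.coe_sub, hGl]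
      have : projIcc (0 : ℝ) 1 zero_le_one 1 = 1 :=
        projIcc_right _
      simp only [this, ContinuousMap.Homotopy.apply_one]
      simp [θ, τ])
  obtain ⟨b, hb⟩ := exists_int_of_coe_eq_zero
    (g := fun p : ℝ × ℝ => G (p, 0) - (F p).1) isPreconnected_univ (by fun_prop)
    (fun q _ => by
      rw [AddCircle.coe_sub, hGl]
      have : projIcc (0 : ℝ) 1 zero_le_one 0 = 0 :=
        projIcc_left _
      simp only [this, ContinuousMap.Homotopy.apply_zero, ContinuousMap.coe_mk]
      rw [← hliftθ, ← hliftτ]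
      simp [θ, τ])
  have e1 := hd (p, 0) (mem_univ _)
  have e2 := hd (p, 1) (mem_univ _)
  have e3 := ha p (mem_univ _)
  have e4 := ha (p + (0, 1)) (mem_univ _)
  have e5 := hb p (mem_univ _)
  have e6 := hb (p + (0, 1)) (mem_univ _)
  simp only [Prod.fst_add, add_zero] at e1 e2 e3 e4 e5 e6
  have h2 : (F (p + (0, 1))).2 = (F p).2 + 1 := by
    have h3 : τ (F (p + (0, 1))) = ((τ (F p)).1, (τ (F p)).2 + 1) := by
      rw [hliftτ, hliftτ, hτs, hfhT2]
    exact congrArg Prod.snd h3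
  refine Prod.ext ?_ ?_
  · simp only [Prod.fst_add, add_zero]; linarith
  · simp only [Prod.snd_add]; exact h2

theorem exists_rotation_points {f : 𝕋2 → 𝕋2} (hf : Continuous f) {fh : 𝔸 → 𝔸}
    (hliftθ : ∀ z, θ (fh z) = f (θ z)) {F : ℝ × ℝ → ℝ × ℝ} (hF : Continuous F)
    (hliftτ : ∀ p, τ (F p) = fh (τ p)) (hFT1 : ∀ p : ℝ × ℝ, F (p + (1, 0)) = F p + (1, 0))
    (hFT2 : ∀ p : ℝ × ℝ, F (p + (0, 1)) = F p + (0, 1)) {ρm ρp α : ℝ}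
    (hrot : rotSet F = Set.Icc ρm ρp ×ˢ ({α} : Set ℝ)) :
    ∃ φ : 𝕋2 → ℝ, (∀ n p, (F^[n] p - p).1 = birkhoffSum f φ n (θ (τ p))) ∧
      (∃ z, Tendsto (fun n : ℕ => birkhoffSum f φ n z / n) atTop (𝓝 ρm)) ∧
      ∃ z, Tendsto (fun n : ℕ => birkhoffSum f φ n z / n) atTop (𝓝 ρp) := by
  have hθτ : IsOpenQuotientMap fun p => θ (τ p) := isOpenQuotientMap_θ.comp isOpenQuotientMap_τ
  have hFn : ∀ (n m : ℤ) p, F (p + ((n : ℝ), (m : ℝ))) - (p + ((n : ℝ), (m : ℝ))) = F p - p := by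
    intro n m p
    have h1 := apply_add_intCast (g := fun t => (F (p + (t, (m : ℝ)))).1) (d := 1)
      (fun t => by
        rw [show p + (t + 1, (m : ℝ)) = p + (t, (m : ℝ)) + (1, 0) by ext <;> simp [add_assoc], hFT1]
        simp) n 0
    have h2 := apply_add_intCast (g := fun t => (F (p + (t, (m : ℝ)))).2) (d := 0)
      (fun t => by
        rw [show p + (t + 1, (m : ℝ)) = p + (t, (m : ℝ)) + (1, 0) by ext <;> simp [add_assoc], hFT1]
        simp) n 0
    have h3 := apply_add_intCast (g := fun t => (F (p + (0, t))).1) (d := 0)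
      (fun t => by
        rw [show p + ((0 : ℝ), t + 1) = p + (0, t) + (0, 1) by ext <;> simp [add_assoc], hFT2]
        simp) m 0
    have h4 := apply_add_intCast (g := fun t => (F (p + (0, t))).2) (d := 1)
      (fun t => by
        rw [show p + ((0 : ℝ), t + 1) = p + (0, t) + (0, 1) by ext <;> simp [add_assoc], hFT2]
        simp) m 0
    rw [show p + ((0 : ℝ), (0 : ℝ)) = p by ext <;> simp] at h3 h4
    simp only [zero_add] at h1 h2 h3 h4
    ext
    · simp only [Prod.fst_sub, Prod.fst_add]; linarith
    · simp only [Prod.snd_sub, Prod.snd_add]; linarith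
  obtain ⟨D, hD, hDF⟩ := exists_continuous_descent hθτ (g := fun p => F p - p) (by fun_prop)
    (fun a b hab => by
      obtain ⟨m, hm⟩ := θ_eq_θ_iff.1 hab
      have h1 : τ a = τ (b + (0, (m : ℝ))) := by rw [hm]; simp [τ]
      obtain ⟨n, rfl⟩ := τ_eq_τ_iff.1 h1
      have h2 : b + (0, (m : ℝ)) + ((n : ℝ), 0) = b + ((n : ℝ), (m : ℝ)) := by ext <;> simp
      rw [h2]
      exact hFn n m b)
  have hsum : ∀ n p, F^[n] p - p = ∑ i ∈ Finset.range n, D (f^[i] (θ (τ p))) := by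
    intro n p
    induction n with
    | zero => simp
    | succ n ih =>
      have hit : ∀ n : ℕ, θ (τ (F^[n] p)) = f^[n] (θ (τ p)) := fun n => by
        induction n with
        | zero => rfl
        | succ n ih => rw [iterate_succ_apply', iterate_succ_apply', hliftτ, hliftθ, ih]
      rw [Finset.sum_range_succ, ← ih, ← hit, hDF, iterate_succ_apply']
      abel
  have hsum1 : ∀ n p, (F^[n] p - p).1 = birkhoffSum f (fun z => (D z).1) n (θ (τ p)) := by
    intro n p
    rw [hsum, Prod.fst_sum]
    rfl
  obtain ⟨M, hM⟩ := (isCompact_range hD).isBounded.subset_closedBall 0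
  have hbd : ∀ (n : ℕ) p, (n : ℝ)⁻¹ • (F^[n] p - p) ∈ closedBall (0 : ℝ × ℝ) M := by
    intro n p
    rw [mem_closedBall_zero_iff, norm_smul, hsum, norm_inv, Real.norm_natCast]
    have h1 : ∀ z, ‖D z‖ ≤ M := fun z => mem_closedBall_zero_iff.1 (hM (mem_range_self z))
    have h2 : ‖∑ i ∈ Finset.range n, D (f^[i] (θ (τ p)))‖ ≤ n * M := by
      refine (norm_sum_le _ _).trans ?_
      simpa using Finset.sum_le_sum fun i (_ : i ∈ Finset.range n) => h1 (f^[i] (θ (τ p)))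
    have hM0 : 0 ≤ M := (norm_nonneg _).trans (h1 (θ (τ p)))
    rcases Nat.eq_zero_or_pos n with rfl | hn
    · simpa using hM0
    · have hn' : (0 : ℝ) < n := by exact_mod_cast hn
      rw [inv_mul_le_iff₀ hn']
      exact h2
  have hacc : ∀ (n : ℕ → ℕ) (x : ℕ → ℝ × ℝ), Tendsto n atTop atTop →
      ∃ v ∈ rotSet F, ∃ ψ : ℕ → ℕ, StrictMono ψ ∧ Tendsto (fun i =>
        ((n (ψ i) : ℝ))⁻¹ • (F^[n (ψ i)] (x (ψ i)) - x (ψ i))) atTop (𝓝 v) := by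
    intro n x hn
    obtain ⟨v, -, ψ, hψ, hv⟩ := (isCompact_closedBall (0 : ℝ × ℝ) M).tendsto_subseq
      (fun i => hbd (n i) (x i))
    exact ⟨v, ⟨n ∘ ψ, x ∘ ψ, hn.comp hψ.tendsto_atTop, hv⟩, ψ, hψ, hv⟩
  have hle : ρm ≤ ρp := by
    obtain ⟨v, hv, -⟩ := hacc id (fun _ => 0) tendsto_id
    rw [hrot] at hv
    exact hv.1.1.trans hv.1.2
  have happrox : ∀ ρ ∈ Icc ρm ρp, ∃ (n : ℕ → ℕ) (z : ℕ → 𝕋2), Tendsto n atTop atTop ∧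
      Tendsto (fun i => birkhoffSum f (fun z => (D z).1) (n i) (z i) / n i) atTop (𝓝 ρ) := by
    intro ρ hρ
    have h1 : (ρ, α) ∈ rotSet F := by rw [hrot]; exact ⟨hρ, rfl⟩
    obtain ⟨n, x, hn, hx⟩ := h1
    refine ⟨n, fun i => θ (τ (x i)), hn, ?_⟩
    have := (continuous_fst.tendsto _).comp hx
    refine this.congr fun i => ?_
    simp only [comp_apply, Prod.smul_fst, hsum1, smul_eq_mul]
    rw [inv_mul_eq_div]
  have hupper : ∀ c > ρp, ∃ N, ∀ n ≥ N, ∀ z, birkhoffSum f (fun z => (D z).1) n z ≤ n * c := by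
    intro c hc
    by_contra! hcon
    choose n hn z hz using hcon
    choose x hx using fun i => hθτ.surjective (z i)
    obtain ⟨v, hv, ψ, hψ, hlim⟩ := hacc n x (tendsto_atTop_mono hn tendsto_id)
    rw [hrot] at hv
    have h1 := (continuous_fst.tendsto _).comp hlim
    have h2 : c ≤ v.1 := by
      refine ge_of_tendsto h1 ((eventually_gt_atTop 0).mono fun i hi => ?_)
      simp only [comp_apply, Prod.smul_fst, hsum1, smul_eq_mul, hx]
      have hpos : (0 : ℝ) < n (ψ i) := by
        have := hi.trans_le ((hψ.id_le i).trans (hn (ψ i)))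
        exact_mod_cast this
      rw [inv_mul_eq_div, le_div_iff₀ hpos, mul_comm]
      exact (hz _).le
    have h3 := hv.1.2
    linarith
  have hlower : ∀ c < ρm, ∃ N, ∀ n ≥ N, ∀ z, n * c ≤ birkhoffSum f (fun z => (D z).1) n z := by
    intro c hc
    by_contra! hcon
    choose n hn z hz using hcon
    choose x hx using fun i => hθτ.surjective (z i)
    obtain ⟨v, hv, ψ, hψ, hlim⟩ := hacc n x (tendsto_atTop_mono hn tendsto_id)
    rw [hrot] at hv
    have h1 := (continuous_fst.tendsto _).comp hlim
    have h2 : v.1 ≤ c := by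
      refine le_of_tendsto h1 ((eventually_gt_atTop 0).mono fun i hi => ?_)
      simp only [comp_apply, Prod.smul_fst, hsum1, smul_eq_mul, hx]
      have hpos : (0 : ℝ) < n (ψ i) := by
        have := hi.trans_le ((hψ.id_le i).trans (hn (ψ i)))
        exact_mod_cast this
      rw [inv_mul_eq_div, div_le_iff₀ hpos, mul_comm]
      exact (hz _).le
    have h3 := hv.1.1
    linarith
  have hφ : Continuous fun z => (D z).1 := continuous_fst.comp hD
  have hneg : ∀ n z, birkhoffSum f (-fun z => (D z).1) n z =
      -birkhoffSum f (fun z => (D z).1) n z := fun n z => by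
    simp only [birkhoffSum, Pi.neg_apply, Finset.sum_neg_distrib]
  refine ⟨fun z => (D z).1, hsum1, ?_, ?_⟩
  · obtain ⟨z, hz⟩ := exists_tendsto_birkhoffAverage (ρ := -ρm) hf hφ.neg
      (fun c hc N => by
        obtain ⟨n, z, hn, hlim⟩ := happrox ρm ⟨le_rfl, hle⟩
        obtain ⟨i, h1, h2, h3⟩ := ((hlim.eventually (gt_mem_nhds (lt_neg.1 hc))).and
          ((hn.eventually_ge_atTop N).and (hn.eventually_gt_atTop 0))).exists
        refine ⟨n i, h2, z i, ?_⟩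
        have hpos : (0 : ℝ) < n i := by exact_mod_cast h3
        rw [div_lt_iff₀ hpos] at h1
        rw [hneg]; linarith)
      (fun c hc => by
        obtain ⟨N, hN⟩ := hlower (-c) (neg_lt.1 hc)
        refine ⟨N, fun n hn z => ?_⟩
        have := hN n hn z
        rw [hneg]; linarith)
    refine ⟨z, ?_⟩
    have := hz.neg
    rw [neg_neg] at this
    refine this.congr fun n => ?_
    rw [hneg, neg_div, neg_neg]
  · exact exists_tendsto_birkhoffAverage hf hφ
      (fun c hc N => by
        obtain ⟨n, z, hn, hlim⟩ := happrox ρp ⟨hle, le_rfl⟩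
        obtain ⟨i, h1, h2, h3⟩ := ((hlim.eventually (lt_mem_nhds hc)).and
          ((hn.eventually_ge_atTop N).and (hn.eventually_gt_atTop 0))).exists
        refine ⟨n i, h2, z i, ?_⟩
        have hpos : (0 : ℝ) < n i := by exact_mod_cast h3
        rw [lt_div_iff₀ hpos] at h1
        linarith)
      hupper

end Rotation

open MeasureTheory in
/-- Weyl equidistribution for an irrational rotation of the circle. -/
theorem tendsto_average_rotation {β : ℝ} (hβ : Irrational β) (t : 𝕊) (g : C(𝕊, ℂ)) :
    Tendsto (fun n : ℕ => (n : ℂ)⁻¹ * ∑ k ∈ Finset.range n, g (t + k • (β : 𝕊))) atTop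
      (𝓝 (∫ x, g x ∂AddCircle.haarAddCircle)) := by
  have hint : ∀ g : C(𝕊, ℂ), Integrable g AddCircle.haarAddCircle := fun g =>
    g.continuous.integrable_of_hasCompactSupport (HasCompactSupport.of_compactSpace g)
  have hmono : ∀ m : ℤ, Tendsto
      (fun n : ℕ => (n : ℂ)⁻¹ * ∑ k ∈ Finset.range n, fourier m (t + k • (β : 𝕊))) atTop
      (𝓝 (∫ x : 𝕊, fourier m x ∂AddCircle.haarAddCircle)) := by
    intro m
    have hcoef : (∫ x : 𝕊, fourier m x ∂AddCircle.haarAddCircle) = if m = 0 then 1 else 0 := by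
      have := congrFun (fourierCoeff_fourier (T := 1) m) 0
      simp only [fourierCoeff, neg_zero, fourier_zero, one_smul, Pi.single_apply] at this
      rw [this]
      simp [eq_comm]
    rw [hcoef]
    by_cases hm : m = 0
    · subst hm
      simp only [fourier_zero, Finset.sum_const, Finset.card_range, if_true, nsmul_eq_mul, mul_one]
      refine tendsto_const_nhds.congr' ?_
      filter_upwards [eventually_gt_atTop 0] with n hn
      rw [inv_mul_cancel₀ (by exact_mod_cast hn.ne')]
    · rw [if_neg hm]
      set w : ℂ := fourier m (β : 𝕊) with hw
      have hw1 : w ≠ 1 := by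
        intro h1
        rw [hw, fourier_apply] at h1
        have h2 : AddCircle.toCircle (m • (β : 𝕊)) = AddCircle.toCircle (0 : 𝕊) := by
          rw [AddCircle.toCircle_zero]
          exact Circle.ext h1
        have h3 := AddCircle.injective_toCircle one_ne_zero h2
        rw [← AddCircle.coe_zsmul, ← AddCircle.coe_zero, coe_eq_coe_iff] at h3
        obtain ⟨n, hn⟩ := h3
        rw [zsmul_eq_mul, zero_add] at hn
        exact (hβ.intCast_mul hm).ne_int n hn
      have hterm : ∀ k : ℕ, fourier m (t + k • (β : 𝕊)) = fourier m t * w ^ k := by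
        intro k
        rw [hw, fourier_apply, fourier_apply, fourier_apply, smul_add, AddCircle.toCircle_add,
          smul_comm, AddCircle.toCircle_nsmul]
        simp
      have hwn : ‖w‖ = 1 := by
        rw [hw, fourier_apply]; exact Circle.norm_coe _
      have hbd : ∀ n : ℕ, ‖∑ k ∈ Finset.range n, fourier m (t + k • (β : 𝕊))‖ ≤ 2 / ‖w - 1‖ := by
        intro n
        simp only [hterm]
        rw [← Finset.mul_sum, geom_sum_eq hw1, norm_mul, norm_div]
        have h1 : ‖fourier m t‖ = 1 := by rw [fourier_apply]; exact Circle.norm_coe _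
        rw [h1, one_mul]
        gcongr
        calc ‖w ^ n - 1‖ ≤ ‖w ^ n‖ + ‖(1:ℂ)‖ := norm_sub_le _ _
          _ = 2 := by rw [norm_pow, hwn]; norm_num
      have hlim : Tendsto (fun n : ℕ => ((n : ℝ)⁻¹) * (2 / ‖w - 1‖)) atTop (𝓝 0) := by
        simpa using (tendsto_inv_atTop_nhds_zero_nat (𝕜 := ℝ)).mul_const (2 / ‖w - 1‖)
      refine squeeze_zero_norm (fun n => ?_) hlim
      rw [norm_mul, norm_inv, Complex.norm_natCast]
      gcongr
      exact hbd n
  have hspan : ∀ p ∈ Submodule.span ℂ (range (@fourier 1)), Tendsto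
      (fun n : ℕ => (n : ℂ)⁻¹ * ∑ k ∈ Finset.range n, p (t + k • (β : 𝕊))) atTop
      (𝓝 (∫ x, p x ∂AddCircle.haarAddCircle)) := by
    intro p hp
    induction hp using Submodule.span_induction with
    | mem p hp => obtain ⟨m, rfl⟩ := hp; exact hmono m
    | zero => simp
    | add p q _ _ hp hq =>
      simp only [ContinuousMap.add_apply, Finset.sum_add_distrib, mul_add]
      rw [integral_add (hint p) (hint q)]
      exact hp.add hq
    | smul c p _ hp =>
      simp only [ContinuousMap.smul_apply, smul_eq_mul, ← Finset.mul_sum]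
      rw [integral_const_mul]
      refine (hp.const_mul c).congr fun n => by ring
  have hg : g ∈ closure (Submodule.span ℂ (range (@fourier 1)) : Set C(𝕊, ℂ)) := by
    rw [← Submodule.topologicalClosure_coe, span_fourier_closure_eq_top]
    trivial
  rw [Metric.tendsto_atTop]
  intro ε hε
  obtain ⟨p, hp, hpg⟩ := Metric.mem_closure_iff.1 hg (ε / 3) (by positivity)
  obtain ⟨N, hN⟩ := Metric.tendsto_atTop.1 (hspan p hp) (ε / 3) (by positivity)
  refine ⟨N, fun n hn => ?_⟩
  have hpt : ∀ x, ‖g x - p x‖ ≤ ε / 3 := fun x => by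
    rw [← dist_eq_norm]
    exact (ContinuousMap.dist_apply_le_dist x).trans hpg.le
  have h1 : dist ((n : ℂ)⁻¹ * ∑ k ∈ Finset.range n, g (t + k • (β : 𝕊)))
      ((n : ℂ)⁻¹ * ∑ k ∈ Finset.range n, p (t + k • (β : 𝕊))) ≤ ε / 3 := by
    rw [dist_eq_norm, ← mul_sub, ← Finset.sum_sub_distrib, norm_mul, norm_inv,
      Complex.norm_natCast]
    have h2 := norm_sum_le_of_le (Finset.range n) fun k _ => hpt (t + k • (β : 𝕊))
    rw [Finset.sum_const, Finset.card_range, nsmul_eq_mul] at h2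
    rcases Nat.eq_zero_or_pos n with rfl | hn0
    · simp; positivity
    · have : (0:ℝ) < n := by exact_mod_cast hn0
      rw [inv_mul_le_iff₀ this]
      exact h2
  have h3 : dist (∫ x, p x ∂AddCircle.haarAddCircle) (∫ x, g x ∂AddCircle.haarAddCircle)
      ≤ ε / 3 := by
    rw [dist_comm, dist_eq_norm, ← integral_sub (hint g) (hint p)]
    simpa using norm_integral_le_of_norm_le_const (μ := AddCircle.haarAddCircle)
      (Eventually.of_forall hpt)
  have h4 := hN n hn
  have h5 := dist_triangle4 ((n : ℂ)⁻¹ * ∑ k ∈ Finset.range n, g (t + k • (β : 𝕊)))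
      ((n : ℂ)⁻¹ * ∑ k ∈ Finset.range n, p (t + k • (β : 𝕊)))
      (∫ x, p x ∂AddCircle.haarAddCircle) (∫ x, g x ∂AddCircle.haarAddCircle)
  linarith

open MeasureTheory in
/-- An irrational rotation visits a closed set of measure less than `δ` with upper frequency at
most `δ`. -/
theorem eventually_card_visits_le {β : ℝ} (hβ : Irrational β) (t : ℝ) {K : Set 𝕊}
    (hK : IsClosed K) {δ : ℝ} (hδ : 0 < δ)
    (hKδ : AddCircle.haarAddCircle K < ENNReal.ofReal δ) :
    ∀ᶠ n : ℕ in atTop, (({k : ℕ | ((t + k * β : ℝ) : 𝕊) ∈ K} ∩ Set.Icc 1 n).ncard : ℝ)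
      ≤ δ * n := by
  classical
  obtain ⟨U, hKU, hU, hUδ⟩ := K.exists_isOpen_lt_of_lt _ hKδ
  obtain ⟨g, hg1, hg2, -, hg⟩ := exists_continuous_one_zero_of_isCompact hK.isCompact
    hU.isClosed_compl (disjoint_compl_right_iff_subset.2 hKU)
  have hg0 : ∀ x, 0 ≤ g x := fun x => (hg x).1
  let gc : C(𝕊, ℂ) := ⟨fun x => (g x : ℂ), Complex.continuous_ofReal.comp g.continuous⟩
  have hW := tendsto_average_rotation hβ (((t + β : ℝ)) : 𝕊) gc
  have hgint : ∫ x, g x ∂AddCircle.haarAddCircle < δ := by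
    have h1 : ∫ x, g x ∂AddCircle.haarAddCircle ≤
        ∫ x, U.indicator (fun _ => (1:ℝ)) x ∂AddCircle.haarAddCircle := by
      refine integral_mono
        (g.continuous.integrable_of_hasCompactSupport (HasCompactSupport.of_compactSpace g))
        ((integrable_const _).indicator hU.measurableSet) fun x => ?_
      by_cases hx : x ∈ U
      · simpa [hx] using (hg x).2
      · simpa [hx] using (hg2 hx).le
    rw [integral_indicator_const _ hU.measurableSet, smul_eq_mul, mul_one] at h1
    refine h1.trans_lt ?_
    exact (ENNReal.toReal_lt_toReal hUδ.ne_top ENNReal.ofReal_ne_top).2 hUδ |>.trans_eq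
      (ENNReal.toReal_ofReal hδ.le)
  have hI : (∫ x, gc x ∂AddCircle.haarAddCircle) = ((∫ x, g x ∂AddCircle.haarAddCircle : ℝ) : ℂ) :=
    integral_ofReal
  rw [hI] at hW
  have hR := (Complex.continuous_re.tendsto _).comp hW
  rw [Complex.ofReal_re] at hR
  filter_upwards [hR.eventually_lt_const hgint, eventually_gt_atTop 0] with n hn hn0
  have hn' : (0:ℝ) < n := by exact_mod_cast hn0
  have hre : (n:ℝ)⁻¹ * ∑ k ∈ Finset.range n, g (((t + β : ℝ) : 𝕊) + k • (β : 𝕊)) < δ := by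
    have : (((n:ℂ)⁻¹ * ∑ k ∈ Finset.range n, gc (((t + β : ℝ) : 𝕊) + k • (β : 𝕊)))) =
        (((n:ℝ)⁻¹ * ∑ k ∈ Finset.range n, g (((t + β : ℝ) : 𝕊) + k • (β : 𝕊)) : ℝ) : ℂ) := by
      push_cast
      rfl
    simp only [comp_apply] at hn
    rwa [this, Complex.ofReal_re] at hn
  rw [inv_mul_lt_iff₀ hn', mul_comm] at hre
  refine le_trans ?_ hre.le
  have hset : ({k : ℕ | ((t + k * β : ℝ) : 𝕊) ∈ K} ∩ Set.Icc 1 n) =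
      (((Finset.range n).filter fun k : ℕ => ((t + (k + 1 : ℕ) * β : ℝ) : 𝕊) ∈ K).image (· + 1) :
        Finset ℕ) := by
    ext k
    simp only [mem_inter_iff, mem_ofPred_eq, mem_Icc, Finset.coe_image, Finset.coe_filter,
      Finset.mem_range, mem_image]
    constructor
    · rintro ⟨h1, h2, h3⟩
      exact ⟨k - 1, ⟨by omega, by rwa [Nat.sub_add_cancel h2]⟩, by omega⟩
    · rintro ⟨j, ⟨h1, h2⟩, rfl⟩
      exact ⟨h2, by omega, by omega⟩
  rw [hset, ncard_coe_finset, Finset.card_image_of_injective _ (add_left_injective 1),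
    Finset.card_filter]
  push_cast
  refine Finset.sum_le_sum fun k _ => ?_
  have hk : (((t + β : ℝ) : 𝕊) + k • (β : 𝕊)) = ((t + (k + 1) * β : ℝ) : 𝕊) := by
    rw [← AddCircle.coe_nsmul, ← AddCircle.coe_add, nsmul_eq_mul]
    congr 1
    ring
  split_ifs with h
  · rw [hk]
    exact (hg1 h).ge
  · exact hg0 _

/-- The values at the points that are maxima on a ball of fixed radius form a countable set. -/
theorem countable_image_isMaxOn_ball {X : Type*} [PseudoMetricSpace X] [SecondCountableTopology X]
    (u : X → ℝ) {ε : ℝ} (hε : 0 < ε) : (u '' {z | ∀ w ∈ ball z ε, u w ≤ u z}).Countable := by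
  refine ((TopologicalSpace.countable_countableBasis X).image fun U => sSup (u '' U)).mono ?_
  rintro _ ⟨z, hz, rfl⟩
  obtain ⟨U, hU, hzU, hUz⟩ := (TopologicalSpace.isBasis_countableBasis X).exists_subset_of_mem_open
    (mem_ball_self hε) isOpen_ball
  refine ⟨U, hU, IsGreatest.csSup_eq ⟨mem_image_of_mem _ hzU, ?_⟩⟩
  rintro _ ⟨w, hw, rfl⟩
  exact hz w (hUz hw)

/-- Away from a closed set of values of small measure, an equivariant height function increases by a
definite amount in every ball of radius `ε`. -/
theorem exists_gap {u : 𝔸 → ℝ} (hu : Continuous u) (hu1 : ∀ z : 𝔸, u (z.1, z.2 + 1) = u z + 1)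
    {ε : ℝ} (hε : 0 < ε) {δ : ℝ} (hδ : 0 < δ) :
    ∃ η > 0, η ≤ 1 ∧ ∃ K : Set 𝕊, IsClosed K ∧
      AddCircle.haarAddCircle K < ENNReal.ofReal δ ∧
      ∀ z, ((u z : ℝ) : 𝕊) ∉ K → ∃ w ∈ ball z ε, u z + η < u w := by
  have hu1' : ∀ (n : ℤ) (z : 𝔸), u (z.1, z.2 + n) = u z + n := fun n z => by
    simpa using height_add_intCast (k := 1) hu1 n z
  let bad : ℝ → Set 𝔸 := fun η => {z | ∀ w ∈ ball z ε, u w ≤ u z + η}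
  have hbad_closed : ∀ η, IsClosed (bad η) := by
    intro η
    have : bad η = ⋂ w, {z | ε ≤ dist w z} ∪ {z | u w ≤ u z + η} := by
      ext z
      simp only [bad, mem_ofPred_eq, mem_ball, mem_iInter, mem_union]
      refine forall_congr' fun w => ?_
      rw [imp_iff_not_or, not_lt]
    rw [this]
    exact isClosed_iInter fun w => (isClosed_le continuous_const (by fun_prop)).union
      (isClosed_le continuous_const (by fun_prop))
  have hbad_mono : ∀ {a b}, a ≤ b → bad a ⊆ bad b := fun hab z hz w hw =>
    (hz w hw).trans (by linarith)
  let η : ℕ → ℝ := fun n => 1 / ((n : ℝ) + 1)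
  have hη0 : ∀ n, 0 < η n := fun n => Nat.one_div_pos_of_nat
  have hηanti : Antitone η := fun a b hab => Nat.one_div_le_one_div hab
  have hstrip : IsCompact ((univ : Set 𝕊) ×ˢ Icc (0:ℝ) 1) := isCompact_univ.prod isCompact_Icc
  let S : ℕ → Set 𝔸 := fun n => bad (η n) ∩ (univ : Set 𝕊) ×ˢ Icc (0:ℝ) 1
  have hS : ∀ n, IsCompact (S n) := fun n => hstrip.inter_left (hbad_closed _)
  have hSanti : Antitone S := fun a b hab => inter_subset_inter_left _ (hbad_mono (hηanti hab))
  let q : 𝔸 → 𝕊 := fun z => ((u z : ℝ) : 𝕊)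
  have hq : Continuous q := (AddCircle.continuous_mk' 1).comp hu
  have hKclosed : ∀ n, IsClosed (q '' S n) := fun n => ((hS n).image hq).isClosed
  have hinter : ⋂ n, q '' S n ⊆
      (fun t : ℝ => (t : 𝕊)) '' (u '' {z | ∀ w ∈ ball z ε, u w ≤ u z}) := by
    intro t ht
    rw [mem_iInter] at ht
    have hcl : IsClosed (q ⁻¹' {t}) := isClosed_singleton.preimage hq
    obtain ⟨z, hz⟩ := IsCompact.nonempty_iInter_of_sequence_nonempty_isCompact_isClosed
      (fun n => S n ∩ q ⁻¹' {t})
      (fun n => inter_subset_inter_left _ (hSanti n.le_succ))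
      (fun n => by
        obtain ⟨z, hz, hzt⟩ := ht n
        exact ⟨z, hz, hzt⟩)
      ((hS 0).inter_right hcl) (fun n => (hS n).isClosed.inter hcl)
    rw [mem_iInter] at hz
    refine ⟨u z, ⟨z, fun w hw => ?_, rfl⟩, (hz 0).2⟩
    have hlim : Tendsto (fun n => u z + η n) atTop (𝓝 (u z + 0)) :=
      tendsto_const_nhds.add tendsto_one_div_add_atTop_nhds_zero_nat
    rw [add_zero] at hlim
    exact ge_of_tendsto' hlim fun n => (hz n).1.1 w hw
  have hnull : AddCircle.haarAddCircle (⋂ n, q '' S n) = 0 := by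
    have : Nontrivial 𝕊 := ⟨((1 / 2 : ℝ) : 𝕊), ((0 : ℝ) : 𝕊), fun h => by
      obtain ⟨n, hn⟩ := coe_eq_coe_iff.1 h
      have h1 : (1 : ℝ) = ((2 * n : ℤ) : ℝ) := by push_cast; linarith
      have h2 : (1 : ℤ) = 2 * n := by exact_mod_cast h1
      omega⟩
    exact (((countable_image_isMaxOn_ball u hε).image _).mono hinter).measure_zero _
  have hlim := MeasureTheory.tendsto_measure_iInter_atTop
    (μ := (@AddCircle.haarAddCircle 1 _))
    (fun n => (hKclosed n).measurableSet.nullMeasurableSet)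
    (fun a b hab => image_mono (hSanti hab)) ⟨0, MeasureTheory.measure_ne_top _ _⟩
  rw [hnull] at hlim
  obtain ⟨n, hn⟩ := (hlim.eventually_lt_const (ENNReal.ofReal_pos.2 hδ)).exists
  refine ⟨η n, hη0 n, ?_, q '' S n, hKclosed n, hn, fun z hz => ?_⟩
  · simpa [η] using hηanti (Nat.zero_le n)
  by_contra! hcon
  refine hz ⟨(z.1, z.2 + (-⌊z.2⌋ : ℤ)), ⟨fun w hw => ?_, trivial, ?_⟩, ?_⟩
  · have h1 := hcon (w.1, w.2 + (⌊z.2⌋ : ℤ)) (by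
      rw [mem_ball, Prod.dist_eq] at hw ⊢
      refine lt_of_eq_of_lt ?_ hw
      congr 1
      rw [Real.dist_eq, Real.dist_eq]
      congr 1
      push_cast
      ring)
    rw [hu1'] at h1 ⊢
    push_cast
    linarith
  · push_cast
    exact ⟨by linarith [Int.floor_le z.2], by linarith [Int.lt_floor_add_one z.2]⟩
  · show ((u _ : ℝ) : 𝕊) = _
    rw [hu1', coe_eq_coe_iff]
    exact ⟨_, rfl⟩

/-- The times at which two orbits of an irrational rotation both avoid a closed set of measure less
than `δ / 2` have lower density at least `1 - δ`. -/
theorem le_lowerDensity_avoiding {β : ℝ} (hβ : Irrational β) (a b : ℝ) {K : Set 𝕊}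
    (hK : IsClosed K) {δ : ℝ} (hδ : 0 < δ)
    (hKδ : AddCircle.haarAddCircle K < ENNReal.ofReal (δ / 2)) :
    1 - δ ≤ lowerDensity
      {n : ℕ | ((a + n * β : ℝ) : 𝕊) ∉ K ∧ ((b + n * β : ℝ) : 𝕊) ∉ K} := by
  have ha := eventually_card_visits_le hβ a hK (half_pos hδ) hKδ
  have hb := eventually_card_visits_le hβ b hK (half_pos hδ) hKδ
  set Pa := {k : ℕ | ((a + k * β : ℝ) : 𝕊) ∈ K}
  set Pb := {k : ℕ | ((b + k * β : ℝ) : 𝕊) ∈ K}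
  set G := {n : ℕ | ((a + n * β : ℝ) : 𝕊) ∉ K ∧ ((b + n * β : ℝ) : 𝕊) ∉ K}
  have hfin : ∀ (P : Set ℕ) n, (P ∩ Icc 1 n).Finite := fun P n =>
    (finite_Icc 1 n).subset inter_subset_right
  have hcard : ∀ n : ℕ, (Icc 1 n).ncard = n := fun n => by
    rw [← Finset.coe_Icc, ncard_coe_finset, Nat.card_Icc]
    rfl
  refine le_liminf_of_le ⟨1, fun c hc => ?_⟩ ?_
  · obtain ⟨n, hn⟩ := (eventually_map.1 hc).exists
    refine hn.trans ?_
    refine div_le_one_of_le₀ ?_ n.cast_nonneg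
    have := ncard_le_ncard (inter_subset_right : G ∩ Icc 1 n ⊆ Icc 1 n) (finite_Icc 1 n)
    rw [hcard] at this
    exact_mod_cast this
  · filter_upwards [ha, hb, eventually_gt_atTop 0] with n ha hb hn
    have hn' : (0:ℝ) < n := by exact_mod_cast hn
    have hsub : Icc 1 n ⊆ (G ∩ Icc 1 n) ∪ ((Pa ∩ Icc 1 n) ∪ (Pb ∩ Icc 1 n)) := by
      intro k hk
      by_cases h1 : ((a + k * β : ℝ) : 𝕊) ∈ K
      · exact Or.inr (Or.inl ⟨h1, hk⟩)
      by_cases h2 : ((b + k * β : ℝ) : 𝕊) ∈ K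
      · exact Or.inr (Or.inr ⟨h2, hk⟩)
      exact Or.inl ⟨⟨h1, h2⟩, hk⟩
    have h1 := ncard_le_ncard hsub ((hfin _ n).union ((hfin _ n).union (hfin _ n)))
    have h2 := ncard_union_le (G ∩ Icc 1 n) ((Pa ∩ Icc 1 n) ∪ (Pb ∩ Icc 1 n))
    have h3 := ncard_union_le (Pa ∩ Icc 1 n) (Pb ∩ Icc 1 n)
    rw [hcard] at h1
    have h4 : (n : ℝ) ≤ (G ∩ Icc 1 n).ncard + ((Pa ∩ Icc 1 n).ncard + (Pb ∩ Icc 1 n).ncard) := by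
      exact_mod_cast h1.trans (h2.trans (by omega))
    rw [le_div_iff₀ hn']
    linarith

/-- Forward orbits of irrational rotations are dense. -/
theorem exists_nat_int_mem_Ioo {β : ℝ} (hβ : Irrational β) (t : ℝ) {c d : ℝ} (hcd : c < d) :
    ∃ (j : ℕ) (i : ℤ), t + j * β + i ∈ Ioo c d := by
  set U : Set 𝕊 := (fun r : ℝ => (r : 𝕊)) '' Ioo c d with hU
  have hUo : IsOpen U := isOpenQuotientMap_coe_circle.isOpenMap _ isOpen_Ioo
  have hpos : 0 < AddCircle.haarAddCircle U :=
    hUo.measure_pos _ ((nonempty_Ioo.2 hcd).image _)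
  have hlt : AddCircle.haarAddCircle Uᶜ < ENNReal.ofReal 1 := by
    rw [MeasureTheory.prob_compl_eq_one_sub hUo.measurableSet, ENNReal.ofReal_one]
    exact ENNReal.sub_lt_self ENNReal.one_ne_top one_ne_zero hpos.ne'
  obtain ⟨δ, hδ0, h1, h2⟩ := ENNReal.lt_iff_exists_real_btwn.1 hlt
  have hδ1 : δ < 1 := (ENNReal.ofReal_lt_ofReal_iff one_pos).1 h2
  have hδ : 0 < δ := ENNReal.ofReal_pos.1 ((zero_le).trans_lt h1)
  obtain ⟨n, hn, hn0⟩ := ((eventually_card_visits_le hβ t hUo.isClosed_compl hδ h1).and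
    (eventually_gt_atTop 0)).exists
  by_contra! hcon
  have hall : {k : ℕ | ((t + k * β : ℝ) : 𝕊) ∈ Uᶜ} ∩ Icc 1 n = Icc 1 n := by
    refine inter_eq_right.2 fun k _ => ?_
    rintro ⟨r, hr, hrk⟩
    obtain ⟨i, hi⟩ := coe_eq_coe_iff.1 hrk
    exact hcon k i (hi ▸ hr)
  rw [hall, ← Finset.coe_Icc, ncard_coe_finset, Nat.card_Icc, Nat.add_sub_cancel] at hn
  have hn' : (0:ℝ) < n := by exact_mod_cast hn0
  nlinarith

theorem isPreconnected_ball_annulus (z : 𝔸) (ε : ℝ) : IsPreconnected (ball z ε) := by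
  obtain ⟨a, b⟩ := z
  rw [← ball_prod_same]
  refine IsPreconnected.prod ?_ (convex_ball b ε).isPreconnected
  obtain ⟨a, rfl⟩ := QuotientAddGroup.mk_surjective a
  have : ball ((a : ℝ) : 𝕊) ε = (fun r : ℝ => (r : 𝕊)) '' ball a ε := by
    ext w
    constructor
    · intro hw
      rw [mem_ball, dist_eq_norm] at hw
      obtain ⟨m, hm, hmlt⟩ := QuotientAddGroup.exists_norm_mk_lt (w - ((a : ℝ) : 𝕊))
        (sub_pos.2 hw)
      refine ⟨m + a, ?_, ?_⟩
      · rw [mem_ball, Real.dist_eq, add_sub_cancel_right]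
        simpa using hmlt
      · show ((m + a : ℝ) : 𝕊) = w
        rw [AddCircle.coe_add]
        exact eq_sub_iff_add_eq.1 hm
    · rintro ⟨r, hr, rfl⟩
      rw [mem_ball, dist_eq_norm] at hr ⊢
      exact (QuotientAddGroup.norm_mk_le_norm (m := r - a)).trans_lt hr
  exact this ▸ (convex_ball a ε).isPreconnected.image _ (AddCircle.continuous_mk' 1).continuousOn

/-- A ball meeting an open set `W` but not contained in it meets the frontier. -/
theorem infDist_lt_of_mem_of_notMem {W Γ : Set 𝔸} (hW : IsOpen W) (hWΓ : IsClosed (W ∪ Γ))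
    {z w : 𝔸} {ε : ℝ} (hw : w ∈ ball z ε) (hz : z ∈ W) (hwW : w ∉ W) : infDist z Γ < ε := by
  have hε : 0 < ε := pos_of_mem_ball hw
  obtain ⟨v, hv, hvΓ⟩ : (ball z ε ∩ Γ).Nonempty := by
    by_contra hne
    rw [not_nonempty_iff_eq_empty, ← disjoint_iff_inter_eq_empty] at hne
    have hcov : ball z ε ⊆ W ∪ (W ∪ Γ)ᶜ := fun v hv => by
      by_cases h : v ∈ W
      · exact Or.inl h
      · exact Or.inr fun h' => h'.elim h (disjoint_left.1 hne hv)
    obtain ⟨v, -, hv1, hv2⟩ := isPreconnected_ball_annulus z ε W _ hW hWΓ.isOpen_compl hcov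
      ⟨z, mem_ball_self hε, hz⟩ ⟨w, hw, (hcov hw).resolve_left hwW⟩
    exact hv2 (Or.inl hv1)
  exact (infDist_le_dist_of_mem hvΓ).trans_lt (by rwa [dist_comm])

theorem tendsto_birkhoffSum_div_iterate {X : Type*} {f : X → X} {φ : X → ℝ} {z : X} {ρ : ℝ}
    (hz : Tendsto (fun n : ℕ => birkhoffSum f φ n z / n) atTop (𝓝 ρ)) (j : ℕ) :
    Tendsto (fun n : ℕ => birkhoffSum f φ n (f^[j] z) / n) atTop (𝓝 ρ) := by
  have hinv : Tendsto (fun n : ℕ => ((n : ℝ)⁻¹)) atTop (𝓝 0) := tendsto_inv_atTop_nhds_zero_nat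
  have h1 : Tendsto (fun n : ℕ => birkhoffSum f φ (j + n) z / (j + n : ℕ)) atTop (𝓝 ρ) :=
    by
    have h0 : Tendsto (fun n : ℕ => j + n) atTop atTop := tendsto_atTop_mono
      (fun n => Nat.le_add_left n j) tendsto_id
    exact hz.comp h0
  have h2 := (h1.mul ((hinv.const_mul (j : ℝ)).add_const 1)).sub
    (hinv.const_mul (birkhoffSum f φ j z))
  simp only [mul_zero, zero_add, mul_one, sub_zero] at h2
  refine h2.congr' ?_
  filter_upwards [eventually_gt_atTop 0] with n hn
  have hn' : (n : ℝ) ≠ 0 := by exact_mod_cast hn.ne'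
  have hjn : ((j + n : ℕ) : ℝ) ≠ 0 := by positivity
  have h3 : (j : ℝ) * (n : ℝ)⁻¹ + 1 = ((j + n : ℕ) : ℝ) * (n : ℝ)⁻¹ := by
    push_cast
    rw [add_mul, mul_inv_cancel₀ hn']
  rw [birkhoffSum_add, h3, ← mul_assoc, div_mul_cancel₀ _ hjn, ← sub_mul, add_sub_cancel_left,
    div_eq_mul_inv]

theorem height_iterate {X : Type*} {u : X → ℝ} {g : X → X} {β : ℝ}
    (hu : ∀ z, u (g z) = u z + β) (n : ℕ) (z : X) : u (g^[n] z) = u z + n * β := by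
  induction n with
  | zero => simp
  | succ n ih =>
    rw [iterate_succ_apply', hu, ih]
    push_cast
    ring

theorem isHomeomorph_iterate {X : Type*} [TopologicalSpace X] {g : X → X} (hg : IsHomeomorph g)
    (n : ℕ) : IsHomeomorph g^[n] := by
  induction n with
  | zero => exact IsHomeomorph.id
  | succ n ih => exact ih.comp hg


theorem key_lemma_for_extensions
    (f : 𝕋2 → 𝕋2) (hf : IsHomeomorph f)
    (hhtpy : ContinuousMap.Homotopic ⟨f, hf.continuous⟩ (ContinuousMap.id 𝕋2))
    (h : 𝕋2 → 𝕊) (hh : IsHorizontalMap h)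
    (α₀ : ℝ) (hα₀ : Irrational α₀)
    (hsemi : ∀ z, h (f z) = h z + (α₀ : 𝕊))
    -- `f̂` is a lift of `f` to the annulus:
    (fh : 𝔸 → 𝔸) (hfh : IsHomeomorph fh)
    (hliftθ : ∀ z, θ (fh z) = f (θ z))
    (hfhT2 : ∀ z : 𝔸, fh (z.1, z.2 + 1) = ((fh z).1, (fh z).2 + 1))
    -- `F` is a lift of `f̂` to the plane:
    (F : ℝ × ℝ → ℝ × ℝ) (hF : IsHomeomorph F)
    (hliftτ : ∀ p, τ (F p) = fh (τ p))
    (hFT1 : ∀ p : ℝ × ℝ, F (p + (1, 0)) = F p + (1, 0))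
    -- the rotation set is `[ρ⁻, ρ⁺] × {α}`:
    (ρm ρp α : ℝ)
    (hrot : rotSet F = Set.Icc ρm ρp ×ˢ ({α} : Set ℝ)) :
    ∃ B > (0:ℝ), ∀ δ > (0:ℝ), ∀ ε > (0:ℝ),
      ∃ (A Γ : Set 𝔸) (x y : 𝔸) (G : Set ℕ),
        IsClosedEssentialAnnulus A ∧
        IsEssentialSimpleLoop Γ ∧ Γ ⊆ Aᶜ ∧ x ∈ Aᶜ ∧ y ∈ Aᶜ ∧
        -- (1) rotation vectors of `x` and `y`:
        (∀ xt : ℝ × ℝ, τ xt = x →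
          Tendsto (fun n : ℕ => (F^[n] xt - xt).1 / n) atTop (𝓝 ρm)) ∧
        (∀ yt : ℝ × ℝ, τ yt = y →
          Tendsto (fun n : ℕ => (F^[n] yt - yt).1 / n) atTop (𝓝 ρp)) ∧
        -- (2) for `n ∈ G`, the iterates of `x` and `y` are `ε`-close to `f̂ⁿ(γ)`:
        (∀ n ∈ G, infDist (fh^[n] x) (fh^[n] '' Γ) < ε ∧
                  infDist (fh^[n] y) (fh^[n] '' Γ) < ε) ∧
        -- (3) `G` has lower density at least `1 − δ`:
        1 - δ ≤ lowerDensity G ∧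
        -- (4) uniformly bounded vertical diameter:
        (∀ n : ℕ, Metric.diam (Prod.snd '' (fh^[n] '' A)) ≤ B) ∧
        -- (5) `A` separates `{x, y}` from `γ`, and the lower widths of the
        -- iterates of `A` are uniformly bounded below:
        (∀ z ∈ Γ, connectedComponentIn Aᶜ x ≠ connectedComponentIn Aᶜ z ∧
                  connectedComponentIn Aᶜ y ≠ connectedComponentIn Aᶜ z) ∧
        (∃ c > (0:ℝ), ∀ n : ℕ, c ≤ lw (fh^[n] '' A)) := by
  obtain ⟨u, β, hu, hβ, hu1, hsu, hpre⟩ :=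
    exists_normalized_height hh hα₀ hsemi hfh.continuous hliftθ
  obtain ⟨⟨C, hC⟩, huc⟩ := exists_height_bound hu hu1
  obtain ⟨φ, hφ, ⟨z₁, hz₁⟩, ⟨z₂, hz₂⟩⟩ :=
    exists_rotation_points hf.continuous hliftθ hF.continuous hliftτ hFT1
      (map_add_vertical hf.continuous hhtpy hliftθ hfhT2 hF.continuous hliftτ) hrot
  have hC0 : 0 ≤ C := (abs_nonneg _).trans (hC 0)
  refine ⟨2 * C + 2, by positivity, fun δ hδ ε hε => ?_⟩
  obtain ⟨η, hη, hη1, K, hK, hKδ, hgap⟩ := exists_gap hu hu1 hε (half_pos hδ)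
  obtain ⟨x₀, hx₀⟩ := isOpenQuotientMap_θ.surjective z₁
  obtain ⟨y, hy⟩ := isOpenQuotientMap_θ.surjective z₂
  obtain ⟨j, i, hji⟩ := exists_nat_int_mem_Ioo hβ (u x₀)
    (show u y < u y + η / 2 by linarith)
  have hiter := height_iterate hsu
  let x : 𝔸 := ((fh^[j] x₀).1, (fh^[j] x₀).2 + i)
  have hux : u x = u x₀ + j * β + i := by
    rw [← hiter]
    simpa using height_add_intCast (k := 1) hu1 i (fh^[j] x₀)
  have hx : θ x = f^[j] z₁ := by
    have h1 : θ x = θ (fh^[j] x₀) := θ_eq_θ_iff.2 ⟨i, rfl⟩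
    rw [h1, ← hx₀]
    exact (Semiconj.iterate_right (fun z => hliftθ z) j).eq x₀
  rw [← hux] at hji
  set s := u y + η with hs
  set s₁ := s - η / 2 with hs₁
  obtain ⟨A, Γ, W, hA, hΓ, hΓA, hW, hWΓ, hlow, hWs, hAs, hsep, c, hc, hlw⟩ :=
    exists_annulus_and_loop huc hC (s := s) (s₁ := s₁) (by linarith) (hpre s).1 (hpre s).2
  have hxs : u x ≤ s₁ := by linarith [hji.2]
  have hys : u y ≤ s₁ := by linarith
  have hnA : ∀ z, u z ≤ s₁ → z ∈ Aᶜ := fun z hz hzA => (hAs hzA).1.not_ge hz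
  have hclose : ∀ z, u y ≤ u z → u z ≤ s₁ → ∀ n : ℕ, ((u z + n * β : ℝ) : 𝕊) ∉ K →
      infDist (fh^[n] z) (fh^[n] '' Γ) < ε := by
    intro z hyz hz n hn
    rw [← hiter] at hn
    obtain ⟨w, hw, huw⟩ := hgap _ hn
    have hg := isHomeomorph_iterate hfh n
    refine infDist_lt_of_mem_of_notMem (W := fh^[n] '' W) (hg.isOpenMap _ hW) ?_ hw
      (mem_image_of_mem _ (hlow hz)) ?_
    · rw [← image_union]
      exact hg.isClosedMap _ hWΓ
    · rintro ⟨v, hv, rfl⟩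
      have hvs : u v < s := hWs hv
      rw [hiter, hiter] at huw
      linarith
  refine ⟨A, Γ, x, y, {n : ℕ | ((u x + n * β : ℝ) : 𝕊) ∉ K ∧ ((u y + n * β : ℝ) : 𝕊) ∉ K},
    hA, hΓ, hΓA, hnA x hxs, hnA y hys, fun xt hxt => ?_, fun yt hyt => ?_,
    fun n hn => ⟨hclose x hji.1.le hxs n hn.1, hclose y le_rfl hys n hn.2⟩,
    le_lowerDensity_avoiding hβ _ _ hK hδ hKδ, fun n => ?_,
    fun z hz => ⟨hsep x hxs z hz, hsep y hys z hz⟩, c, hc, fun n =>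
      hlw _ (isHomeomorph_iterate hfh n) (n * β) (hiter n)⟩
  · simp only [hφ, hxt, hx]
    exact tendsto_birkhoffSum_div_iterate hz₁ j
  · simp only [hφ, hyt, hy]
    exact hz₂
  · refine Metric.diam_le_of_forall_dist_le (by positivity) ?_
    rintro _ ⟨_, ⟨a, ha, rfl⟩, rfl⟩ _ ⟨_, ⟨b, hb, rfl⟩, rfl⟩
    have h1 := abs_le.1 (hC (fh^[n] a))
    have h2 := abs_le.1 (hC (fh^[n] b))
    rw [hiter] at h1 h2
    obtain ⟨ha1, ha2⟩ := hAs ha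
    obtain ⟨hb1, hb2⟩ := hAs hb
    rw [Real.dist_eq, abs_le]
    constructor <;> linarith [h1.1, h1.2, h2.1, h2.2]
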